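/- Fix an integer d ≥ 3 and a finite set M. If μ ∈ I_d(M) is a weakly typical process, then its annealed entropy satisfies Σ(μ) ≥ 0. -/

import Mathlib

open MeasureTheory Filter Topology
open scoped ENNReal Classical

noncomputable section

namespace TreeEntropy

@[ext]
structure RCG (M : Type*) where
  col : List ℕ → Option M
  adj : List ℕ × List ℕ → Bool

variable {M : Type*}

def resS (r : ℕ) (g : RCG M) : RCG M where
  col l := if l.length ≤ r then g.col l else none
  adj p := if p.1.length ≤ r ∧ p.2.length ≤ r then g.adj p else false

def rcgDist (g g' : RCG M) : ℝ :=
  ∑' r : ℕ, if resS r g = resS r g' then 0 else (2:ℝ)⁻¹ ^ r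

private lemma rcg_summable (a b : RCG M) : Summable
    (fun r : ℕ => if resS r a = resS r b then (0:ℝ) else (2:ℝ)⁻¹ ^ r) := by
  refine Summable.of_nonneg_of_le (fun r => ?_) (fun r => ?_)
    (summable_geometric_of_lt_one (by norm_num) (by norm_num : (2:ℝ)⁻¹ < 1))
  · split
    · exact le_rfl
    · positivity
  · split
    · positivity
    · exact le_rfl

private lemma rcg_nonneg (a b : RCG M) (r : ℕ) :
    (0:ℝ) ≤ if resS r a = resS r b then (0:ℝ) else (2:ℝ)⁻¹ ^ r := by
  split
  · exact le_rfl
  · positivity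

private lemma rcgDist_self (g : RCG M) : rcgDist g g = 0 := by simp [rcgDist]

private lemma rcgDist_comm (g g' : RCG M) : rcgDist g g' = rcgDist g' g :=
  tsum_congr fun r => if_congr eq_comm rfl rfl

private lemma rcgDist_triangle (g₁ g₂ g₃ : RCG M) :
    rcgDist g₁ g₃ ≤ rcgDist g₁ g₂ + rcgDist g₂ g₃ := by
  unfold rcgDist
  rw [← Summable.tsum_add (rcg_summable _ _) (rcg_summable _ _)]
  refine Summable.tsum_le_tsum (fun r => ?_) (rcg_summable _ _)
    ((rcg_summable _ _).add (rcg_summable _ _))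
  have hx : (0:ℝ) ≤ (2:ℝ)⁻¹ ^ r := by positivity
  by_cases h12 : resS r g₁ = resS r g₂
  · by_cases h23 : resS r g₂ = resS r g₃
    · rw [if_pos h12, if_pos h23, if_pos (h12.trans h23)]; linarith
    · rw [if_pos h12, if_neg h23, zero_add]
      split_ifs <;> linarith
  · by_cases h23 : resS r g₂ = resS r g₃
    · rw [if_neg h12, if_pos h23, add_zero]
      split_ifs <;> linarith
    · rw [if_neg h12, if_neg h23]
      split_ifs <;> linarith

private lemma rcgDist_eq_zero (g g' : RCG M) (h : rcgDist g g' = 0) : g = g' := by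
  unfold rcgDist at h
  have hr : ∀ r : ℕ, resS r g = resS r g' := by
    intro r
    by_contra hne
    have hpos : (0:ℝ) <
        ∑' r : ℕ, if resS r g = resS r g' then (0:ℝ) else (2:ℝ)⁻¹ ^ r :=
      Summable.tsum_pos (rcg_summable g g') (rcg_nonneg g g') r
        (by rw [if_neg hne]; positivity)
    exact absurd h hpos.ne'
  have hc : g.col = g'.col := by
    funext l
    have h1 := congrFun (congrArg RCG.col (hr l.length)) l
    simpa [resS] using h1
  have ha : g.adj = g'.adj := by
    funext p
    have h1 := congrFun (congrArg RCG.adj (hr (max p.1.length p.2.length))) p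
    simpa [resS, le_max_left, le_max_right] using h1
  exact RCG.ext hc ha

instance : MetricSpace (RCG M) where
  dist := rcgDist
  dist_self := rcgDist_self
  dist_comm := rcgDist_comm
  dist_triangle := rcgDist_triangle
  eq_of_dist_eq_zero := rcgDist_eq_zero _ _

instance : MeasurableSpace (RCG M) := borel _
instance : BorelSpace (RCG M) := ⟨rfl⟩


/-! ### The `d`-regular tree `T_d` -/

/-- A list `l = [i_k, …, i_1]` (deepest step first) is the breadth-first-search label of a
vertex of the `d`-regular tree `T_d` iff its first (root-side) step lies in `{1, …, d}` and all
subsequent steps lie in `{1, …, d-1}`. -/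
def ValidTd (d : ℕ) (l : List ℕ) : Prop :=
  (∀ i ∈ l.dropLast, 1 ≤ i ∧ i ≤ d - 1) ∧ (∀ i ∈ l.getLast?, 1 ≤ i ∧ i ≤ d)

/-- The vertex set of the `d`-regular tree `T_d`. -/
def TdVertex (d : ℕ) : Type := {l : List ℕ // ValidTd d l}

/-- The root `o` of `T_d`. -/
def rootTd (d : ℕ) : TdVertex d := ⟨[], by constructor <;> simp [List.getLast?]⟩

/-- The first neighbor `1` of the root of `T_d` (defined as the root for the degenerate case
`d = 0`, which never occurs below). -/
def node1 (d : ℕ) : TdVertex d :=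
  if h : 1 ≤ d then ⟨[1], by constructor <;> simp [List.getLast?, h]⟩ else rootTd d

/-- The graph structure of the `d`-regular tree: two vertices are adjacent iff one is obtained
from the other by adding one step. -/
def TdGraph (d : ℕ) : SimpleGraph (TdVertex d) where
  Adj v w := (∃ i, w.1 = i :: v.1) ∨ (∃ i, v.1 = i :: w.1)
  symm := by constructor; intro v w h; tauto
  loopless := by
    constructor
    rintro v (⟨i, h⟩ | ⟨i, h⟩) <;>
      · have := congrArg List.length h
        simp at this

/-- Graph distance between two vertices of a tree encoded by their BFS labels: the nearest
common ancestor corresponds to the longest common suffix. -/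
def treeDist (u w : List ℕ) : ℕ :=
  ((u.reverse.zip w.reverse).takeWhile (fun p => p.1 = p.2)).length |> fun c =>
    (u.length - c) + (w.length - c)

/-- The ball `S_r = B_r(o)` of radius `r` around the root of `T_d`. -/
def SrSet (d r : ℕ) : Set (TdVertex d) := {v | v.1.length ≤ r}

/-- The set `E_r = B_{r-1}({o,1})` of vertices at distance at most `r-1` from the edge `{o,1}`
of `T_d` (for `r ≥ 1`). -/
def ErSet (d r : ℕ) : Set (TdVertex d) :=
  {v | v.1.length + 1 ≤ r ∨ (v.1.getLast? = some 1 ∧ v.1.length ≤ r)}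

lemma ErSet_subset_SrSet (d r : ℕ) : ErSet d r ⊆ SrSet d r := by
  rintro v (h | ⟨-, h⟩) <;> simp only [SrSet, Set.mem_setOf_eq] <;> omega

/-! ### Invariant processes on `T_d` and their entropies -/

variable (d : ℕ) (M : Type*)

/-- `I_d(M)`: the set of probability measures on `M^{T_d}` invariant under all automorphisms
of the tree `T_d`. -/
def InvMeas [MeasurableSpace M] : Set (Measure (TdVertex d → M)) :=
  {μ | IsProbabilityMeasure μ ∧
    ∀ φ : TdGraph d ≃g TdGraph d, μ.map (fun x => fun v => x (φ v)) = μ}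

variable {d M}

/-- The Shannon entropy of (the distribution of) a random variable with law `μ`, a measure
with countable support on a discrete space. -/
def shannon {α : Type*} [MeasurableSpace α] (μ : Measure α) : ℝ :=
  ∑' a : α, Real.negMulLog (μ {a}).toReal

/-- The restriction `X_S` of a process `X` on `T_d` to a subset `S` of the vertices:
the pushforward of its law. -/
def restrictTo [MeasurableSpace M] (S : Set (TdVertex d))
    (μ : Measure (TdVertex d → M)) : Measure (↥S → M) :=
  μ.map (fun x => fun v => x v.1)

/-- The annealed entropy `Σ_r(μ) = H(X_{S_r}) - (d/2) H(X_{E_r})`. -/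
def SigmaR [MeasurableSpace M] (d : ℕ) (r : ℕ) (μ : Measure (TdVertex d → M)) : ℝ :=
  shannon (restrictTo (SrSet d r) μ) - (d / 2 : ℝ) * shannon (restrictTo (ErSet d r) μ)

/-- The annealed entropy `Σ(μ) = lim_r Σ_r(μ)`: the limit of the non-increasing sequence
`r ↦ Σ_r(μ)` (`r ≥ 1`), as an extended real (the limit may be `-∞`). -/
def SigmaInf [MeasurableSpace M] (d : ℕ) (μ : Measure (TdVertex d → M)) : EReal :=
  ⨅ r : ℕ, ((SigmaR d (r + 1) μ : ℝ) : EReal)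

/-- `Σ_e(X) = (d/2) H(X_{E_1}) - (d-1) H(X_o)`. -/
def SigmaE [MeasurableSpace M] (d : ℕ) (μ : Measure (TdVertex d → M)) : ℝ :=
  (d / 2 : ℝ) * shannon (restrictTo (ErSet d 1) μ)
    - ((d : ℝ) - 1) * shannon (restrictTo ({rootTd d} : Set (TdVertex d)) μ)

/-! ### Markov processes on `T_d` -/

/-- The elementary cylinder event: the coloring takes the values prescribed by `y` on `S`. -/
def cylEvent (S : Set (TdVertex d)) (y : TdVertex d → M) : Set (TdVertex d → M) :=
  {x | ∀ v ∈ S, x v = y v}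

/-- The side of the edge `{u,w}` containing `u`, in the tree `T_d`. -/
def sideOf (u w : TdVertex d) : Set (TdVertex d) :=
  {v | treeDist v.1 u.1 < treeDist v.1 w.1}

/-- `B_{r-1}({u,w})`: the set of vertices at distance at most `r-1` from the edge `{u,w}`. -/
def edgeBall (r : ℕ) (u w : TdVertex d) : Set (TdVertex d) :=
  {v | treeDist v.1 u.1 + 1 ≤ r ∨ treeDist v.1 w.1 + 1 ≤ r}

/-- A probability measure on `M^{T_d}` is `r`-Markov on a subset `A` of `T_d` if, for every
edge `{u,w}` of `A`, conditioned on the value on the `(r-1)`-neighborhood of the edge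
(within `A`), the processes on the two sides of the edge (within `A`) are independent;
equivalently, the corresponding products of cylinder probabilities agree.  For `A` the whole
tree and `r = 1` this is the edge-Markov property. -/
def rMarkovOn [MeasurableSpace M] (r : ℕ) (A : Set (TdVertex d))
    (μ : Measure (TdVertex d → M)) : Prop :=
  ∀ u w : TdVertex d, u ∈ A → w ∈ A → (TdGraph d).Adj u w →
    ∀ F₁ F₂ : Finset (TdVertex d), ↑F₁ ⊆ sideOf u w ∩ A → ↑F₂ ⊆ sideOf w u ∩ A →
      ∀ y : TdVertex d → M,
        μ (cylEvent (↑F₁ ∪ ↑F₂ ∪ (edgeBall r u w ∩ A)) y)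
            * μ (cylEvent (edgeBall r u w ∩ A) y)
          = μ (cylEvent (↑F₁ ∪ (edgeBall r u w ∩ A)) y)
            * μ (cylEvent (↑F₂ ∪ (edgeBall r u w ∩ A)) y)

/-- A probability measure on `M^{T_d}` is `r`-Markov if, conditioned on the value on the
`(r-1)`-neighborhood of any edge, the processes on the two sides of the edge are
independent. -/
def rMarkov [MeasurableSpace M] (r : ℕ) (μ : Measure (TdVertex d → M)) : Prop :=
  rMarkovOn r Set.univ μ

/-- A probability measure on `M^{T_d}` is vertex-Markov if, conditioned on the value at a
vertex, the processes on the pending subtrees of that vertex are independent. -/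
def vertexMarkov [MeasurableSpace M] (μ : Measure (TdVertex d → M)) : Prop :=
  ∀ v : TdVertex d, ∀ k : ℕ, ∀ u : Fin k → TdVertex d,
    Function.Injective u → (∀ i, (TdGraph d).Adj v (u i)) →
    ∀ F : Fin k → Finset (TdVertex d), (∀ i, ↑(F i) ⊆ sideOf (u i) v) →
      ∀ y : TdVertex d → M,
        μ (cylEvent ((⋃ i, ↑(F i)) ∪ {v}) y) * (μ (cylEvent {v} y)) ^ (k - 1)
          = ∏ i : Fin k, μ (cylEvent (↑(F i) ∪ {v}) y)

/-- `X_{S_1}` is a vertex-Markov process on `S_1`: the values at the `d` neighbors of the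
root are conditionally independent given the value at the root. -/
def vertexMarkovOnS1 [MeasurableSpace M] (d : ℕ) (μ : Measure (TdVertex d → M)) : Prop :=
  ∀ y : TdVertex d → M,
    μ (cylEvent (SrSet d 1) y) * (μ (cylEvent ({rootTd d} : Set (TdVertex d)) y)) ^ (d - 1)
      = ∏ i ∈ Finset.Icc 1 d,
          μ (cylEvent {v : TdVertex d | v = rootTd d ∨ v.1 = [i]} y)


/-! ### The randomly labeled rooted colored graph associated to a finite colored graph

Given a finite colored graph `(G,f)` and a vertex `v`, the associated randomly labeled rooted
colored graph is obtained by a breadth-first search exploration of the connected component of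
`v` started at `v`, ties between vertices being broken uniformly at random.  We implement the
uniformly random tie-breaking by a uniformly random priority permutation `σ`. -/

variable {M : Type*} {n : ℕ}

/-- The `k`-th layer of the breadth-first search of `G` started at `v`, ordered according to
the position of the parents in the previous layer, ties being broken by the priority `σ`. -/
def bfsLayer (G : SimpleGraph (Fin n)) (v : Fin n) (σ : Equiv.Perm (Fin n)) :
    ℕ → List (Fin n)
  | 0 => [v]
  | (k + 1) =>
    let prev := bfsLayer G v σ k
    let key : Fin n → ℕ := fun w =>
      (prev.idxOf (((prev.find? (fun u => decide (G.Adj u w))).getD v))) * n + (σ w : ℕ)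
    ((List.finRange n).filter
        (fun w => decide (G.Reachable v w ∧ G.dist v w = k + 1))).mergeSort
      (fun a b => key a ≤ key b)

/-- The breadth-first-search label of the vertex `w` lying in layer `k` of the exploration of
`G` started at `v` with tie-breaking priority `σ`. -/
def bfsPathAux (G : SimpleGraph (Fin n)) (v : Fin n) (σ : Equiv.Perm (Fin n)) :
    ℕ → Fin n → Option (List ℕ)
  | 0, w => if w = v then some [] else none
  | (k + 1), w =>
    match (bfsLayer G v σ k).find? (fun u => decide (G.Adj u w)) with
    | none => none
    | some p =>
      let L := bfsLayer G v σ (k + 1)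
      let j := 1 + ((L.takeWhile (fun w' => w' ≠ w)).filter
        (fun w' => (bfsLayer G v σ k).find? (fun u => decide (G.Adj u w')) = some p)).length
      (bfsPathAux G v σ k p).map (fun pl => j :: pl)

/-- The breadth-first-search label of the vertex `w` in the exploration of the connected
component of `v` in `G`, with tie-breaking priority `σ` (`none` if `w` is not in the component
of `v`). -/
def bfsPath (G : SimpleGraph (Fin n)) (v : Fin n) (σ : Equiv.Perm (Fin n)) (w : Fin n) :
    Option (List ℕ) :=
  if G.Reachable v w then bfsPathAux G v σ (G.dist v w) w else none

/-- The rooted colored graph obtained from the colored graph `(G,f)` by the breadth-first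
search exploration of the connected component of `v` rooted at `v`, with tie-breaking
priority `σ`. -/
def bfsRCG (G : SimpleGraph (Fin n)) (f : Fin n → M) (v : Fin n) (σ : Equiv.Perm (Fin n)) :
    RCG M where
  col l := if h : ∃ w, bfsPath G v σ w = some l then some (f h.choose) else none
  adj p :=
    if (∃ w₁ w₂, bfsPath G v σ w₁ = some p.1 ∧ bfsPath G v σ w₂ = some p.2 ∧ G.Adj w₁ w₂)
    then true else false

/-- `distr_{G,v}(f)`: the law of the randomly labeled rooted colored graph obtained from the
connected component of `v` in the colored graph `(G,f)`, rooted at `v`. -/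
def distrAt (G : SimpleGraph (Fin n)) (f : Fin n → M) (v : Fin n) : Measure (RCG M) :=
  ((Nat.factorial n : ℝ≥0∞))⁻¹ •
    ∑ σ : Equiv.Perm (Fin n), Measure.dirac (bfsRCG G f v σ)

/-- `distr_G(f) = (1/|V|) ∑_{v ∈ V} distr_{G,v}(f)`. -/
def distrG (G : SimpleGraph (Fin n)) (f : Fin n → M) : Measure (RCG M) :=
  ((n : ℝ≥0∞))⁻¹ • ∑ v : Fin n, distrAt G f v

/-! ### Random regular graphs -/

/-- The set `𝓖_n(d)` of simple `d`-regular graphs on the vertex set `{1, …, n}`. -/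
def regularGraphs (d n : ℕ) : Set (SimpleGraph (Fin n)) :=
  {G | ∀ v, (G.neighborSet v).ncard = d}

/-- The probability that a uniformly distributed random `d`-regular graph `G_n` on `n`
vertices belongs to `A`. -/
def PrG (d n : ℕ) (A : Set (SimpleGraph (Fin n))) : ℝ :=
  ((regularGraphs d n ∩ A).ncard : ℝ) / ((regularGraphs d n).ncard : ℝ)

/-- The expectation of `F(G_n)` for a uniformly distributed random `d`-regular graph `G_n`
on `n` vertices. -/
def ExG (d n : ℕ) (F : SimpleGraph (Fin n) → ℝ) : ℝ :=
  (∑ᶠ G ∈ regularGraphs d n, F G) / ((regularGraphs d n).ncard : ℝ)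

/-- The integers `n` for which the set of simple `d`-regular graphs on `n` vertices is
non-empty: `n ≥ d + 1` and `nd` even.  Limits `n → ∞` are taken along this set. -/
def goodN (d : ℕ) : Set ℕ := {n | d + 1 ≤ n ∧ Even (n * d)}

/-- The filter `n → ∞` along `{n : n ≥ d+1, nd even}`. -/
def goodFilter (d : ℕ) : Filter ℕ := Filter.atTop ⊓ Filter.principal (goodN d)

/-! ### The embedding of invariant processes into rooted colored graphs -/

/-- The rooted colored graph `(T_d, x, o)` associated to a coloring `x` of `T_d` (the
canonical labeling of `T_d` is a breadth-first-search labeling; for an invariant process the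
resulting law is that of the randomly labeled rooted colored graph). -/
def iotaTd (d : ℕ) (x : TdVertex d → M) : RCG M where
  col l := if h : ValidTd d l then some (x ⟨l, h⟩) else none
  adj p :=
    if (ValidTd d p.1 ∧ ValidTd d p.2 ∧ ((∃ i, p.2 = i :: p.1) ∨ (∃ i, p.1 = i :: p.2)))
    then true else false

/-- The law, as a probability measure on rooted colored graphs, of the randomly labeled rooted
colored tree `(T_d, X, o)` where `X` has law `μ`. -/
def lawTd (d : ℕ) [MeasurableSpace M] (μ : Measure (TdVertex d → M)) : Measure (RCG M) :=
  μ.map (iotaTd d)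

/-! ### Micro-state (sofic) entropy -/

/-- `𝓕_G(μ,r,ε)`: the set of colorings `f` of `G` whose radius-`r` local statistics are
`ε`-close (in the Lévy-Prokhorov distance, which generates the weak topology) to the
radius-`r` restriction of `μ`. -/
def FSet (d : ℕ) [MeasurableSpace M] (μ : Measure (TdVertex d → M)) (r : ℕ) (ε : ℝ)
    (G : SimpleGraph (Fin n)) : Set (Fin n → M) :=
  {f | levyProkhorovDist ((distrG G f).map (resS r)) ((lawTd d μ).map (resS r)) ≤ ε}

/-- `H_{G}(μ,r,ε) = (1/n) log |𝓕_G(μ,r,ε)| ∈ {-∞} ∪ [0,∞)`. -/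
def HG (d : ℕ) [MeasurableSpace M] (μ : Measure (TdVertex d → M)) (r : ℕ) (ε : ℝ)
    (G : SimpleGraph (Fin n)) : EReal :=
  if FSet d μ r ε G = ∅ then ⊥
  else ((Real.log ((FSet d μ r ε G).ncard) / n : ℝ) : EReal)

/-- `h_n(μ,r,ε,α)`: the `α`-quantile
`sup { h ∈ {-∞} ∪ [0,∞) : ℙ(H_{G_n}(μ,r,ε) ≥ h) ≥ α }`. -/
def hquant (d : ℕ) [MeasurableSpace M] (μ : Measure (TdVertex d → M)) (r : ℕ) (ε : ℝ)
    (α : ℝ) (n : ℕ) : EReal :=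
  sSup {h : EReal | (h = ⊥ ∨ 0 ≤ h) ∧
    α ≤ PrG d n {G : SimpleGraph (Fin n) | h ≤ HG d μ r ε G}}

/-- The upper entropy `h̄(μ,r,α) = lim_{ε → 0} limsup_n h_n(μ,r,ε,α)` (the limit over `ε`
of a quantity non-decreasing in `ε`, i.e. the infimum over `ε > 0`). -/
def hbarA (d : ℕ) [MeasurableSpace M] (μ : Measure (TdVertex d → M)) (r : ℕ) (α : ℝ) :
    EReal :=
  ⨅ ε : {e : ℝ // 0 < e}, (goodFilter d).limsup (fun n => hquant d μ r ε.1 α n)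

/-- The lower entropy `h̲(μ,r,α) = lim_{ε → 0} liminf_n h_n(μ,r,ε,α)`. -/
def hlowA (d : ℕ) [MeasurableSpace M] (μ : Measure (TdVertex d → M)) (r : ℕ) (α : ℝ) :
    EReal :=
  ⨅ ε : {e : ℝ // 0 < e}, (goodFilter d).liminf (fun n => hquant d μ r ε.1 α n)

/-- `h̄(μ,r)`: the common value of `h̄(μ,r,α)`, `0 < α < 1`. -/
def hbarR (d : ℕ) [MeasurableSpace M] (μ : Measure (TdVertex d → M)) (r : ℕ) : EReal :=
  hbarA d μ r (1 / 2)

/-- `h̲(μ,r)`: the common value of `h̲(μ,r,α)`, `0 < α < 1`. -/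
def hlowR (d : ℕ) [MeasurableSpace M] (μ : Measure (TdVertex d → M)) (r : ℕ) : EReal :=
  hlowA d μ r (1 / 2)

/-- The upper sofic entropy `h̄(μ) = lim_{r → ∞} h̄(μ,r)` (the limit of a non-increasing
sequence, i.e. the infimum over `r`). -/
def hbar (d : ℕ) [MeasurableSpace M] (μ : Measure (TdVertex d → M)) : EReal :=
  ⨅ r : ℕ, hbarR d μ r

/-- The lower sofic entropy `h̲(μ) = lim_{r → ∞} h̲(μ,r)`. -/
def hlow (d : ℕ) [MeasurableSpace M] (μ : Measure (TdVertex d → M)) : EReal :=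
  ⨅ r : ℕ, hlowR d μ r

/-! ### Typical processes -/

/-- The probability that the random `d`-regular graph `G_n` admits a coloring whose local
statistics are `ε`-close to `μ`. -/
def typicalPr (d : ℕ) [MeasurableSpace M] (μ : Measure (TdVertex d → M)) (ε : ℝ) (n : ℕ) :
    ℝ :=
  PrG d n {G : SimpleGraph (Fin n) |
    ∃ f : Fin n → M, levyProkhorovDist (distrG G f) (lawTd d μ) ≤ ε}

/-- `μ ∈ I_d(M)` is weakly typical if
`lim_{ε → 0} limsup_{n → ∞} ℙ(∃ f : d(distr_{G_n}(f), μ) ≤ ε) = 1`. -/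
def WeaklyTypical (d : ℕ) [MeasurableSpace M] (μ : Measure (TdVertex d → M)) : Prop :=
  Tendsto (fun ε => (goodFilter d).limsup (fun n => typicalPr d μ ε n))
    (nhdsWithin 0 (Set.Ioi 0)) (nhds 1)

/-- `μ ∈ I_d(M)` is strongly typical if
`lim_{ε → 0} lim_{n → ∞} ℙ(∃ f : d(distr_{G_n}(f), μ) ≤ ε) = 1` (in particular the inner
limits along `n → ∞` exist). -/
def StronglyTypical (d : ℕ) [MeasurableSpace M] (μ : Measure (TdVertex d → M)) : Prop :=
  ∃ L : ℝ → ℝ,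
    (∀ ε : ℝ, 0 < ε → Tendsto (fun n => typicalPr d μ ε n) (goodFilter d) (nhds (L ε))) ∧
    Tendsto L (nhdsWithin 0 (Set.Ioi 0)) (nhds 1)


/-! ### Processes on balls of `T_d` and the sets `I_{d,r}(M)`, `I_e(M)` -/

/-- The ball `S_r` of `T_d` as an induced subgraph. -/
def SrGraph (d r : ℕ) : SimpleGraph ↥(SrSet d r) := (TdGraph d).induce (SrSet d r)

/-- The set `E_r` of `T_d` as an induced subgraph. -/
def ErGraph (d r : ℕ) : SimpleGraph ↥(ErSet d r) := (TdGraph d).induce (ErSet d r)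

lemma root_mem_Er (d r : ℕ) (hr : 1 ≤ r) : rootTd d ∈ ErSet d r := by
  left; simpa [rootTd] using hr

lemma node1_mem_Er (d r : ℕ) (hr : 1 ≤ r) : node1 d ∈ ErSet d r := by
  by_cases h : 1 ≤ d
  · right
    constructor <;> simp [node1, h, List.getLast?, hr]
  · simpa [node1, h] using root_mem_Er d r hr

variable {M : Type*}

/-- The restriction to `E_r ⊆ S_r` of a probability measure on `M^{S_r}`. -/
def restrictErOfSr [MeasurableSpace M] (d r : ℕ) (p : Measure (↥(SrSet d r) → M)) :
    Measure (↥(ErSet d r) → M) :=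
  p.map (fun x => fun v : ↥(ErSet d r) => x ⟨v.1, ErSet_subset_SrSet d r v.2⟩)

/-- `I_{d,r}(M)`: the set of probability measures on `M^{S_r}` which are invariant under the
automorphisms of `S_r` and whose restriction to `E_r` is invariant under switching the two
sides of the edge `{o,1}`. -/
def IdrMeas (d r : ℕ) (M : Type*) [MeasurableSpace M] :
    Set (Measure (↥(SrSet d r) → M)) :=
  {p | IsProbabilityMeasure p ∧
    (∀ φ : SrGraph d r ≃g SrGraph d r, p.map (fun x => fun v => x (φ v)) = p) ∧
    (∀ ψ : ErGraph d r ≃g ErGraph d r,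
      (∀ hv : rootTd d ∈ ErSet d r, ((ψ ⟨rootTd d, hv⟩ : ↥(ErSet d r)) : TdVertex d) = node1 d) →
      (restrictErOfSr d r p).map (fun x => fun v => x (ψ v)) = restrictErOfSr d r p)}

/-- The annealed entropy `Σ(p) = H(X_{S_r}) - (d/2) H(X_{E_r})` of `p ∈ I_{d,r}(M)`. -/
def SigmaP [MeasurableSpace M] (d r : ℕ) (p : Measure (↥(SrSet d r) → M)) : ℝ :=
  shannon p - (d / 2 : ℝ) * shannon (restrictErOfSr d r p)

/-- The involution of `E_1 = {o, 1}` switching the two sides of the edge `{o,1}`. -/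
def swapE1 (d : ℕ) : ↥(ErSet d 1) → ↥(ErSet d 1) := fun v =>
  if (v : TdVertex d) = rootTd d then ⟨node1 d, node1_mem_Er d 1 le_rfl⟩
  else ⟨rootTd d, root_mem_Er d 1 le_rfl⟩

/-- `I_e(M)`: the set of probability measures on `M^{E_1}` invariant under switching the two
sides of the edge `{o,1}`. -/
def IeMeas (d : ℕ) (M : Type*) [MeasurableSpace M] : Set (Measure (↥(ErSet d 1) → M)) :=
  {p | IsProbabilityMeasure p ∧ p.map (fun x => fun v => x (swapE1 d v)) = p}

/-- The annealed entropy `Σ(p) = (d/2) H(X_{E_1}) - (d-1) H(X_o)` of `p ∈ I_e(M)`. -/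
def SigmaPe [MeasurableSpace M] (d : ℕ) (p : Measure (↥(ErSet d 1) → M)) : ℝ :=
  (d / 2 : ℝ) * shannon p
    - ((d : ℝ) - 1) * shannon (p.map (fun x => x ⟨rootTd d, root_mem_Er d 1 le_rfl⟩))

/-! ### Factor graphs: functions of rooted unlabeled colored graphs of radius `r` -/

/-- The vertex set of a rooted colored graph. -/
def vertsOf (g : RCG M) : Set (List ℕ) := {l | g.col l ≠ none}

/-- An isomorphism of rooted colored graphs (a color- and adjacency-preserving bijection of
the vertex sets mapping root to root). -/
def RCGRootedIso (g g' : RCG M) : Prop :=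
  ∃ e : ↥(vertsOf g) ≃ ↥(vertsOf g'),
    (∀ v, g'.col ((e v) : List ℕ) = g.col (v : List ℕ)) ∧
    (∀ v w, g'.adj (((e v) : List ℕ), ((e w) : List ℕ)) = g.adj ((v : List ℕ), (w : List ℕ))) ∧
    (∀ h : [] ∈ vertsOf g, ∀ _ : [] ∈ vertsOf g', ((e ⟨[], h⟩) : List ℕ) = [])

/-- A function on rooted unlabeled colored graphs of radius `r`: a function of rooted colored
graphs which only depends on the isomorphism class of the ball of radius `r` around the
root. -/
def IsRadiusRFn (r : ℕ) (ψ : RCG M → ℝ) : Prop :=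
  ∀ g g' : RCG M, RCGRootedIso (resS r g) (resS r g') → ψ g = ψ g'

/-- The value `ψ((G,f,v)_r)` of `ψ` at the rooted unlabeled colored graph given by the ball of
radius `r` around `v` in `(G,f)` (computed as the average over the random labelings, which is
the constant value of `ψ` on them when `ψ` is a function of the unlabeled graph). -/
def psiAt {n : ℕ} (G : SimpleGraph (Fin n)) (f : Fin n → M) (v : Fin n) (ψ : RCG M → ℝ) :
    ℝ :=
  ∫ g, ψ g ∂(distrAt G f v)

/-- The partition function `Z_G = ∑_f ∏_v exp(ψ((G,f,v)_r))` of the factor model `ψ`. -/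
def ZG {n : ℕ} [Fintype M] (G : SimpleGraph (Fin n)) (ψ : RCG M → ℝ) : ℝ :=
  ∑ f : Fin n → M, Real.exp (∑ v : Fin n, psiAt G f v ψ)

/-- The ground-state energy `L_G = max_f ∑_v ψ((G,f,v)_r)`. -/
def LG {n : ℕ} (G : SimpleGraph (Fin n)) (ψ : RCG M → ℝ) : ℝ :=
  sSup {x : ℝ | ∃ f : Fin n → M, x = ∑ v : Fin n, psiAt G f v ψ}

/-- The canonical rooted colored graph associated to a coloring of the ball `S_r` of `T_d`. -/
def iotaSr (d r : ℕ) (x : ↥(SrSet d r) → M) : RCG M where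
  col l := if h : ValidTd d l ∧ l.length ≤ r then some (x ⟨⟨l, h.1⟩, h.2⟩) else none
  adj p := if (ValidTd d p.1 ∧ ValidTd d p.2 ∧ p.1.length ≤ r ∧ p.2.length ≤ r ∧
      ((∃ i, p.2 = i :: p.1) ∨ (∃ i, p.1 = i :: p.2))) then true else false

/-- `⟨p, ψ⟩ = E[ψ(X)]` where `X` has law `p ∈ I_{d,r}(M)`. -/
def pairing [MeasurableSpace M] (d r : ℕ) (p : Measure (↥(SrSet d r) → M))
    (ψ : RCG M → ℝ) : ℝ :=
  ∫ x, ψ (iotaSr d r x) ∂p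

/-! ### Annealed quantities for random regular graphs -/

/-- `log` with the convention `log 0 = -∞`, with values in the extended reals. -/
def elog (x : ℝ) : EReal := if x ≤ 0 then ⊥ else ((Real.log x : ℝ) : EReal)

/-- The set `𝓖_n(μ,r,ε)` of pairs `(G,f)` of a `d`-regular graph together with a coloring
whose radius-`r` local statistics are `ε`-close to `μ_r`. -/
def GnPairs (d : ℕ) [MeasurableSpace M] (μ : Measure (TdVertex d → M)) (r : ℕ) (ε : ℝ)
    (n : ℕ) : Set (SimpleGraph (Fin n) × (Fin n → M)) :=
  {Gf | Gf.1 ∈ regularGraphs d n ∧ Gf.2 ∈ FSet d μ r ε Gf.1}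

/-- The annealed entropy
`Σ_n(μ,r,ε) = (1/n) (log |𝓖_n(μ,r,ε)| - log |𝓖_n(d)|) = (1/n) log E |𝓕_{G_n}(μ,r,ε)|`. -/
def SigmaN (d : ℕ) [MeasurableSpace M] (μ : Measure (TdVertex d → M)) (r : ℕ) (ε : ℝ)
    (n : ℕ) : EReal :=
  (((n : ℝ)⁻¹ : ℝ) : EReal) *
    elog (((GnPairs d μ r ε n).ncard : ℝ) / ((regularGraphs d n).ncard : ℝ))

/-- The relaxed partition function `Z_G(β) = ∑_f exp(-nβ d(distr_G(f)_r, μ_r))`. -/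
def ZGbeta (d : ℕ) [MeasurableSpace M] {n : ℕ} [Fintype M] (μ : Measure (TdVertex d → M))
    (r : ℕ) (β : ℝ) (G : SimpleGraph (Fin n)) : ℝ :=
  ∑ f : Fin n → M, Real.exp (-(n : ℝ) * β *
    levyProkhorovDist ((distrG G f).map (resS r)) ((lawTd d μ).map (resS r)))


/-! ### Processes on unimodular Galton-Watson trees

A colored rooted tree `(T, X, o)` with `T` a subtree of the label set, rooted at `[]` and
with the children of a vertex `v` labeled `1 :: v, …, N_v :: v`, is encoded as a rooted
colored graph in `RCG M`. -/

/-- `g` is a canonically labeled colored rooted tree. -/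
def IsCanonTree (g : RCG M) : Prop :=
  g.col [] ≠ none ∧
  (∀ l : List ℕ, g.col l ≠ none → g.col l.tail ≠ none) ∧
  (∀ (v : List ℕ) (i : ℕ), 1 ≤ i → g.col ((i + 1) :: v) ≠ none → g.col (i :: v) ≠ none) ∧
  (∀ v : List ℕ, g.col (0 :: v) = none) ∧
  (∀ p : List ℕ × List ℕ, g.adj p = true ↔
    (g.col p.1 ≠ none ∧ g.col p.2 ≠ none ∧
      ((∃ i, p.2 = i :: p.1) ∨ (∃ i, p.1 = i :: p.2))))

/-- A finite canonically labeled tree. -/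
def IsFinTree (t : Finset (List ℕ)) : Prop :=
  [] ∈ t ∧ (∀ l ∈ t, l.tail ∈ t) ∧
  (∀ (v : List ℕ) (i : ℕ), 1 ≤ i → ((i + 1) :: v) ∈ t → (i :: v) ∈ t) ∧
  (∀ v : List ℕ, (0 :: v) ∉ t)

/-- The number of children of the vertex `v` in the finite tree `t`. -/
def childCountF (t : Finset (List ℕ)) (v : List ℕ) : ℕ :=
  (t.filter (fun w => w ≠ [] ∧ w.tail = v)).card

/-- The size-biased version `π̂(k) = (k+1) π(k+1) / d` of the offspring distribution `π`. -/
def sizeBiased (π : ℕ → ℝ) (dd : ℝ) (k : ℕ) : ℝ := (k + 1 : ℝ) * π (k + 1) / dd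

/-- The probability that the unimodular Galton-Watson tree with degree distribution `π`,
truncated at depth `k`, equals the finite tree `t`. -/
def treeWeight (π : ℕ → ℝ) (dd : ℝ) (k : ℕ) (t : Finset (List ℕ)) : ℝ :=
  π (childCountF t []) *
    ∏ v ∈ t.filter (fun v => v ≠ [] ∧ v.length < k), sizeBiased π dd (childCountF t v)

/-- The law of the underlying tree is the unimodular Galton-Watson law `UGW(π)`:
all finite-depth truncations have the prescribed distribution. -/
def IsUGWTreeLaw (π : ℕ → ℝ) (dd : ℝ) (μ : Measure (RCG M)) : Prop :=
  ∀ (k : ℕ) (t : Finset (List ℕ)), IsFinTree t → (∀ v ∈ t, v.length ≤ k) →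
    (μ {g | ∀ l : List ℕ, l.length ≤ k → (g.col l ≠ none ↔ l ∈ t)}).toReal
      = treeWeight π dd k t

/-- `e` realizes an isomorphism (not necessarily root-preserving) of the colored graphs `g`
and `g'`. -/
def IsIsoVia (g g' : RCG M) (e : List ℕ → List ℕ) : Prop :=
  Set.BijOn e (vertsOf g) (vertsOf g') ∧
  (∀ l ∈ vertsOf g, g'.col (e l) = g.col l) ∧
  (∀ l ∈ vertsOf g, ∀ l' ∈ vertsOf g, g'.adj (e l, e l') = g.adj (l, l'))

/-- A function on doubly rooted colored graphs, invariant under isomorphisms. -/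
def PairInvariant (F : RCG M → List ℕ → List ℕ → ℝ≥0∞) : Prop :=
  ∀ g g' e, IsIsoVia g g' e → ∀ u ∈ vertsOf g, ∀ v ∈ vertsOf g, F g' (e u) (e v) = F g u v

/-- Unimodularity (the mass-transport principle):
`E ∑_v F(G,o,v) = E ∑_v F(G,v,o)` for all isomorphism-invariant `F ≥ 0`. -/
def Unimodular (μ : Measure (RCG M)) : Prop :=
  ∀ F : RCG M → List ℕ → List ℕ → ℝ≥0∞, PairInvariant F →
    ∫⁻ g, (∑' v : ↥(vertsOf g), F g [] (v : List ℕ)) ∂μ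
      = ∫⁻ g, (∑' v : ↥(vertsOf g), F g (v : List ℕ) []) ∂μ

/-- `I_π(M)`: the laws of invariant (unimodular) processes `(T,X)` with colors in `M` over
the unimodular Galton-Watson tree with degree distribution `π` (of mean `dd`). -/
def IPiMeas (π : ℕ → ℝ) (dd : ℝ) (M : Type*) [MeasurableSpace M] :
    Set (Measure (RCG M)) :=
  {μ | IsProbabilityMeasure μ ∧ μ {g | IsCanonTree g} = 1 ∧ Unimodular μ ∧
    IsUGWTreeLaw π dd μ}

/-- The root degree `deg(o)` of a canonically labeled tree (the number of children of the
root). -/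
def rootDeg (g : RCG M) : ℕ := {i : ℕ | g.col [i] ≠ none}.ncard

/-- The edge-biased law `→μ(⬝) = (1/d) E[deg(o) 1{(T,X,(o,1)) ∈ ⬝}]` on colored edge-rooted
trees (the root edge being `([], [1])`). -/
def vecLaw (dd : ℝ) [MeasurableSpace M] (μ : Measure (RCG M)) : Measure (RCG M) :=
  (ENNReal.ofReal dd)⁻¹ • μ.withDensity (fun g => (rootDeg g : ℝ≥0∞))

/-- Membership in `E_r = B_{r-1}({o,1})` for a vertex of a canonically labeled tree. -/
def inErL (r : ℕ) (l : List ℕ) : Prop :=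
  l.length + 1 ≤ r ∨ (l.getLast? = some 1 ∧ l.length ≤ r)

/-- The restriction of a colored edge-rooted tree to `E_r = B_{r-1}({o,1})`. -/
def resE (r : ℕ) (g : RCG M) : RCG M where
  col l := if inErL r l then g.col l else none
  adj p := if inErL r p.1 ∧ inErL r p.2 then g.adj p else false

/-- The Shannon entropy `H(π)` of the probability mass function `π`. -/
def Hpmf (π : ℕ → ℝ) : ℝ := ∑' k : ℕ, Real.negMulLog (π k)

/-- The annealed entropy `Σ_r(μ) = H(X_{S_r}) - (d/2) H(→X_{E_r}) - H(π)` of an invariant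
process over the unimodular Galton-Watson tree. -/
def SigmaUGW (π : ℕ → ℝ) (dd : ℝ) [MeasurableSpace M] (r : ℕ) (μ : Measure (RCG M)) : ℝ :=
  shannon (μ.map (resS r)) - (dd / 2) * shannon ((vecLaw dd μ).map (resE r)) - Hpmf π

/-- `Σ(μ) = lim_{r → ∞} Σ_r(μ)` (the limit of a non-increasing sequence). -/
def SigmaUGWInf (π : ℕ → ℝ) (dd : ℝ) [MeasurableSpace M] (μ : Measure (RCG M)) : EReal :=
  ⨅ r : ℕ, ((SigmaUGW π dd (r + 1) μ : ℝ) : EReal)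

/-- `Σ_e(X) = (d/2) H(→X_{E_1}) - d H(→X_o) + H(X_o) - H(π)`. -/
def SigmaEUGW (π : ℕ → ℝ) (dd : ℝ) [MeasurableSpace M] (μ : Measure (RCG M)) : ℝ :=
  (dd / 2) * shannon ((vecLaw dd μ).map (resE 1))
    - dd * shannon ((vecLaw dd μ).map (resS 0))
    + shannon (μ.map (resS 0)) - Hpmf π

/-! ### Markov processes on random trees -/

/-- The side of the (potential) edge `{u,w}` containing `u`, among the labels. -/
def sideL (u w : List ℕ) : Set (List ℕ) := {v | treeDist v u < treeDist v w}

/-- `B_{r-1}({u,w})` among the labels. -/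
def edgeBallL (r : ℕ) (u w : List ℕ) : Set (List ℕ) :=
  {v | treeDist v u + 1 ≤ r ∨ treeDist v w + 1 ≤ r}

/-- The event that the tree structure agrees with that of `y` on `S` and that the colored
tree agrees with `y` on `B`. -/
def treeCylEvent (S B : Set (List ℕ)) (y : RCG M) : Set (RCG M) :=
  {g | (∀ l ∈ S, (g.col l ≠ none ↔ y.col l ≠ none)) ∧ (∀ l ∈ B, g.col l = y.col l)}

/-- A random colored tree is `r`-Markov on the ambient set `A` if, conditioned on the tree
and on the value on the `(r-1)`-neighborhood of an edge, the processes on the two sides of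
the edge are independent (conditioning on the tree is expressed through arbitrary finite
windows `S`). -/
def rMarkovTreeOn [MeasurableSpace M] (r : ℕ) (A : Set (List ℕ)) (μ : Measure (RCG M)) :
    Prop :=
  ∀ (u : List ℕ) (i : ℕ), 1 ≤ i → u ∈ A → (i :: u) ∈ A →
    ∀ F₁ F₂ : Finset (List ℕ), ↑F₁ ⊆ sideL u (i :: u) ∩ A → ↑F₂ ⊆ sideL (i :: u) u ∩ A →
    ∀ S : Finset (List ℕ), ↑S ⊆ A → ∀ y : RCG M,
      μ (treeCylEvent ↑S (edgeBallL r u (i :: u) ∩ A) y ∩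
          treeCylEvent ∅ ↑F₁ y ∩ treeCylEvent ∅ ↑F₂ y)
        * μ (treeCylEvent ↑S (edgeBallL r u (i :: u) ∩ A) y)
      = μ (treeCylEvent ↑S (edgeBallL r u (i :: u) ∩ A) y ∩ treeCylEvent ∅ ↑F₁ y)
        * μ (treeCylEvent ↑S (edgeBallL r u (i :: u) ∩ A) y ∩ treeCylEvent ∅ ↑F₂ y)

/-- A random colored tree is `r`-Markov if the above holds with ambient set everything. -/
def rMarkovTree [MeasurableSpace M] (r : ℕ) (μ : Measure (RCG M)) : Prop :=
  rMarkovTreeOn r Set.univ μ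

/-- A random colored tree is vertex-Markov on the ambient set `A` if, conditioned on the tree
and on the value at a vertex, the processes on the pending subtrees of that vertex are
independent. -/
def vertexMarkovTreeOn [MeasurableSpace M] (A : Set (List ℕ)) (μ : Measure (RCG M)) :
    Prop :=
  ∀ v ∈ A, ∀ (k : ℕ) (u : Fin k → List ℕ), Function.Injective u →
    (∀ j, u j ∈ A ∧ ((∃ i, 1 ≤ i ∧ u j = i :: v) ∨ (v ≠ [] ∧ u j = v.tail))) →
    ∀ F : Fin k → Finset (List ℕ), (∀ j, ↑(F j) ⊆ sideL (u j) v ∩ A) →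
    ∀ S : Finset (List ℕ), ↑S ⊆ A → ∀ y : RCG M,
      μ (treeCylEvent ↑S {v} y ∩ ⋂ j, treeCylEvent ∅ ↑(F j) y)
          * (μ (treeCylEvent ↑S {v} y)) ^ (k - 1)
        = ∏ j : Fin k, μ (treeCylEvent ↑S {v} y ∩ treeCylEvent ∅ ↑(F j) y)

/-- A random colored tree is vertex-Markov if the above holds with ambient set everything. -/
def vertexMarkovTree [MeasurableSpace M] (μ : Measure (RCG M)) : Prop :=
  vertexMarkovTreeOn Set.univ μ

/-! ### Random graphs with given degree sequences -/

/-- The set of simple graphs on `{1,…,n}` with degree sequence `dn`. -/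
def degSeqGraphs (n : ℕ) (dn : Fin n → ℕ) : Set (SimpleGraph (Fin n)) :=
  {G | ∀ v, (G.neighborSet v).ncard = dn v}

/-- The probability that a uniform random graph with degree sequence `dn` lies in `A`. -/
def PrD (n : ℕ) (dn : Fin n → ℕ) (A : Set (SimpleGraph (Fin n))) : ℝ :=
  ((degSeqGraphs n dn ∩ A).ncard : ℝ) / ((degSeqGraphs n dn).ncard : ℝ)

/-- `𝓕_G(μ,r,ε)` for a process `μ` over a unimodular Galton-Watson tree. -/
def FSetD [MeasurableSpace M] (μ : Measure (RCG M)) (r : ℕ) (ε : ℝ) {n : ℕ}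
    (G : SimpleGraph (Fin n)) : Set (Fin n → M) :=
  {f | levyProkhorovDist ((distrG G f).map (resS r)) (μ.map (resS r)) ≤ ε}

/-- `H_G(μ,r,ε) = (1/n) log |𝓕_G(μ,r,ε)|`. -/
def HGD [MeasurableSpace M] (μ : Measure (RCG M)) (r : ℕ) (ε : ℝ) {n : ℕ}
    (G : SimpleGraph (Fin n)) : EReal :=
  if FSetD μ r ε G = ∅ then ⊥
  else ((Real.log ((FSetD μ r ε G).ncard) / n : ℝ) : EReal)

/-- The `α`-quantile of `H_{G_n}(μ,r,ε)` for the uniform random graph with degree sequence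
`DN n`. -/
def hquantD [MeasurableSpace M] (DN : (n : ℕ) → Fin n → ℕ) (μ : Measure (RCG M)) (r : ℕ)
    (ε : ℝ) (α : ℝ) (n : ℕ) : EReal :=
  sSup {h : EReal | (h = ⊥ ∨ 0 ≤ h) ∧
    α ≤ PrD n (DN n) {G : SimpleGraph (Fin n) | h ≤ HGD μ r ε G}}

/-- `h̄(μ,r,α)` for the degree-sequence ensemble. -/
def hbarAD [MeasurableSpace M] (DN : (n : ℕ) → Fin n → ℕ) (μ : Measure (RCG M)) (r : ℕ)
    (α : ℝ) : EReal :=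
  ⨅ ε : {e : ℝ // 0 < e}, Filter.atTop.limsup (fun n => hquantD DN μ r ε.1 α n)

/-- `h̲(μ,r,α)` for the degree-sequence ensemble. -/
def hlowAD [MeasurableSpace M] (DN : (n : ℕ) → Fin n → ℕ) (μ : Measure (RCG M)) (r : ℕ)
    (α : ℝ) : EReal :=
  ⨅ ε : {e : ℝ // 0 < e}, Filter.atTop.liminf (fun n => hquantD DN μ r ε.1 α n)

/-- `h̄(μ,r)`: the common value of `h̄(μ,r,α)`, `0 < α < 1`. -/
def hbarRD [MeasurableSpace M] (DN : (n : ℕ) → Fin n → ℕ) (μ : Measure (RCG M)) (r : ℕ) :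
    EReal :=
  hbarAD DN μ r (1 / 2)

/-- `h̲(μ,r)`. -/
def hlowRD [MeasurableSpace M] (DN : (n : ℕ) → Fin n → ℕ) (μ : Measure (RCG M)) (r : ℕ) :
    EReal :=
  hlowAD DN μ r (1 / 2)

/-- The upper sofic entropy `h̄(μ) = lim_{r → ∞} h̄(μ,r)`. -/
def hbarD [MeasurableSpace M] (DN : (n : ℕ) → Fin n → ℕ) (μ : Measure (RCG M)) : EReal :=
  ⨅ r : ℕ, hbarRD DN μ r

/-- The lower sofic entropy `h̲(μ) = lim_{r → ∞} h̲(μ,r)`. -/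
def hlowD [MeasurableSpace M] (DN : (n : ℕ) → Fin n → ℕ) (μ : Measure (RCG M)) : EReal :=
  ⨅ r : ℕ, hlowRD DN μ r

/-- The hypotheses on the degree sequences: uniformly bounded by `Δ`, even sums, and
empirical distributions converging (weakly) to `π`. -/
def GoodDegSeq (π : ℕ → ℝ) (Δ : ℝ) (DN : (n : ℕ) → Fin n → ℕ) : Prop :=
  (∀ n v, (DN n v : ℝ) ≤ Δ) ∧ (∀ n, Even (∑ v : Fin n, DN n v)) ∧
  (∀ k : ℕ, Tendsto (fun n => (((Finset.univ.filter (fun v : Fin n => DN n v = k)).card : ℝ) / n))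
    atTop (nhds (π k)))

/-- The hypotheses on the degree distribution `π`: a probability mass function supported in
`{0,…,Δ}` with mean `dd > 0`. -/
def GoodPmf (π : ℕ → ℝ) (Δ : ℝ) (dd : ℝ) : Prop :=
  (∀ k, 0 ≤ π k) ∧ (∑' k : ℕ, π k) = 1 ∧ (∀ k : ℕ, (Δ : ℝ) < k → π k = 0) ∧
  (∑' k : ℕ, (k : ℝ) * π k) = dd ∧ 0 < dd


/-! ### Couplings -/

/-- `ν ∈ I_d(M × M)` is an invariant coupling of `μ` with itself: both coordinate marginal
processes of `ν` have law `μ`. -/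
def IsInvCoupling (d : ℕ) {M : Type*} [MeasurableSpace M] (μ : Measure (TdVertex d → M))
    (ν : Measure (TdVertex d → M × M)) : Prop :=
  ν ∈ InvMeas d (M × M) ∧ ν.map (fun x => fun v => (x v).1) = μ ∧
    ν.map (fun x => fun v => (x v).2) = μ

/-- The first coordinate marginal of a colored graph with colors in a product set. -/
def rcgFst {M₁ M₂ : Type*} (g : RCG (M₁ × M₂)) : RCG M₁ :=
  ⟨fun l => (g.col l).map Prod.fst, g.adj⟩

/-- The second coordinate marginal of a colored graph with colors in a product set. -/
def rcgSnd {M₁ M₂ : Type*} (g : RCG (M₁ × M₂)) : RCG M₂ :=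
  ⟨fun l => (g.col l).map Prod.snd, g.adj⟩

/-- `ν ∈ I_π(M × M)` is an invariant coupling of `μ ∈ I_π(M)` with itself. -/
def IsInvCouplingUGW (π : ℕ → ℝ) (dd : ℝ) {M : Type*} [MeasurableSpace M]
    (μ : Measure (RCG M)) (ν : Measure (RCG (M × M))) : Prop :=
  ν ∈ IPiMeas π dd (M × M) ∧ ν.map rcgFst = μ ∧ ν.map rcgSnd = μ


/-! ### Entropy and empirical distributions on finite types -/

/-- Shannon entropy of a vector of weights on a finite type. -/
def ent {α : Type*} [Fintype α] (p : α → ℝ) : ℝ := ∑ a, Real.negMulLog (p a)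

/-- The empirical distribution of a finite family. -/
def emp {ι α : Type*} [Fintype ι] (y : ι → α) (a : α) : ℝ :=
  ((Finset.univ.filter fun i => y i = a).card : ℝ) / Fintype.card ι

lemma continuous_ent {α : Type*} [Fintype α] : Continuous (ent : (α → ℝ) → ℝ) := by
  unfold ent
  exact continuous_finsetSum _ fun a _ => Real.continuous_negMulLog.comp (continuous_apply a)

lemma exists_ent_close {α : Type*} [Fintype α] (p : α → ℝ) {η : ℝ} (hη : 0 < η) :
    ∃ δ > 0, ∀ q : α → ℝ, (∀ a, |q a - p a| ≤ δ) → |ent q - ent p| ≤ η := by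
  obtain ⟨δ, hδ, h⟩ := Metric.continuous_iff.1 (continuous_ent (α := α)) p η hη
  refine ⟨δ / 2, by positivity, fun q hq => ?_⟩
  have := h q (lt_of_le_of_lt ((dist_pi_le_iff (by positivity)).2 fun a => ?_) (half_lt_self hδ))
  · exact this.le
  · rw [Real.dist_eq]; exact hq a

lemma emp_nonneg {ι α : Type*} [Fintype ι] (y : ι → α) (a : α) : 0 ≤ emp y a := by
  unfold emp; positivity

lemma card_mul_emp {ι α : Type*} [Fintype ι] (y : ι → α) (a : α) :
    (Fintype.card ι : ℝ) * emp y a = (Finset.univ.filter fun i => y i = a).card := by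
  unfold emp
  rcases Nat.eq_zero_or_pos (Fintype.card ι) with h | h
  · have : IsEmpty ι := Fintype.card_eq_zero_iff.1 h
    simp
  · field_simp

lemma sum_emp_le_one {ι α : Type*} [Fintype ι] [Fintype α] (y : ι → α) : ∑ a, emp y a ≤ 1 := by
  unfold emp
  rw [← Finset.sum_div, ← Nat.cast_sum,
    ← Finset.card_eq_sum_card_fiberwise (f := y) (s := Finset.univ) (t := Finset.univ)
      (fun _ _ => by simp)]
  exact div_self_le_one _

lemma card_mul_ent_emp {ι α : Type*} [Fintype ι] [Fintype α] (y : ι → α) :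
    (Fintype.card ι : ℝ) * ent (emp y) =
      -∑ a, ((Finset.univ.filter fun i => y i = a).card : ℝ) * Real.log (emp y a) := by
  unfold ent Real.negMulLog
  rw [Finset.mul_sum, ← Finset.sum_neg_distrib]
  refine Finset.sum_congr rfl fun a _ => ?_
  rw [← card_mul_emp]; ring

lemma prod_emp {ι α : Type*} [Fintype ι] [Fintype α] (y : ι → α) :
    ∏ i, emp y (y i) = Real.exp (-(Fintype.card ι * ent (emp y))) := by
  rw [card_mul_ent_emp, neg_neg, Real.exp_sum, ← Finset.prod_fiberwise' Finset.univ y (emp y)]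
  refine Finset.prod_congr rfl fun a _ => ?_
  rw [Finset.prod_const]
  rcases Nat.eq_zero_or_pos (Finset.univ.filter fun i => y i = a).card with h | h
  · rw [h]; simp
  · have hpos : 0 < emp y a := by
      unfold emp
      have : 0 < Fintype.card ι := lt_of_lt_of_le h (Finset.card_le_univ _)
      positivity
    rw [mul_comm, Real.exp_mul, Real.exp_log hpos, Real.rpow_natCast]

lemma sum_prod_emp_le_one {ι κ α : Type*} [Fintype ι] [Fintype κ] [DecidableEq κ] [Fintype α]
    (y : ι → α) :
    ∑ z : κ → α, ∏ i, emp y (z i) ≤ 1 := by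
  have h := Finset.prod_univ_sum (ι := κ) (fun _ => (Finset.univ : Finset α))
    (fun _ a => emp y a)
  rw [Fintype.piFinset_univ] at h
  rw [← h]
  exact Finset.prod_le_one (fun _ _ => Finset.sum_nonneg fun a _ => emp_nonneg y a)
    fun _ _ => sum_emp_le_one y

lemma card_typeClass_le {ι α : Type*} [Fintype ι] [Fintype α] (y : ι → α) :
    ((Finset.univ.filter fun z : ι → α => emp z = emp y).card : ℝ) ≤
      Real.exp (Fintype.card ι * ent (emp y)) := by
  have h1 : ∑ z ∈ Finset.univ.filter (fun z : ι → α => emp z = emp y), ∏ i, emp y (z i) ≤ 1 :=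
    (Finset.sum_le_sum_of_subset_of_nonneg (Finset.filter_subset _ _) fun z _ _ =>
      Finset.prod_nonneg fun i _ => emp_nonneg y _).trans
        (sum_prod_emp_le_one y)
  rw [Finset.sum_congr rfl (g := fun _ => Real.exp (-(Fintype.card ι * ent (emp y)))),
    Finset.sum_const, nsmul_eq_mul, Real.exp_neg] at h1
  · rwa [← div_eq_mul_inv, div_le_one (Real.exp_pos _)] at h1
  · intro z hz
    rw [← (Finset.mem_filter.1 hz).2]
    exact prod_emp z

lemma card_near_le {α : Type*} [Fintype α] (p : α → ℝ) {η : ℝ} (hη : 0 < η) :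
    ∃ δ > 0, ∀ (ι : Type) [Fintype ι],
      ((Finset.univ.filter fun z : ι → α => ∀ a, |emp z a - p a| ≤ δ).card : ℝ) ≤
        ((Fintype.card ι : ℝ) + 1) ^ Fintype.card α *
          Real.exp (Fintype.card ι * (ent p + η)) := by
  obtain ⟨δ, hδ, h⟩ := exists_ent_close p hη
  refine ⟨δ, hδ, fun ι _ => ?_⟩
  set N := Fintype.card ι
  set A := Finset.univ.filter fun z : ι → α => ∀ a, |emp z a - p a| ≤ δ
  let F : (ι → α) → (α → Fin (N + 1)) := fun z a =>
    ⟨(Finset.univ.filter fun i => z i = a).card, Nat.lt_succ_of_le (Finset.card_le_univ _)⟩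
  have hF : ∀ z w, F z = F w → emp z = emp w := by
    intro z w hzw
    funext a
    have := congrArg Fin.val (congrFun hzw a)
    simp only [F] at this
    simp only [emp, this]
  have key := Finset.card_le_mul_card_image (f := F) A ⌊Real.exp (N * (ent p + η))⌋₊ (by
    intro b hb
    obtain ⟨w, hw, rfl⟩ := Finset.mem_image.1 hb
    refine Nat.le_floor ?_
    refine le_trans (b := ((Finset.univ.filter fun z : ι → α => emp z = emp w).card : ℝ)) ?_ ?_
    · refine Nat.cast_le.2 (Finset.card_le_card fun z hz => ?_)
      simp only [Finset.mem_filter, Finset.mem_univ, true_and] at hz ⊢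
      exact hF _ _ hz.2
    · refine (card_typeClass_le w).trans (Real.exp_le_exp.2 ?_)
      have := (abs_le.1 (h (emp w) (Finset.mem_filter.1 hw).2)).2
      exact mul_le_mul_of_nonneg_left (by linarith) (Nat.cast_nonneg _))
  have h2 : (A.image F).card ≤ (N + 1) ^ Fintype.card α := by
    refine (Finset.card_le_univ _).trans ?_
    simp
  calc (A.card : ℝ) ≤ (⌊Real.exp (N * (ent p + η))⌋₊ * (A.image F).card : ℕ) := by
        exact_mod_cast key
    _ = (⌊Real.exp (N * (ent p + η))⌋₊ : ℝ) * (A.image F).card := by push_cast; ring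
    _ ≤ Real.exp (N * (ent p + η)) * ((N : ℝ) + 1) ^ Fintype.card α := by
        refine mul_le_mul (Nat.floor_le (Real.exp_pos _).le) ?_ (by positivity)
          (Real.exp_pos _).le
        exact_mod_cast h2
    _ = _ := mul_comm _ _

lemma factorial_le_exp (k : ℕ) :
    (k.factorial : ℝ) ≤ Real.exp 1 * (k + 1) * Real.exp (k * Real.log k - k) := by
  have aux : ∀ k : ℕ, ((k + 1).factorial : ℝ) ≤
      Real.exp 1 * (k + 1) * Real.exp ((k + 1) * Real.log (k + 1) - (k + 1)) := by
    intro k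
    induction k with
    | zero => simp [← Real.exp_add]
    | succ k ih =>
      rw [Nat.factorial_succ]
      push_cast
      have hk : (0 : ℝ) < k + 1 := by positivity
      have hlog : 1 / ((k : ℝ) + 2) ≤ Real.log (k + 2) - Real.log (k + 1) := by
        rw [← Real.log_div (by positivity) (by positivity)]
        have := Real.one_sub_inv_le_log_of_pos (x := ((k : ℝ) + 2) / (k + 1)) (by positivity)
        refine le_trans (le_of_eq ?_) this
        field_simp
        ring
      have hlog' : 1 ≤ ((k : ℝ) + 2) * (Real.log (k + 2) - Real.log (k + 1)) := by
        have := mul_le_mul_of_nonneg_left hlog (by positivity : (0 : ℝ) ≤ k + 2)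
        rwa [mul_one_div_cancel (by positivity)] at this
      have e2 : ((k : ℝ) + 1 + 1) = k + 2 := by ring
      rw [e2]
      calc ((k : ℝ) + 2) * ((k + 1).factorial : ℝ)
          ≤ (k + 2) * (Real.exp 1 * (k + 1) *
              Real.exp ((k + 1) * Real.log (k + 1) - (k + 1))) := by gcongr
        _ = Real.exp 1 * (k + 2) * (Real.exp (Real.log (k + 1)) *
              Real.exp ((k + 1) * Real.log (k + 1) - (k + 1))) := by
            rw [Real.exp_log hk]; ring
        _ ≤ _ := by
            rw [← Real.exp_add]
            refine mul_le_mul_of_nonneg_left (Real.exp_le_exp.2 ?_) (by positivity)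
            nlinarith
  cases k with
  | zero => simp
  | succ k =>
    refine (aux k).trans ?_
    push_cast
    gcongr
    linarith

lemma exp_le_factorial (k : ℕ) : Real.exp (k * Real.log k - k) ≤ k.factorial := by
  rcases Nat.eq_zero_or_pos k with rfl | hk
  · simp
  have h := Real.pow_div_factorial_le_exp (x := k) (by positivity) k
  rw [Real.exp_sub, div_le_iff₀ (Real.exp_pos _), mul_comm (k : ℝ), Real.exp_mul,
    Real.exp_log (by positivity), Real.rpow_natCast]
  rw [div_le_iff₀ (by positivity)] at h
  linarith [mul_comm (Real.exp (k : ℝ)) (k.factorial : ℝ)]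

lemma prod_factorial_div_le {ι α : Type*} [Fintype ι] [Fintype α] (y : ι → α) :
    (∏ a, ((Finset.univ.filter fun i => y i = a).card.factorial : ℝ)) ≤
      (Fintype.card ι).factorial * ((Real.exp 1 * (Fintype.card ι + 1)) ^ Fintype.card α *
        Real.exp (-(Fintype.card ι * ent (emp y)))) := by
  set N := Fintype.card ι with hN
  set c : α → ℕ := fun a => (Finset.univ.filter fun i => y i = a).card with hc
  have hcN : ∀ a, c a ≤ N := fun a => Finset.card_le_univ _
  have hsum : ∑ a, (c a : ℝ) = N := by
    rw [← Nat.cast_sum, hN, ← Finset.card_univ,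
      Finset.card_eq_sum_card_fiberwise (f := y) (s := Finset.univ) (t := Finset.univ)
      (fun _ _ => by simp)]
  have hent : -((N : ℝ) * ent (emp y)) = ∑ a, (c a : ℝ) * Real.log (c a) - N * Real.log N := by
    rw [card_mul_ent_emp, neg_neg]
    rw [show (N : ℝ) * Real.log N = ∑ a, (c a : ℝ) * Real.log N by
      rw [← Finset.sum_mul, hsum], ← Finset.sum_sub_distrib]
    refine Finset.sum_congr rfl fun a _ => ?_
    rcases Nat.eq_zero_or_pos (c a) with h | h
    · have h' : (Finset.univ.filter fun i => y i = a).card = 0 := h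
      rw [h', h]; simp
    · have hNpos : 0 < N := lt_of_lt_of_le h (hcN a)
      have : emp y a = (c a : ℝ) / N := rfl
      rw [this, Real.log_div (by positivity) (by positivity)]
      ring
  calc (∏ a, ((c a).factorial : ℝ))
      ≤ ∏ a, (Real.exp 1 * (N + 1)) * Real.exp (c a * Real.log (c a) - c a) := by
        refine Finset.prod_le_prod (fun _ _ => by positivity) fun a _ => ?_
        refine (factorial_le_exp (c a)).trans ?_
        have : (c a : ℝ) ≤ N := by exact_mod_cast hcN a
        gcongr
    _ = (Real.exp 1 * (N + 1)) ^ Fintype.card α *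
          (Real.exp (N * Real.log N - N) * Real.exp (-(N * ent (emp y)))) := by
        rw [Finset.prod_mul_distrib, Finset.prod_const, Finset.card_univ, ← Real.exp_sum,
          ← Real.exp_add, hent, Finset.sum_sub_distrib, hsum]
        congr 2
        ring
    _ ≤ (Real.exp 1 * (N + 1)) ^ Fintype.card α *
          (N.factorial * Real.exp (-(N * ent (emp y)))) := by
        gcongr
        exact exp_le_factorial N
    _ = _ := by ring

/-! ### Perfect matchings -/

/-- The perfect matchings of a finite type, as fixed-point free involutions. -/
def matchings (H : Type*) [Fintype H] : Finset (Equiv.Perm H) :=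
  Finset.univ.filter fun π => ∀ h, π (π h) = h ∧ π h ≠ h

lemma mem_matchings {H : Type*} [Fintype H] {π : Equiv.Perm H} :
    π ∈ matchings H ↔ ∀ h, π (π h) = h ∧ π h ≠ h := by simp [matchings]

lemma conj_mem_matchings {H : Type*} [Fintype H] {π : Equiv.Perm H} (hπ : π ∈ matchings H)
    (g : Equiv.Perm H) : g * π * g⁻¹ ∈ matchings H := by
  rw [mem_matchings] at hπ ⊢
  intro h
  constructor
  · simp [(hπ _).1]
  · intro e
    apply (hπ (g⁻¹ h)).2
    apply g.injective
    simpa using e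

/-- The matchings compatible with a labelling of the points, matching each label with its
reverse. -/
def compat {H E : Type*} [Fintype H] (rev : E → E) (y : H → E) : Finset (Equiv.Perm H) :=
  (matchings H).filter fun π => ∀ h, y (π h) = rev (y h)

lemma mem_compat {H E : Type*} [Fintype H] {rev : E → E} {y : H → E} {π : Equiv.Perm H} :
    π ∈ compat rev y ↔ π ∈ matchings H ∧ ∀ h, y (π h) = rev (y h) := by simp [compat]

lemma emp_rev_of_mem_compat {H E : Type*} [Fintype H] {rev : E → E}
    (hrev : Function.Involutive rev) {y : H → E} {π : Equiv.Perm H} (hπ : π ∈ compat rev y)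
    (a : E) : emp y (rev a) = emp y a := by
  unfold emp
  congr 2
  refine Finset.card_bij (fun h _ => π h) ?_ (fun _ _ _ _ h => π.injective h) ?_
  · intro h hh
    simp only [Finset.mem_filter, Finset.mem_univ, true_and] at hh ⊢
    rw [(mem_compat.1 hπ).2, hh, hrev]
  · intro h hh
    simp only [Finset.mem_filter, Finset.mem_univ, true_and] at hh
    refine ⟨π h, ?_, (mem_matchings.1 (mem_compat.1 hπ).1 h).1⟩
    simp only [Finset.mem_filter, Finset.mem_univ, true_and]
    rw [(mem_compat.1 hπ).2, hh]

lemma sum_compat_labels_le {H E : Type*} [Fintype H] [Fintype E] {rev : E → E} (y : H → E)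
    (hq : ∀ a, emp y (rev a) = emp y a) {π : Equiv.Perm H} (hπ : π ∈ matchings H) :
    ((Finset.univ.filter fun z : H → E =>
        emp z = emp y ∧ ∀ h, z (π h) = rev (z h)).card : ℝ) ≤
      Real.exp (Fintype.card H * ent (emp y) / 2) := by
  let e := Fintype.equivFin H
  set R : Finset H := Finset.univ.filter fun h => e h < e (π h) with hR
  set Z := Finset.univ.filter fun z : H → E =>
        emp z = emp y ∧ ∀ h, z (π h) = rev (z h) with hZ
  have hπ' := mem_matchings.1 hπ
  have hsplit : ∀ h, h ∉ R → π h ∈ R := by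
    intro h hh
    simp only [hR, Finset.mem_filter, Finset.mem_univ, true_and, not_lt] at hh ⊢
    rw [(hπ' h).1]
    exact lt_of_le_of_ne hh fun h' => (hπ' h).2 (e.injective h')
  have hsplit' : ∀ h, h ∈ R → π h ∉ R := by
    intro h hh
    simp only [hR, Finset.mem_filter, Finset.mem_univ, true_and, not_lt] at hh ⊢
    rw [(hπ' h).1]
    exact hh.le
  let F : (H → E) → (R → E) := fun z h => z h
  have hinj : Set.InjOn F Z := by
    intro z hz w hw hzw
    have hz' := (Finset.mem_filter.1 hz).2.2
    have hw' := (Finset.mem_filter.1 hw).2.2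
    have hR' : ∀ h ∈ R, z h = w h := fun h hh => congrFun hzw ⟨h, hh⟩
    funext h
    by_cases hh : h ∈ R
    · exact hR' h hh
    · have h1 := hR' _ (hsplit h hh)
      have h2 := hz' (π h)
      have h3 := hw' (π h)
      rw [(hπ' h).1] at h2 h3
      rw [h2, h3, h1]
  have hprod : ∀ z ∈ Z, ∏ h : R, emp y (F z h) =
      Real.exp (-(Fintype.card H * ent (emp y) / 2)) := by
    intro z hz
    obtain ⟨hz1, hz2⟩ := (Finset.mem_filter.1 hz).2
    have hfull := prod_emp z
    rw [hz1] at hfull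
    have hA : ∏ h : R, emp y (F z h) = ∏ h ∈ R, emp y (z h) :=
      Finset.prod_coe_sort R fun h => emp y (z h)
    have hB : ∏ h ∈ Rᶜ, emp y (z h) = ∏ h ∈ R, emp y (z h) := by
      refine Finset.prod_bij (fun h _ => π h) (fun h hh => hsplit h (Finset.mem_compl.1 hh))
        (fun _ _ _ _ h => π.injective h)
        (fun h hh => ⟨π h, Finset.mem_compl.2 (hsplit' h hh), (hπ' h).1⟩) ?_
      intro h _
      rw [hz2, hq]
    rw [← Finset.prod_mul_prod_compl R, hB, ← hA] at hfull
    have hnn : 0 ≤ ∏ h : R, emp y (F z h) := Finset.prod_nonneg fun _ _ => emp_nonneg _ _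
    have hsq : Real.exp (-(Fintype.card H * ent (emp y))) =
        Real.exp (-(Fintype.card H * ent (emp y) / 2)) *
          Real.exp (-(Fintype.card H * ent (emp y) / 2)) := by
      rw [← Real.exp_add]; congr 1; ring
    rw [hsq] at hfull
    exact (mul_self_inj hnn (Real.exp_pos _).le).1 hfull
  have h1 : ∑ z ∈ Z, ∏ h : R, emp y (F z h) ≤ 1 := by
    rw [← Finset.sum_image (f := fun w : R → E => ∏ h : R, emp y (w h)) hinj]
    exact (Finset.sum_le_sum_of_subset_of_nonneg (Finset.subset_univ _) fun z _ _ =>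
      Finset.prod_nonneg fun i _ => emp_nonneg y _).trans
        (sum_prod_emp_le_one y)
  rw [Finset.sum_congr rfl hprod, Finset.sum_const, nsmul_eq_mul, Real.exp_neg,
    ← div_eq_mul_inv, div_le_one (Real.exp_pos _)] at h1
  exact h1

lemma card_perm_fiber_le {ι α : Type*} [Fintype ι] [Fintype α] (y z : ι → α) :
    (Finset.univ.filter fun g : Equiv.Perm ι => y ∘ g = z).card ≤
      ∏ a, (Finset.univ.filter fun i => y i = a).card.factorial := by
  by_cases hne : ∃ g : Equiv.Perm ι, y ∘ g = z
  · obtain ⟨g₀, hg₀⟩ := hne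
    have h := DomMulAct.stabilizer_card y
    simp only [Fintype.card_subtype] at h
    rw [← h]
    refine Finset.card_le_card_of_injOn (fun g => g * g₀⁻¹) ?_ ?_
    · intro g hg
      simp only [Finset.coe_filter, Finset.mem_univ, true_and, Set.mem_ofPred_eq] at hg ⊢
      funext i
      have := congrFun (hg.trans hg₀.symm) (g₀⁻¹ i)
      simpa using this
    · intro g _ g' _ hgg
      exact mul_right_cancel hgg
  · rw [Finset.filter_false_of_mem (fun g _ hg => hne ⟨g, hg⟩)]
    simp

lemma card_compat_comp {H E : Type*} [Fintype H] (rev : E → E) (y : H → E)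
    (g : Equiv.Perm H) : (compat rev (y ∘ g)).card = (compat rev y).card := by
  refine Finset.card_bij (fun π _ => g * π * g⁻¹) ?_ ?_ ?_
  · intro π hπ
    rw [mem_compat] at hπ ⊢
    refine ⟨conj_mem_matchings hπ.1 g, fun h => ?_⟩
    simpa using hπ.2 (g⁻¹ h)
  · intro π _ π' _ h
    exact mul_left_cancel (mul_right_cancel h)
  · intro π hπ
    rw [mem_compat] at hπ
    refine ⟨g⁻¹ * π * g, ?_, by group⟩
    rw [mem_compat]
    refine ⟨by simpa using conj_mem_matchings hπ.1 g⁻¹, fun h => ?_⟩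
    simpa using hπ.2 (g h)

lemma emp_comp_perm {ι α : Type*} [Fintype ι] (y : ι → α) (g : Equiv.Perm ι) :
    emp (y ∘ g) = emp y := by
  funext a
  unfold emp
  congr 2
  refine Finset.card_bij (fun i _ => g i) (by simp) (fun _ _ _ _ h => g.injective h) ?_
  intro i hi
  exact ⟨g⁻¹ i, by simpa using hi, by simp⟩

lemma card_compat_le {H E : Type*} [Fintype H] [Fintype E] {rev : E → E}
    (hrev : Function.Involutive rev) (y : H → E) :
    ((compat rev y).card : ℝ) ≤ (matchings H).card *
      ((Real.exp 1 * (Fintype.card H + 1)) ^ Fintype.card E *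
        Real.exp (-(Fintype.card H * ent (emp y) / 2))) := by
  rcases (compat rev y).eq_empty_or_nonempty with he | ⟨π₀, hπ₀⟩
  · rw [he]; simp; positivity
  have hq := emp_rev_of_mem_compat hrev hπ₀
  set N := Fintype.card H
  set h := ent (emp y)
  set S := Finset.univ.filter fun z : H → E => emp z = emp y
  have hdouble : (N.factorial : ℝ) * (compat rev y).card ≤ (matchings H).card *
      (Real.exp (N * h / 2) * ∏ a, ((Finset.univ.filter fun i => y i = a).card.factorial : ℝ)) := by
    have e1 : N.factorial * (compat rev y).card =
        ∑ π ∈ matchings H, (Finset.univ.filter fun g : Equiv.Perm H =>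
          π ∈ compat rev (y ∘ g)).card := by
      have : ∑ g : Equiv.Perm H, (compat rev (y ∘ g)).card =
          N.factorial * (compat rev y).card := by
        rw [Finset.sum_congr rfl fun g _ => card_compat_comp rev y g, Finset.sum_const,
          Finset.card_univ, Fintype.card_perm, smul_eq_mul]
      rw [← this]
      have := Finset.sum_card_bipartiteAbove_eq_sum_card_bipartiteBelow
        (s := (Finset.univ : Finset (Equiv.Perm H))) (t := matchings H)
        (fun (g : Equiv.Perm H) (π : Equiv.Perm H) => π ∈ compat rev (y ∘ g))
      simp only [Finset.bipartiteAbove, Finset.bipartiteBelow] at this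
      rw [← this]
      refine Finset.sum_congr rfl fun g _ => congrArg _ ?_
      ext π
      simp only [Finset.mem_filter]
      exact ⟨fun h => ⟨(mem_compat.1 h).1, h⟩, fun h => h.2⟩
    rw [← Nat.cast_mul, e1, Nat.cast_sum, ← nsmul_eq_mul]
    refine Finset.sum_le_card_nsmul _ _ _ fun π hπ => ?_
    have hmap : ∀ g ∈ Finset.univ.filter (fun g : Equiv.Perm H => π ∈ compat rev (y ∘ g)),
        y ∘ g ∈ Finset.univ.filter (fun z : H → E =>
          emp z = emp y ∧ ∀ h, z (π h) = rev (z h)) := by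
      intro g hg
      simp only [Finset.mem_filter, Finset.mem_univ, true_and] at hg ⊢
      exact ⟨emp_comp_perm y g, (mem_compat.1 hg).2⟩
    have hc := Finset.card_le_mul_card_image_of_maps_to hmap
      (∏ a, (Finset.univ.filter fun i => y i = a).card.factorial) (fun z _ =>
        (Finset.card_le_card (by intro g hg; simp only [Finset.mem_filter] at hg ⊢; exact ⟨Finset.mem_univ _, hg.2⟩)).trans
          (card_perm_fiber_le y z))
    have hc' : ((Finset.univ.filter fun g : Equiv.Perm H =>
          π ∈ compat rev (y ∘ g)).card : ℝ) ≤ _ := Nat.cast_le.2 hc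
    refine hc'.trans ?_
    push_cast
    rw [mul_comm]
    gcongr
    exact sum_compat_labels_le y hq hπ
  have hfac := prod_factorial_div_le y
  have hNpos : (0 : ℝ) < N.factorial := by positivity
  refine le_of_mul_le_mul_left (hdouble.trans ?_) hNpos
  calc _ ≤ (matchings H).card * (Real.exp (N * h / 2) * (N.factorial *
        ((Real.exp 1 * (N + 1)) ^ Fintype.card E * Real.exp (-(N * h))))) := by gcongr
    _ = N.factorial * ((matchings H).card * ((Real.exp 1 * (N + 1)) ^ Fintype.card E *
        (Real.exp (N * h / 2) * Real.exp (-(N * h))))) := by ring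
    _ = _ := by
      rw [← Real.exp_add]
      congr 5
      ring

lemma mul_emp_edge {C E : Type*} [Fintype C] {n d : ℕ} (τ : C → Fin d → E) (c : Fin n → C)
    (y : E) :
    (d : ℝ) * emp (fun h : Fin n × Fin d => τ (c h.1) h.2) y =
      ∑ i, ∑ a, if τ a i = y then emp c a else 0 := by
  have h1 : ((Finset.univ.filter fun h : Fin n × Fin d => τ (c h.1) h.2 = y).card : ℝ) =
      ∑ i : Fin d, ∑ a, if τ a i = y then
        ((Finset.univ.filter fun v => c v = a).card : ℝ) else 0 := by
    rw [Finset.card_filter, ← Finset.univ_product_univ, Finset.sum_product_right, Nat.cast_sum]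
    refine Finset.sum_congr rfl fun i _ => ?_
    rw [← Finset.card_filter, Finset.card_eq_sum_card_fiberwise (f := c) (t := Finset.univ)
      (fun _ _ => by simp), Nat.cast_sum]
    refine Finset.sum_congr rfl fun a _ => ?_
    rw [Finset.filter_filter]
    split_ifs with h
    · congr 2
      ext v
      simp only [Finset.mem_filter, Finset.mem_univ, true_and]
      exact ⟨fun h' => h'.2, fun h' => ⟨by rw [h']; exact h, h'⟩⟩
    · rw [Nat.cast_eq_zero, Finset.card_eq_zero, Finset.filter_eq_empty_iff]
      rintro v - ⟨h2, h3⟩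
      exact h (by rw [← h3]; exact h2)
  unfold emp
  rw [h1, Fintype.card_prod, Fintype.card_fin, Fintype.card_fin]
  rcases Nat.eq_zero_or_pos d with rfl | hd
  · simp
  rw [Nat.cast_mul, mul_div_assoc', mul_comm (n : ℝ), mul_div_mul_left _ _ (by positivity),
    Finset.sum_div]
  refine Finset.sum_congr rfl fun i _ => ?_
  rw [Finset.sum_div]
  refine Finset.sum_congr rfl fun a _ => ?_
  split_ifs <;> simp

lemma card_colored_matchings_le {C E : Type*} [Fintype C] [Fintype E] {d : ℕ} (hd : 0 < d)
    (τ : C → Fin d → E) {rev : E → E} (hrev : Function.Involutive rev) (p : C → ℝ) (q : E → ℝ)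
    (hq : ∀ y, (d : ℝ) * q y = ∑ i, ∑ a, if τ a i = y then p a else 0) {η : ℝ} (hη : 0 < η) :
    ∃ δ > 0, ∀ n : ℕ,
      ((Finset.univ.filter fun x : Equiv.Perm (Fin n × Fin d) × (Fin n → C) =>
        x.1 ∈ matchings (Fin n × Fin d) ∧
        (∀ h, τ (x.2 (x.1 h).1) (x.1 h).2 = rev (τ (x.2 h.1) h.2)) ∧
        ∀ a, |emp x.2 a - p a| ≤ δ).card : ℝ) ≤
      (matchings (Fin n × Fin d)).card *
        (((n : ℝ) + 1) ^ Fintype.card C * (Real.exp 1 * (n * d + 1)) ^ Fintype.card E *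
          Real.exp (n * (ent p - d / 2 * ent q + η))) := by
  obtain ⟨δ₁, hδ₁, h₁⟩ := card_near_le p (half_pos hη)
  obtain ⟨δ₂, hδ₂, h₂⟩ := exists_ent_close q (η := η / d) (by positivity)
  refine ⟨min δ₁ (δ₂ / (Fintype.card C + 1)), by positivity, fun n => ?_⟩
  set δ := min δ₁ (δ₂ / (Fintype.card C + 1)) with hδ
  set X := Finset.univ.filter fun x : Equiv.Perm (Fin n × Fin d) × (Fin n → C) =>
        x.1 ∈ matchings (Fin n × Fin d) ∧
        (∀ h, τ (x.2 (x.1 h).1) (x.1 h).2 = rev (τ (x.2 h.1) h.2)) ∧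
        ∀ a, |emp x.2 a - p a| ≤ δ with hX
  set Y := Finset.univ.filter fun c : Fin n → C => ∀ a, |emp c a - p a| ≤ δ₁ with hY
  have hclose : ∀ c : Fin n → C, (∀ a, |emp c a - p a| ≤ δ) → ∀ y,
      |emp (fun h : Fin n × Fin d => τ (c h.1) h.2) y - q y| ≤ δ₂ := by
    intro c hc y
    have hd' : (0 : ℝ) < d := by positivity
    have hδ0 : 0 ≤ δ := by positivity
    have e : (d : ℝ) * |emp (fun h : Fin n × Fin d => τ (c h.1) h.2) y - q y| ≤
        d * (Fintype.card C * δ) := by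
      rw [← abs_of_pos hd', ← abs_mul, mul_sub, abs_of_pos hd', mul_emp_edge, hq,
        ← Finset.sum_sub_distrib]
      refine (Finset.abs_sum_le_sum_abs _ _).trans ?_
      have : ∀ i ∈ (Finset.univ : Finset (Fin d)),
          |(∑ a, if τ a i = y then emp c a else 0) - ∑ a, if τ a i = y then p a else 0| ≤
            Fintype.card C * δ := by
        intro i _
        rw [← Finset.sum_sub_distrib]
        refine (Finset.abs_sum_le_sum_abs _ _).trans ?_
        refine (Finset.sum_le_card_nsmul _ _ δ fun a _ => ?_).trans_eq (by simp)
        split_ifs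
        · exact hc a
        · simpa using hδ0
      exact (Finset.sum_le_card_nsmul _ _ _ this).trans_eq (by simp)
    refine (le_of_mul_le_mul_left e hd').trans ?_
    have h3 : δ ≤ δ₂ / (Fintype.card C + 1) := min_le_right _ _
    rw [le_div_iff₀ (by positivity)] at h3
    nlinarith
  have hcard : (X.card : ℝ) ≤ ∑ c ∈ Finset.univ.filter fun c : Fin n → C =>
      ∀ a, |emp c a - p a| ≤ δ,
      ((compat rev fun h : Fin n × Fin d => τ (c h.1) h.2).card : ℝ) := by
    rw [← Nat.cast_sum, ← Finset.card_sigma]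
    refine Nat.cast_le.2 (Finset.card_le_card_of_injOn (fun x => ⟨x.2, x.1⟩) ?_ ?_)
    · intro x hx
      have hx' := (Finset.mem_filter.1 hx).2
      simp only [Finset.coe_sigma, Set.mem_sigma_iff, Finset.mem_coe, Finset.mem_filter,
        Finset.mem_univ, true_and, mem_compat]
      exact ⟨hx'.2.2, hx'.1, hx'.2.1⟩
    · rintro ⟨a, b⟩ _ ⟨a', b'⟩ _ h
      simp only [Sigma.mk.injEq, heq_eq_eq] at h
      rw [h.1, h.2]
  set T := ((matchings (Fin n × Fin d)).card : ℝ) with hT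
  have hterm : ∀ c ∈ Finset.univ.filter fun c : Fin n → C => ∀ a, |emp c a - p a| ≤ δ,
      ((compat rev fun h : Fin n × Fin d => τ (c h.1) h.2).card : ℝ) ≤
      T * ((Real.exp 1 * (n * d + 1)) ^ Fintype.card E *
        Real.exp (-(n * (d / 2 * ent q - η / 2)))) := by
    intro c hc
    have hc' := (Finset.mem_filter.1 hc).2
    have h4 := card_compat_le hrev (fun h : Fin n × Fin d => τ (c h.1) h.2)
    rw [Fintype.card_prod, Fintype.card_fin, Fintype.card_fin] at h4
    push_cast at h4
    refine h4.trans ?_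
    have h5 := (abs_le.1 (h₂ _ (hclose c hc'))).1
    have h6 : d / 2 * ent q - η / 2 ≤
        d / 2 * ent (emp fun h : Fin n × Fin d => τ (c h.1) h.2) := by
      have h7 : (d : ℝ) * (η / d) = η := by field_simp
      have h8 : (0 : ℝ) < d := by positivity
      nlinarith
    have h9 := mul_le_mul_of_nonneg_left h6 (Nat.cast_nonneg (α := ℝ) n)
    gcongr
    linarith
  have hY' := h₁ (Fin n)
  rw [Fintype.card_fin] at hY'
  refine hcard.trans ((Finset.sum_le_card_nsmul _ _ _ hterm).trans ?_)
  rw [nsmul_eq_mul]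
  have hle : ((Finset.univ.filter fun c : Fin n → C => ∀ a, |emp c a - p a| ≤ δ).card : ℝ) ≤
      ((n : ℝ) + 1) ^ Fintype.card C * Real.exp (n * (ent p + η / 2)) := by
    refine le_trans (Nat.cast_le.2 (Finset.card_le_card ?_)) hY'
    intro c hc
    simp only [Finset.mem_filter, Finset.mem_univ, true_and] at hc ⊢
    exact fun a => (hc a).trans (min_le_left _ _)
  calc _ ≤ (((n : ℝ) + 1) ^ Fintype.card C * Real.exp (n * (ent p + η / 2))) *
        (T * ((Real.exp 1 * (n * d + 1)) ^ Fintype.card E *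
        Real.exp (-(n * (d / 2 * ent q - η / 2))))) := by gcongr
    _ = T * (((n : ℝ) + 1) ^ Fintype.card C * (Real.exp 1 * (n * d + 1)) ^ Fintype.card E *
          (Real.exp (n * (ent p + η / 2)) * Real.exp (-(n * (d / 2 * ent q - η / 2))))) := by
        ring
    _ = _ := by
        rw [← Real.exp_add]
        congr 3
        ring

/-! ### Simple matchings -/

/-- The half-edges of a matching contained in a loop or a multiple edge, where `v` sends a
half-edge to its vertex. -/
def badSet {H V : Type*} [Fintype H] (v : H → V) (π : Equiv.Perm H) : Finset H :=
  Finset.univ.filter fun h =>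
    v (π h) = v h ∨ ∃ h', h' ≠ h ∧ v h' = v h ∧ v (π h') = v (π h)

lemma mem_badSet {H V : Type*} [Fintype H] {v : H → V} {π : Equiv.Perm H} {h : H} :
    h ∈ badSet v π ↔ v (π h) = v h ∨ ∃ h', h' ≠ h ∧ v h' = v h ∧ v (π h') = v (π h) := by
  simp [badSet]

lemma bad_of_switch {H V : Type*} {v w w' : H → V} {h g a b : H}
    (h1 : v g ≠ v h) (h2 : v g ≠ v a) (h3 : v b ≠ v h) (h4 : v b ≠ v a) (h5 : v b ≠ v g)
    (e1 : w' h = v g) (e2 : w' g = v h) (e3 : w' a = v b) (e4 : w' b = v a)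
    (e5 : ∀ x, x ≠ h → x ≠ g → x ≠ a → x ≠ b → w' x = w x)
    (k1 : ∀ x, v x = v h ∨ v x = v a → w x ≠ v g ∧ w x ≠ v b)
    (k2 : ∀ x, v x = v g ∨ v x = v b → w x ≠ v h ∧ w x ≠ v a) (x : H)
    (hx : w' x = v x ∨ ∃ y, y ≠ x ∧ v y = v x ∧ w' y = w' x) :
    x ≠ h ∧ (w x = v x ∨ ∃ y, y ≠ x ∧ v y = v x ∧ w y = w x) := by
  have key : ∀ x y, y ≠ x → v y = v x → w' y = w' x →
      (x ≠ h ∧ x ≠ g ∧ x ≠ a ∧ x ≠ b) ∧ (y ≠ h ∧ y ≠ g ∧ y ≠ a ∧ y ≠ b) := by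
    intro x y n1 n2 n3
    have aux : ∀ x y, y ≠ x → v y = v x → w' y = w' x →
        (x ≠ h ∧ x ≠ g ∧ x ≠ a ∧ x ≠ b) := by
      intro x y n1 n2 n3
      have k1y := k1 y
      have k2y := k2 y
      have e5y := e5 y
      clear k1 k2 e5
      by_cases yh : y = h
      · subst yh; refine ⟨?_, ?_, ?_, ?_⟩ <;> rintro rfl <;> simp_all
      by_cases yg : y = g
      · subst yg; refine ⟨?_, ?_, ?_, ?_⟩ <;> rintro rfl <;> simp_all
      by_cases ya : y = a
      · subst ya; refine ⟨?_, ?_, ?_, ?_⟩ <;> rintro rfl <;> simp_all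
      by_cases yb : y = b
      · subst yb; refine ⟨?_, ?_, ?_, ?_⟩ <;> rintro rfl <;> simp_all
      have := e5y yh yg ya yb
      refine ⟨?_, ?_, ?_, ?_⟩ <;> rintro rfl <;> simp_all
    exact ⟨aux x y n1 n2 n3, aux y x n1.symm n2.symm n3.symm⟩
  rcases hx with hx | ⟨y, n1, n2, n3⟩
  · have xh : x ≠ h := by rintro rfl; exact h1 (e1.symm.trans hx)
    have xg : x ≠ g := by rintro rfl; exact h1 (hx.symm.trans e2)
    have xa : x ≠ a := by rintro rfl; exact h4 (e3.symm.trans hx)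
    have xb : x ≠ b := by rintro rfl; exact h4 (hx.symm.trans e4)
    exact ⟨xh, Or.inl ((e5 x xh xg xa xb).symm.trans hx)⟩
  · obtain ⟨kx, ky⟩ := key x y n1 n2 n3
    refine ⟨kx.1, Or.inr ⟨y, n1, n2, ?_⟩⟩
    rw [← e5 x kx.1 kx.2.1 kx.2.2.1 kx.2.2.2, ← e5 y ky.1 ky.2.1 ky.2.2.1 ky.2.2.2, n3]

lemma badSet_conj_swap_subset {H V : Type*} [Fintype H] {v : H → V} {π : Equiv.Perm H}
    (hπ : π ∈ matchings H) {h g : H} (hg : g ∉ badSet v π)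
    (h1 : v g ≠ v h ∧ v g ≠ v (π h) ∧ v (π g) ≠ v h ∧ v (π g) ≠ v (π h))
    (h2 : ∀ x, v x = v h ∨ v x = v (π h) → v (π x) ≠ v g ∧ v (π x) ≠ v (π g)) :
    badSet v (Equiv.swap (π h) g * π * (Equiv.swap (π h) g)⁻¹) ⊆ (badSet v π).erase h := by
  rw [mem_matchings] at hπ
  set σ := Equiv.swap (π h) g with hσ
  set π' := σ * π * σ⁻¹ with hπ'
  have hp : ∀ x, π' x = σ (π (σ x)) := fun x => by simp [hπ', hσ]
  have hππ : ∀ x, π (π x) = x := fun x => (hπ x).1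
  have n1 : h ≠ g := fun e => h1.1 (by rw [e])
  have n2 : π h ≠ g := fun e => h1.2.1 (by rw [e])
  have n3 : π g ≠ h := fun e => h1.2.2.1 (by rw [e])
  have n4 : π g ≠ π h := fun e => h1.2.2.2 (by rw [e])
  have n5 : π h ≠ h := (hπ h).2
  have n6 : π g ≠ g := (hπ g).2
  have e1 : π' h = g := by
    rw [hp, hσ, Equiv.swap_apply_of_ne_of_ne n5.symm n1, Equiv.swap_apply_left]
  have e2 : π' g = h := by
    rw [hp, hσ, Equiv.swap_apply_right, hππ, Equiv.swap_apply_of_ne_of_ne n5.symm n1]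
  have e3 : π' (π h) = π g := by
    rw [hp, hσ, Equiv.swap_apply_left, Equiv.swap_apply_of_ne_of_ne n4 n6]
  have e4 : π' (π g) = π h := by
    rw [hp, hσ, Equiv.swap_apply_of_ne_of_ne n4 n6, hππ, Equiv.swap_apply_right]
  have e5 : ∀ x, x ≠ h → x ≠ g → x ≠ π h → x ≠ π g → π' x = π x := by
    intro x a b c e
    rw [hp, hσ, Equiv.swap_apply_of_ne_of_ne c b, Equiv.swap_apply_of_ne_of_ne]
    · exact fun h' => a (π.injective h')
    · exact fun h' => e (by rw [← h', hππ])
  have hww : v (π g) ≠ v g := fun e => hg (mem_badSet.2 (Or.inl e))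
  have h3 : ∀ x, v x = v g ∨ v x = v (π g) → v (π x) ≠ v h ∧ v (π x) ≠ v (π h) := by
    intro x hx
    constructor <;> intro e
    · have := h2 (π x) (Or.inl e)
      rw [hππ] at this
      tauto
    · have := h2 (π x) (Or.inr e)
      rw [hππ] at this
      tauto
  intro x hx
  rw [mem_badSet] at hx
  rw [Finset.mem_erase, mem_badSet]
  exact bad_of_switch (w := fun x => v (π x)) (w' := fun x => v (π' x)) h1.1 h1.2.1 h1.2.2.1
    h1.2.2.2 hww (congrArg v e1) (congrArg v e2) (congrArg v e3) (congrArg v e4)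
    (fun x a b c e => congrArg v (e5 x a b c e)) h2 h3 x hx

lemma exists_good_switch {H V : Type*} [Fintype H] {v : H → V} {d : ℕ}
    (hv : ∀ u, (Finset.univ.filter fun h => v h = u).card ≤ d) {π : Equiv.Perm H}
    (hπ : π ∈ matchings H) (h : H)
    (hcard : (badSet v π).card + 2 * ((2 + 2 * d) * d) < Fintype.card H) :
    ∃ g, (badSet v (Equiv.swap (π h) g * π * (Equiv.swap (π h) g)⁻¹)) ⊆ (badSet v π).erase h := by
  set A := Finset.univ.filter fun x => v x = v h
  set B := Finset.univ.filter fun x => v x = v (π h)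
  set S : Finset V := {v h, v (π h)} ∪ (A.image (fun x => v (π x)) ∪ B.image fun x => v (π x))
  have hS : S.card ≤ 2 + 2 * d := by
    refine (Finset.card_union_le _ _).trans (add_le_add Finset.card_le_two ?_)
    refine (Finset.card_union_le _ _).trans ?_
    rw [two_mul]
    exact add_le_add (Finset.card_image_le.trans (hv _)) (Finset.card_image_le.trans (hv _))
  set P := S.biUnion fun u => Finset.univ.filter fun h => v h = u
  have hP : P.card ≤ (2 + 2 * d) * d :=
    (Finset.card_biUnion_le_card_mul _ _ d fun u _ => hv u).trans (Nat.mul_le_mul_right _ hS)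
  have hPm : ∀ x, x ∈ P ↔ v x ∈ S := by intro x; simp [P]
  obtain ⟨g, hg⟩ : ∃ g, g ∉ badSet v π ∪ (P ∪ P.image π) := by
    by_contra! hall
    have h1 : Fintype.card H ≤ (badSet v π ∪ (P ∪ P.image π)).card := by
      rw [Finset.eq_univ_of_forall hall, Finset.card_univ]
    have h2 := Finset.card_union_le (badSet v π) (P ∪ P.image π)
    have h3 := Finset.card_union_le P (P.image π)
    have h4 : (P.image π).card ≤ P.card := Finset.card_image_le
    omega
  simp only [Finset.mem_union, not_or] at hg
  have g1 : v g ∉ S := fun h' => hg.2.1 ((hPm g).2 h')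
  have g2 : v (π g) ∉ S := fun h' => hg.2.2
    (Finset.mem_image.2 ⟨π g, (hPm _).2 h', ((mem_matchings.1 hπ) g).1⟩)
  have key : ∀ u, u ∉ S → u ≠ v h ∧ u ≠ v (π h) ∧
      ∀ x, v x = v h ∨ v x = v (π h) → v (π x) ≠ u := by
    intro u hu
    refine ⟨fun e => hu (by simp [S, e]), fun e => hu (by simp [S, e]), ?_⟩
    rintro x hx rfl
    refine hu (Finset.mem_union_right _ ?_)
    rcases hx with hx | hx
    · exact Finset.mem_union_left _ (Finset.mem_image_of_mem _ (by simp [A, hx]))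
    · exact Finset.mem_union_right _
        (Finset.mem_image_of_mem (fun x => v (π x)) (by simp [B, hx]))
  have k1 := key _ g1
  have k2 := key _ g2
  exact ⟨g, badSet_conj_swap_subset hπ hg.1 ⟨k1.1, k1.2.1, k2.1, k2.2.1⟩
    fun x hx => ⟨k1.2.2 x hx, k2.2.2 x hx⟩⟩

/-- The matchings with at most `k` bad half-edges. -/
def nearSimple {H V : Type*} [Fintype H] (v : H → V) (k : ℕ) : Finset (Equiv.Perm H) :=
  (matchings H).filter fun π => (badSet v π).card ≤ k

lemma card_nearSimple_succ_le {H V : Type*} [Fintype H] {v : H → V} {d : ℕ}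
    (hv : ∀ u, (Finset.univ.filter fun h => v h = u).card ≤ d) (k : ℕ)
    (hcard : (k + 1) + 2 * ((2 + 2 * d) * d) < Fintype.card H) :
    (nearSimple v (k + 1)).card ≤ (1 + Fintype.card H ^ 2) * (nearSimple v k).card := by
  have hsub : nearSimple v (k + 1) ⊆ nearSimple v k ∪
      ((nearSimple v k) ×ˢ (Finset.univ : Finset (H × H))).image fun x =>
        Equiv.swap x.2.1 x.2.2 * x.1 * (Equiv.swap x.2.1 x.2.2)⁻¹ := by
    intro π hπ
    obtain ⟨hm, hb⟩ := Finset.mem_filter.1 hπ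
    rcases (badSet v π).eq_empty_or_nonempty with he | ⟨h, hh⟩
    · exact Finset.mem_union_left _ (Finset.mem_filter.2 ⟨hm, by simp [he]⟩)
    · obtain ⟨g, hg⟩ := exists_good_switch hv hm h (by omega)
      refine Finset.mem_union_right _ (Finset.mem_image.2
        ⟨(Equiv.swap (π h) g * π * (Equiv.swap (π h) g)⁻¹, (π h, g)), ?_, ?_⟩)
      · refine Finset.mem_product.2 ⟨Finset.mem_filter.2 ⟨conj_mem_matchings hm _, ?_⟩,
          Finset.mem_univ _⟩
        have := Finset.card_le_card hg
        rw [Finset.card_erase_of_mem hh] at this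
        dsimp only
        omega
      · simp [mul_assoc]
  refine (Finset.card_le_card hsub).trans ((Finset.card_union_le _ _).trans ?_)
  rw [add_mul, one_mul]
  refine Nat.add_le_add_left (Finset.card_image_le.trans ?_) _
  rw [Finset.card_product, Finset.card_univ, Fintype.card_prod, mul_comm, sq]

lemma card_nearSimple_le {H V : Type*} [Fintype H] {v : H → V} {d : ℕ}
    (hv : ∀ u, (Finset.univ.filter fun h => v h = u).card ≤ d) (k : ℕ)
    (hcard : k + 2 * ((2 + 2 * d) * d) < Fintype.card H) :
    (nearSimple v k).card ≤ (1 + Fintype.card H ^ 2) ^ k * (nearSimple v 0).card := by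
  induction k with
  | zero => simp
  | succ k ih =>
    refine (card_nearSimple_succ_le hv k hcard).trans ?_
    rw [pow_succ' _ k, mul_assoc]
    exact Nat.mul_le_mul_left _ (ih (by omega))

lemma card_matchings_apply {H : Type*} [Fintype H] (h g : H) :
    (Fintype.card H - 1) * ((matchings H).filter fun π => π h = g).card ≤ (matchings H).card := by
  by_cases hgh : g = h
  · subst hgh
    rw [Finset.filter_false_of_mem fun π hπ => (mem_matchings.1 hπ g).2]
    simp
  rw [Finset.card_eq_sum_card_fiberwise (f := fun π : Equiv.Perm H => π h)
    (s := matchings H) (t := Finset.univ.erase h)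
    (fun π hπ => by simpa using (mem_matchings.1 hπ h).2), ← Finset.card_univ,
    ← Finset.card_erase_of_mem (Finset.mem_univ h), ← smul_eq_mul]
  refine Finset.card_nsmul_le_sum _ _ _ fun g' hg' => ?_
  have hg'' : g' ≠ h := (Finset.mem_erase.1 hg').1
  refine Finset.card_le_card_of_injOn
    (fun π => Equiv.swap g g' * π * (Equiv.swap g g')⁻¹) ?_ ?_
  · intro π hπ
    simp only [Finset.coe_filter, Set.mem_ofPred_eq] at hπ ⊢
    refine ⟨conj_mem_matchings hπ.1 _, ?_⟩
    simp only [Equiv.swap_inv, Equiv.Perm.coe_mul, Function.comp_apply]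
    rw [Equiv.swap_apply_of_ne_of_ne (Ne.symm hgh) hg''.symm, hπ.2, Equiv.swap_apply_left]
  · intro π _ π' _ e
    exact mul_left_cancel (mul_right_cancel e)

lemma card_matchings_apply_apply {H : Type*} [Fintype H] {h h' g g' : H}
    (n1 : h' ≠ h) (n2 : g ≠ h') (n3 : g' ≠ h) :
    (Fintype.card H - 3) * ((matchings H).filter fun π => π h = g ∧ π h' = g').card ≤
      ((matchings H).filter fun π => π h = g).card := by
  by_cases n4 : g' = h'
  · subst n4
    rw [Finset.filter_false_of_mem fun π hπ e => (mem_matchings.1 hπ g').2 e.2]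
    simp
  by_cases n5 : g' = g
  · subst n5
    rw [Finset.filter_false_of_mem fun π hπ e => n1 (π.injective (e.2.trans e.1.symm))]
    simp
  rw [Finset.card_eq_sum_card_fiberwise (f := fun π : Equiv.Perm H => π h')
    (s := (matchings H).filter fun π => π h = g) (t := Finset.univ)
    (fun π hπ => by simp)]
  have hs : ({h, h', g} : Finset H).card ≤ 3 := Finset.card_le_three
  have hc : Fintype.card H - 3 ≤ (Finset.univ \ ({h, h', g} : Finset H)).card := by
    rw [Finset.card_sdiff_of_subset (Finset.subset_univ _), Finset.card_univ]
    omega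
  refine (Nat.mul_le_mul_right _ hc).trans ?_
  rw [← smul_eq_mul]
  refine (Finset.card_nsmul_le_sum _ (fun x => (((matchings H).filter fun π => π h = g).filter
    fun π => π h' = x).card) _ fun x hx => ?_).trans
    (Finset.sum_le_sum_of_subset (Finset.subset_univ _))
  simp only [Finset.mem_sdiff, Finset.mem_univ, true_and, Finset.mem_insert,
    Finset.mem_singleton, not_or] at hx
  refine Finset.card_le_card_of_injOn
    (fun π => Equiv.swap g' x * π * (Equiv.swap g' x)⁻¹) ?_ ?_
  · intro π hπ
    simp only [Finset.coe_filter, Set.mem_ofPred_eq, Finset.mem_filter] at hπ ⊢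
    refine ⟨⟨conj_mem_matchings hπ.1 _, ?_⟩, ?_⟩
    · simp only [Equiv.swap_inv, Equiv.Perm.coe_mul, Function.comp_apply]
      rw [Equiv.swap_apply_of_ne_of_ne n3.symm (Ne.symm hx.1), hπ.2.1,
        Equiv.swap_apply_of_ne_of_ne (Ne.symm n5) (Ne.symm hx.2.2)]
    · simp only [Equiv.swap_inv, Equiv.Perm.coe_mul, Function.comp_apply]
      rw [Equiv.swap_apply_of_ne_of_ne (Ne.symm n4) (Ne.symm hx.2.1), hπ.2.2,
        Equiv.swap_apply_left]
  · intro π _ π' _ e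
    exact mul_left_cancel (mul_right_cancel e)

lemma card_mul_card_bad_le {H V : Type*} [Fintype H] {v : H → V} {d : ℕ}
    (hv : ∀ u, (Finset.univ.filter fun h => v h = u).card ≤ d) (hN : 4 ≤ Fintype.card H) (h : H) :
    Fintype.card H * ((matchings H).filter fun π => h ∈ badSet v π).card ≤
      (2 * d + 4 * d ^ 2) * (matchings H).card := by
  set N := Fintype.card H with hNdef
  set A : H → Finset H := fun g => Finset.univ.filter fun x => v x = v g with hA
  have hAc : ∀ g, (A g).card ≤ d := fun g => hv (v g)
  have hmA : ∀ g x, x ∈ A g ↔ v x = v g := by intro g x; simp [hA]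
  set F : H → Finset (Equiv.Perm H) := fun g => (matchings H).filter fun π => π h = g
  set F2 : H → H → H → Finset (Equiv.Perm H) := fun h' g g' =>
    (matchings H).filter fun π => π h = g ∧ π h' = g'
  set O : Finset H := Finset.univ.filter fun g => v g ≠ v h
  have hsub : ((matchings H).filter fun π => h ∈ badSet v π) ⊆ (A h).biUnion F ∪
      ((A h).erase h).biUnion fun h' => O.biUnion fun g => (A g).biUnion fun g' => F2 h' g g' := by
    intro π hπ
    obtain ⟨hm, hb⟩ := Finset.mem_filter.1 hπ
    by_cases hl : v (π h) = v h
    · exact Finset.mem_union_left _ (Finset.mem_biUnion.2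
        ⟨π h, (hmA _ _).2 hl, Finset.mem_filter.2 ⟨hm, rfl⟩⟩)
    · obtain ⟨h', n1, n2, n3⟩ := (mem_badSet.1 hb).resolve_left hl
      refine Finset.mem_union_right _ (Finset.mem_biUnion.2
        ⟨h', Finset.mem_erase.2 ⟨n1, (hmA _ _).2 n2⟩, Finset.mem_biUnion.2
          ⟨π h, by simp [O, hl], Finset.mem_biUnion.2
            ⟨π h', (hmA _ _).2 n3, Finset.mem_filter.2 ⟨hm, rfl, rfl⟩⟩⟩⟩)
  have hF : ∀ g, N * (F g).card ≤ 2 * (matchings H).card := by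
    intro g
    have h1 : N * (F g).card ≤ 2 * (N - 1) * (F g).card := Nat.mul_le_mul_right _ (by omega)
    have h2 := card_matchings_apply h g
    calc _ ≤ _ := h1
      _ = 2 * ((N - 1) * (F g).card) := by ring
      _ ≤ _ := Nat.mul_le_mul_left _ h2
  have hF2 : ∀ h' g g', h' ≠ h → g ≠ h' → g' ≠ h → N * (F2 h' g g').card ≤ 4 * (F g).card := by
    intro h' g g' n1 n2 n3
    have h1 : N * (F2 h' g g').card ≤ 4 * (N - 3) * (F2 h' g g').card :=
      Nat.mul_le_mul_right _ (by omega)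
    have h2 := card_matchings_apply_apply n1 n2 n3
    calc _ ≤ _ := h1
      _ = 4 * ((N - 3) * (F2 h' g g').card) := by ring
      _ ≤ _ := Nat.mul_le_mul_left _ h2
  have hsum : ∑ g ∈ O, (F g).card ≤ (matchings H).card := by
    rw [Finset.card_eq_sum_card_fiberwise (f := fun π : Equiv.Perm H => π h)
      (s := matchings H) (t := Finset.univ) (fun π _ => by simp)]
    exact Finset.sum_le_sum_of_subset (Finset.subset_univ _)
  have hone : N * ((A h).biUnion F).card ≤ d * (2 * (matchings H).card) := by
    refine (Nat.mul_le_mul_left _ Finset.card_biUnion_le).trans ?_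
    rw [Finset.mul_sum]
    refine (Finset.sum_le_card_nsmul _ _ _ fun g _ => hF g).trans ?_
    exact Nat.mul_le_mul_right _ (hAc h)
  have htwo : N * (((A h).erase h).biUnion fun h' => O.biUnion fun g => (A g).biUnion
      fun g' => F2 h' g g').card ≤ d * (d * 4 * (matchings H).card) := by
    refine (Nat.mul_le_mul_left _ Finset.card_biUnion_le).trans ?_
    rw [Finset.mul_sum]
    refine (Finset.sum_le_card_nsmul _ _ (d * 4 * (matchings H).card) fun h' hh' => ?_).trans
      (Nat.mul_le_mul_right _ ((Finset.card_le_card (Finset.erase_subset _ _)).trans (hAc h)))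
    obtain ⟨n1, n2⟩ := Finset.mem_erase.1 hh'
    rw [hmA] at n2
    refine (Nat.mul_le_mul_left _ Finset.card_biUnion_le).trans ?_
    refine le_trans ?_ (Nat.mul_le_mul_left _ hsum)
    rw [Finset.mul_sum, Finset.mul_sum]
    refine Finset.sum_le_sum fun g hg => ?_
    have hg' : v g ≠ v h := (Finset.mem_filter.1 hg).2
    refine (Nat.mul_le_mul_left _ Finset.card_biUnion_le).trans ?_
    rw [Finset.mul_sum, mul_assoc]
    refine (Finset.sum_le_card_nsmul _ _ (4 * (F g).card) fun g' hgg' => ?_).trans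
      (Nat.mul_le_mul_right _ (hAc g))
    rw [hmA] at hgg'
    refine hF2 h' g g' n1 (fun e => hg' (by rw [e, n2])) fun e => hg' (by rw [← hgg', e])
  calc _ ≤ N * _ := Nat.mul_le_mul_left _ ((Finset.card_le_card hsub).trans
        (Finset.card_union_le _ _))
    _ ≤ _ := by
      rw [mul_add]
      refine (add_le_add hone htwo).trans (le_of_eq ?_)
      ring

lemma sum_card_badSet_le {H V : Type*} [Fintype H] {v : H → V} {d : ℕ}
    (hv : ∀ u, (Finset.univ.filter fun h => v h = u).card ≤ d) (hN : 4 ≤ Fintype.card H) :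
    ∑ π ∈ matchings H, (badSet v π).card ≤ (2 * d + 4 * d ^ 2) * (matchings H).card := by
  have h1 : ∑ π ∈ matchings H, (badSet v π).card =
      ∑ h, ((matchings H).filter fun π => h ∈ badSet v π).card := by
    simp_rw [Finset.card_filter]
    rw [Finset.sum_comm]
    refine Finset.sum_congr rfl fun π _ => ?_
    rw [← Finset.card_filter, Finset.filter_mem_eq_inter, Finset.univ_inter]
  have h2 : Fintype.card H * ∑ π ∈ matchings H, (badSet v π).card ≤
      Fintype.card H * ((2 * d + 4 * d ^ 2) * (matchings H).card) := by
    rw [h1, Finset.mul_sum]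
    refine (Finset.sum_le_card_nsmul _ _ _ fun h _ => card_mul_card_bad_le hv hN h).trans ?_
    rw [Finset.card_univ, smul_eq_mul]
  exact Nat.le_of_mul_le_mul_left h2 (by omega)

lemma card_matchings_le_nearSimple {H V : Type*} [Fintype H] {v : H → V} {d : ℕ}
    (hv : ∀ u, (Finset.univ.filter fun h => v h = u).card ≤ d) (hN : 4 ≤ Fintype.card H) :
    (matchings H).card ≤ 2 * (nearSimple v (2 * (2 * d + 4 * d ^ 2))).card := by
  set K := 2 * d + 4 * d ^ 2
  have h1 := sum_card_badSet_le hv hN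
  have h2 := Finset.card_filter_add_card_filter_not (s := matchings H)
    (fun π => (badSet v π).card ≤ 2 * K)
  set B := (matchings H).filter fun π => ¬ (badSet v π).card ≤ 2 * K
  have h3 : B.card * (2 * K + 1) ≤ K * (matchings H).card := by
    refine le_trans ?_ h1
    have h6 : B.card * (2 * K + 1) ≤ ∑ π ∈ B, (badSet v π).card := by
      rw [← smul_eq_mul]
      refine Finset.card_nsmul_le_sum B (fun π => (badSet v π).card) _ fun π hπ => ?_
      have := (Finset.mem_filter.1 hπ).2
      omega
    exact h6.trans (Finset.sum_le_sum_of_subset (Finset.filter_subset _ _))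
  have h4 : (nearSimple v (2 * K)).card + B.card = (matchings H).card := h2
  by_contra! h5
  have h6 : (matchings H).card < 2 * B.card := by omega
  nlinarith

lemma card_matchings_le_simple {H V : Type*} [Fintype H] {v : H → V} {d : ℕ}
    (hv : ∀ u, (Finset.univ.filter fun h => v h = u).card ≤ d) (hN : 4 ≤ Fintype.card H)
    (hN' : 2 * (2 * d + 4 * d ^ 2) + 2 * ((2 + 2 * d) * d) < Fintype.card H) :
    (matchings H).card ≤ 2 * ((1 + Fintype.card H ^ 2) ^ (2 * (2 * d + 4 * d ^ 2)) *
      (nearSimple v 0).card) :=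
  (card_matchings_le_nearSimple hv hN).trans (Nat.mul_le_mul_left _ (card_nearSimple_le hv _ hN'))

/-! ### Ports -/

/-- The map sending the half-edge `(u, i)` to the opposite half-edge, when the neighbors of each
vertex are numbered. -/
def portMap {V : Type*} {d : ℕ} {G : SimpleGraph V} (e : ∀ u, Fin d ≃ G.neighborSet u)
    (h : V × Fin d) : V × Fin d :=
  ((e h.1 h.2 : V), (e (e h.1 h.2 : V)).symm ⟨h.1, (e h.1 h.2).2.symm⟩)

lemma portMap_portMap {V : Type*} {d : ℕ} {G : SimpleGraph V} (e : ∀ u, Fin d ≃ G.neighborSet u)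
    (h : V × Fin d) : portMap e (portMap e h) = h := by
  have h1 : (e (portMap e h).1 (portMap e h).2 : V) = h.1 :=
    congrArg Subtype.val (Equiv.apply_symm_apply _ _)
  have key : ∀ (w : V) (hw : w ∈ G.neighborSet h.1) (j : Fin d) (hj : (e w j : V) = h.1),
      w = (e h.1 h.2 : V) → portMap e (w, j) = h := by
    rintro w hw j hj rfl
    have : ∀ (x : V) (hx : (e h.1 h.2 : V) ∈ G.neighborSet x), x = h.1 →
        (x, (e x).symm ⟨(e h.1 h.2 : V), hx⟩) = h := by
      rintro x hx rfl
      simp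
    exact this _ _ hj
  exact key _ (e h.1 h.2).2 _ h1 rfl

/-- The matching of the half-edges determined by numberings of the neighbors of all vertices. -/
def portMatching {V : Type*} {d : ℕ} {G : SimpleGraph V} (e : ∀ u, Fin d ≃ G.neighborSet u) :
    Equiv.Perm (V × Fin d) :=
  Function.Involutive.toPerm (portMap e) (portMap_portMap e)

lemma portMatching_apply_fst {V : Type*} {d : ℕ} {G : SimpleGraph V}
    (e : ∀ u, Fin d ≃ G.neighborSet u) (h : V × Fin d) :
    (portMatching e h).1 = e h.1 h.2 := rfl

lemma portMatching_portMatching {V : Type*} {d : ℕ} {G : SimpleGraph V}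
    (e : ∀ u, Fin d ≃ G.neighborSet u) (h : V × Fin d) :
    portMatching e (portMatching e h) = h := portMap_portMap e h

lemma portMatching_mem_matchings {V : Type*} [Fintype V] {d : ℕ} {G : SimpleGraph V}
    (e : ∀ u, Fin d ≃ G.neighborSet u) : portMatching e ∈ matchings (V × Fin d) := by
  refine mem_matchings.2 fun h => ⟨portMatching_portMatching e h, fun e' => ?_⟩
  have := (e h.1 h.2).2
  rw [← portMatching_apply_fst, e'] at this
  exact G.loopless.irrefl _ this

lemma portMatching_adj_iff {V : Type*} {d : ℕ} {G : SimpleGraph V}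
    (e : ∀ u, Fin d ≃ G.neighborSet u) (u w : V) :
    G.Adj u w ↔ ∃ i, (portMatching e (u, i)).1 = w := by
  constructor
  · intro h
    exact ⟨(e u).symm ⟨w, h⟩, by simp [portMatching_apply_fst]⟩
  · rintro ⟨i, rfl⟩
    exact (e u i).2

/-- A fixed numbering of the neighbors of a vertex of a regular graph. -/
def stdPort {d n : ℕ} (G : regularGraphs d n) (u : Fin n) : Fin d ≃ G.1.neighborSet u :=
  (Finite.equivFinOfCardEq (by rw [Nat.card_coe_set_eq]; exact G.2 u)).symm

/-- The numbering of the neighbors obtained from `stdPort` by permuting the labels. -/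
def portOf {d n : ℕ} (G : regularGraphs d n) (s : Fin n → Equiv.Perm (Fin d)) (u : Fin n) :
    Fin d ≃ G.1.neighborSet u := (s u).trans (stdPort G u)

lemma portMatching_portOf_injective (d n : ℕ) :
    Function.Injective fun x : regularGraphs d n × (Fin n → Equiv.Perm (Fin d)) =>
      portMatching (portOf x.1 x.2) := by
  rintro ⟨G, s⟩ ⟨G', s'⟩ h
  dsimp only at h
  have hG : G = G' := by
    refine Subtype.ext (SimpleGraph.ext ?_)
    ext u w
    rw [portMatching_adj_iff (portOf G s), portMatching_adj_iff (portOf G' s'), h]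
  subst hG
  refine Prod.ext rfl (funext fun u => Equiv.ext fun i => ?_)
  have := congrArg (fun π : Equiv.Perm (Fin n × Fin d) => (π (u, i)).1) h
  exact (stdPort G u).injective (Subtype.ext this)

lemma exists_portMatching_eq {d n : ℕ} {π : Equiv.Perm (Fin n × Fin d)}
    (hπ : π ∈ nearSimple (Prod.fst : Fin n × Fin d → Fin n) 0) :
    ∃ x : regularGraphs d n × (Fin n → Equiv.Perm (Fin d)), portMatching (portOf x.1 x.2) = π := by
  obtain ⟨hm, hb⟩ := Finset.mem_filter.1 hπ
  rw [mem_matchings] at hm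
  have hb' : ∀ h, h ∉ badSet Prod.fst π := by
    intro h
    rw [Finset.card_eq_zero.1 (Nat.le_zero.1 hb)]
    simp
  simp only [mem_badSet, not_or, not_exists, not_and] at hb'
  let G : SimpleGraph (Fin n) :=
    { Adj := fun u w => ∃ i, (π (u, i)).1 = w
      symm := ⟨by
        rintro u w ⟨i, rfl⟩
        exact ⟨(π (u, i)).2, by rw [Prod.mk.eta, (hm _).1]⟩⟩
      loopless := ⟨by
        rintro u ⟨i, hi⟩
        exact (hb' (u, i)).1 hi⟩ }
  let e : ∀ u, Fin d ≃ G.neighborSet u := fun u =>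
    Equiv.ofBijective (fun i => ⟨(π (u, i)).1, i, rfl⟩) ⟨by
      intro i j hij
      by_contra hne
      exact (hb' (u, j)).2 (u, i) (fun h => hne (congrArg Prod.snd h)) rfl
        (congrArg Subtype.val hij), by
      rintro ⟨w, i, rfl⟩
      exact ⟨i, rfl⟩⟩
  have hG : G ∈ regularGraphs d n := by
    intro u
    rw [← Nat.card_coe_set_eq, Nat.card_congr (e u).symm, Nat.card_fin]
  refine ⟨(⟨G, hG⟩, fun u => (e u).trans (stdPort ⟨G, hG⟩ u).symm), ?_⟩
  have h1 : ∀ u, portOf ⟨G, hG⟩ (fun u => (e u).trans (stdPort ⟨G, hG⟩ u).symm) u = e u := by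
    intro u
    ext i
    simp [portOf]
  have h2 : ∀ h, (portMatching (portOf ⟨G, hG⟩
      (fun u => (e u).trans (stdPort ⟨G, hG⟩ u).symm)) h).1 = (π h).1 := by
    intro h
    rw [portMatching_apply_fst, h1]
    rfl
  ext1 h
  refine Prod.ext (h2 h) ?_
  set π' := portMatching (portOf ⟨G, hG⟩ (fun u => (e u).trans (stdPort ⟨G, hG⟩ u).symm))
  have h3 : π (π' h) = h := by
    have h4 : (π (π' h)).1 = h.1 := by
      rw [← h2, portMatching_portMatching]
    by_contra hne
    exact (hb' (π h)).2 (π' h) (fun h' => hne (by rw [h', (hm h).1])) (h2 h)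
      (by rw [h4, (hm h).1])
  rw [← (hm (π' h)).1, h3]

lemma card_nearSimple_zero_le (d n : ℕ) :
    (nearSimple (Prod.fst : Fin n × Fin d → Fin n) 0).card ≤
      (regularGraphs d n).ncard * d.factorial ^ n := by
  have h1 : nearSimple (Prod.fst : Fin n × Fin d → Fin n) 0 ⊆
      Finset.univ.image fun x : regularGraphs d n × (Fin n → Equiv.Perm (Fin d)) =>
        portMatching (portOf x.1 x.2) := by
    intro π hπ
    obtain ⟨x, hx⟩ := exists_portMatching_eq hπ
    exact Finset.mem_image.2 ⟨x, Finset.mem_univ _, hx⟩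
  refine (Finset.card_le_card h1).trans (Finset.card_image_le.trans (le_of_eq ?_))
  rw [Finset.card_univ, Fintype.card_prod, Fintype.card_fun, Fintype.card_perm, Fintype.card_fin,
    Fintype.card_fin, ← Nat.card_eq_fintype_card, Nat.card_coe_set_eq]

/-- The number of matchings is at most polynomially larger than the number of numbered regular
graphs. -/
lemma card_matchings_le_regularGraphs {d n : ℕ} (hn : 4 ≤ n * d)
    (hn' : 2 * (2 * d + 4 * d ^ 2) + 2 * ((2 + 2 * d) * d) < n * d) :
    (matchings (Fin n × Fin d)).card ≤ 2 * ((1 + (n * d) ^ 2) ^ (2 * (2 * d + 4 * d ^ 2)) *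
      ((regularGraphs d n).ncard * d.factorial ^ n)) := by
  have hc : Fintype.card (Fin n × Fin d) = n * d := by simp
  have hv : ∀ u, (Finset.univ.filter fun h : Fin n × Fin d => h.1 = u).card ≤ d := by
    intro u
    refine le_of_eq ?_
    have : (Finset.univ.filter fun h : Fin n × Fin d => h.1 = u) =
        ({u} : Finset (Fin n)) ×ˢ (Finset.univ : Finset (Fin d)) := by
      ext h
      rw [Finset.mem_filter, Finset.mem_product]
      simp
    rw [this, Finset.card_product]
    simp
  refine (card_matchings_le_simple (v := Prod.fst) (fun u => by convert hv u) (by rw [hc]; exact hn) (by rw [hc]; exact hn')).trans ?_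
  rw [hc]
  exact Nat.mul_le_mul_left _ (Nat.mul_le_mul_left _ (card_nearSimple_zero_le d n))

/-! ### Local views along ports -/

/-- Words of length at most `k` over `m` letters. -/
abbrev Wd (m k : ℕ) : Type := {l : List (Fin m) // l.length ≤ k}

instance (m k : ℕ) : Finite (Wd m k) := (List.finite_length_le (Fin m) k).to_subtype

instance (m k : ℕ) : Fintype (Wd m k) := Fintype.ofFinite _

/-- Addresses of the vertices of a ball of radius `k + 1` in the `(m + 1)`-regular tree. -/
abbrev BallIx (m k : ℕ) : Type := Option (Fin (m + 1) × Wd m k)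

/-- Addresses of the vertices at distance at most `k` from an edge of the `(m + 1)`-regular
tree. -/
abbrev EdgeIx (m k : ℕ) : Type := Bool × Wd m k

/-- Follow a word from a half-edge `h`; the ports at a vertex other than the one pointing back are
numbered by `Fin m`. -/
def walk {V : Type*} {m : ℕ} (π : V × Fin (m + 1) → V × Fin (m + 1)) (h : V × Fin (m + 1)) :
    List (Fin m) → V × Fin (m + 1)
  | [] => h
  | k :: l => π ((walk π h l).1, (walk π h l).2.succAbove k)

lemma walk_append_singleton {V : Type*} {m : ℕ} (π : V × Fin (m + 1) → V × Fin (m + 1))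
    (h : V × Fin (m + 1)) (l : List (Fin m)) (j : Fin m) :
    walk π h (l ++ [j]) = walk π (π (h.1, h.2.succAbove j)) l := by
  induction l with
  | nil => rfl
  | cons k l ih => simp only [List.cons_append, walk, ih]

/-- The color and port patterns seen around the vertex `v`. -/
def localView {V M : Type*} {m : ℕ} (k : ℕ) (π : V × Fin (m + 1) → V × Fin (m + 1)) (f : V → M)
    (v : V) : (BallIx m k → M) × (Fin (m + 1) × Wd m k → Fin (m + 1)) :=
  (fun s => s.elim (f v) fun p => f (walk π (π (v, p.1)) p.2.1).1,
    fun p => (walk π (π (v, p.1)) p.2.1).2)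

/-- The address in the ball around a vertex of an address around its edge with number `i`. -/
def edgeToBall {m k : ℕ} (i : Fin (m + 1)) (e : EdgeIx m k) : BallIx m k :=
  if e.1 then some (i, e.2) else
    if h : e.2.1 = [] then none else
      some (i.succAbove (e.2.1.getLast h), ⟨e.2.1.dropLast, by
        have := e.2.2
        rw [List.length_dropLast]
        omega⟩)

lemma edgeToBall_true {m k : ℕ} (i : Fin (m + 1)) (l : Wd m k) :
    edgeToBall i (true, l) = some (i, l) := by simp [edgeToBall]

lemma edgeToBall_nil {m k : ℕ} (i : Fin (m + 1)) :
    edgeToBall i (false, (⟨[], by simp⟩ : Wd m k)) = none := by simp [edgeToBall]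

lemma edgeToBall_append {m k : ℕ} (i : Fin (m + 1)) (l : List (Fin m)) (j : Fin m)
    (h : (l ++ [j]).length ≤ k) :
    edgeToBall i (false, (⟨l ++ [j], h⟩ : Wd m k)) =
      some (i.succAbove j, ⟨l, by simp at h; omega⟩) := by
  simp [edgeToBall]

lemma edgeIx_cases {m k : ℕ} {P : EdgeIx m k → Prop} (h1 : ∀ l, P (true, l))
    (h2 : P (false, ⟨[], by simp⟩))
    (h3 : ∀ l j (h : (l ++ [j]).length ≤ k), P (false, ⟨l ++ [j], h⟩)) (e : EdgeIx m k) :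
    P e := by
  obtain ⟨z, l, hl⟩ := e
  cases z with
  | true => exact h1 _
  | false =>
    induction l using List.reverseRecOn with
    | nil => exact h2
    | append_singleton l j _ => exact h3 l j hl

lemma edgeToBall_injective {m k : ℕ} (i : Fin (m + 1)) :
    Function.Injective (edgeToBall i : EdgeIx m k → BallIx m k) := by
  intro e
  refine edgeIx_cases (P := fun e => ∀ e', edgeToBall i e = edgeToBall i e' → e = e') ?_ ?_ ?_ e
  · intro l e'
    refine edgeIx_cases (P := fun e' => edgeToBall i (true, l) = edgeToBall i e' → _ = e')
      ?_ ?_ ?_ e'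
    · intro l' h
      simpa [edgeToBall_true] using h
    · simp [edgeToBall_true, edgeToBall_nil]
    · intro l' j h
      rw [edgeToBall_true, edgeToBall_append]
      intro h'
      exact absurd (congrArg Prod.fst (Option.some.inj h')).symm (Fin.succAbove_ne _ _)
  · intro e'
    refine edgeIx_cases (P := fun e' => edgeToBall i (false, _) = edgeToBall i e' → _ = e')
      ?_ ?_ ?_ e'
    · simp [edgeToBall_true, edgeToBall_nil]
    · simp
    · intro l' j h
      simp [edgeToBall_append, edgeToBall_nil]
  · intro l j hl e'
    refine edgeIx_cases (P := fun e' => edgeToBall i (false, _) = edgeToBall i e' → _ = e')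
      ?_ ?_ ?_ e'
    · intro l'
      rw [edgeToBall_true, edgeToBall_append]
      intro h'
      exact absurd (congrArg Prod.fst (Option.some.inj h')) (Fin.succAbove_ne _ _)
    · simp [edgeToBall_append, edgeToBall_nil]
    · intro l' j' h
      rw [edgeToBall_append, edgeToBall_append]
      intro h'
      have := Option.some.inj h'
      rw [Prod.mk.injEq, Fin.succAbove_right_inj, Subtype.mk.injEq] at this
      obtain ⟨rfl, rfl⟩ := this
      rfl

/-- The pattern seen around the edge with number `i` from the pattern seen around a vertex. -/
def edgeView {M : Type*} {m k : ℕ} (c : (BallIx m k → M) × (Fin (m + 1) × Wd m k → Fin (m + 1)))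
    (i : Fin (m + 1)) : (EdgeIx m k → M) × (EdgeIx m k → Fin (m + 1)) :=
  (fun e => c.1 (edgeToBall i e), fun e => (edgeToBall i e).elim i c.2)

/-- Reversal of the edge patterns. -/
def edgeRev {M : Type*} {m k : ℕ} (y : (EdgeIx m k → M) × (EdgeIx m k → Fin (m + 1))) :
    (EdgeIx m k → M) × (EdgeIx m k → Fin (m + 1)) :=
  (fun e => y.1 (!e.1, e.2), fun e => y.2 (!e.1, e.2))

lemma edgeRev_involutive {M : Type*} {m k : ℕ} :
    Function.Involutive (edgeRev : (EdgeIx m k → M) × (EdgeIx m k → Fin (m + 1)) → _) := by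
  intro y
  simp [edgeRev]

lemma edgeView_localView {V M : Type*} {m k : ℕ} (π : V × Fin (m + 1) → V × Fin (m + 1))
    (f : V → M) (h : V × Fin (m + 1)) :
    edgeView (localView k π f h.1) h.2 =
      (fun e => f (walk π (if e.1 then π h else h) e.2.1).1,
        fun e => (walk π (if e.1 then π h else h) e.2.1).2) := by
  refine Prod.ext (funext fun e => ?_) (funext fun e => ?_)
  · refine edgeIx_cases (P := fun e => (edgeView (localView k π f h.1) h.2).1 e =
      f (walk π (if e.1 then π h else h) e.2.1).1) ?_ ?_ ?_ e
    · intro l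
      simp [edgeView, edgeToBall_true, localView]
    · simp [edgeView, edgeToBall_nil, localView, walk]
    · intro l j hl
      simp [edgeView, edgeToBall_append, localView, walk_append_singleton]
  · refine edgeIx_cases (P := fun e => (edgeView (localView k π f h.1) h.2).2 e =
      (walk π (if e.1 then π h else h) e.2.1).2) ?_ ?_ ?_ e
    · intro l
      simp [edgeView, edgeToBall_true, localView]
    · simp [edgeView, edgeToBall_nil, walk]
    · intro l j hl
      simp [edgeView, edgeToBall_append, localView, walk_append_singleton]

lemma edgeView_localView_rev {V M : Type*} {m k : ℕ} {π : V × Fin (m + 1) → V × Fin (m + 1)}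
    (hπ : ∀ h, π (π h) = h) (f : V → M) (h : V × Fin (m + 1)) :
    edgeView (localView k π f (π h).1) (π h).2 = edgeRev (edgeView (localView k π f h.1) h.2) := by
  rw [edgeView_localView, edgeView_localView, hπ]
  refine Prod.ext (funext fun e => ?_) (funext fun e => ?_) <;>
  · rcases e with ⟨_ | _, l⟩ <;> simp [edgeRev]

lemma ent_mul_card_inv {A B : Type*} [Fintype A] [Fintype B] [Nonempty B] (p : A → ℝ)
    (hp : ∑ a, p a = 1) :
    ent (fun x : A × B => p x.1 * ((Fintype.card B : ℝ))⁻¹) =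
      ent p + Real.log (Fintype.card B) := by
  have hB : (Fintype.card B : ℝ) ≠ 0 := by exact_mod_cast Fintype.card_ne_zero
  unfold ent
  rw [Fintype.sum_prod_type]
  simp only [Real.negMulLog_mul, Finset.sum_const, Finset.card_univ, nsmul_eq_mul]
  rw [← Finset.mul_sum, Finset.sum_add_distrib, ← Finset.mul_sum, ← Finset.sum_mul, hp, one_mul,
    mul_add, ← mul_assoc, mul_inv_cancel₀ hB, one_mul, Real.negMulLog, Real.log_inv]
  field_simp

lemma card_elim_comp_eq {X Y D : Type*} [Fintype X] [Fintype Y] [Fintype D] (κ : Y → Option X)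
    (hκ : Function.Injective κ) (y₀ : Y) (h0 : κ y₀ = none) (i : D) (t : Y → D) :
    (Finset.univ.filter fun b : X → D => ∀ y, (κ y).elim i b = t y).card *
      Fintype.card D ^ Fintype.card Y =
      if t y₀ = i then Fintype.card D ^ (Fintype.card X + 1) else 0 := by
  split_ifs with hi
  · let S : X → Finset D := fun x =>
      if h : ∃ y, κ y = some x then {t h.choose} else Finset.univ
    have hS : (Finset.univ.filter fun b : X → D => ∀ y, (κ y).elim i b = t y) =
        Fintype.piFinset S := by
      ext b
      simp only [Finset.mem_filter, Finset.mem_univ, true_and, Fintype.mem_piFinset]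
      constructor
      · intro h x
        by_cases hx : ∃ y, κ y = some x
        · have := h hx.choose
          rw [hx.choose_spec] at this
          simp only [S, dif_pos hx, Finset.mem_singleton]
          exact this
        · simp [S, dif_neg hx]
      · intro h y
        rcases hy : κ y with _ | x
        · have : y = y₀ := hκ (hy.trans h0.symm)
          rw [this, hi]
          rfl
        · have hx : ∃ y, κ y = some x := ⟨y, hy⟩
          have h' := h x
          simp only [S, dif_pos hx, Finset.mem_singleton] at h'
          rw [show y = hx.choose from hκ (hy.trans hx.choose_spec.symm), ← h']
          rfl
    rw [hS, Fintype.card_piFinset]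
    have h1 : ∀ x, (S x).card = if ∃ y, κ y = some x then 1 else Fintype.card D := by
      intro x
      simp only [S]
      split_ifs <;> simp
    simp_rw [h1]
    rw [Finset.prod_ite, Finset.prod_const_one, one_mul, Finset.prod_const, ← pow_add]
    congr 1
    have h2 : (Finset.univ.filter fun x => ∃ y, κ y = some x).card + 1 = Fintype.card Y := by
      have h3 : Finset.univ.image κ = insert none
          ((Finset.univ.filter fun x => ∃ y, κ y = some x).map Function.Embedding.some) := by
        ext z
        rcases z with _ | x
        · simpa using ⟨y₀, h0⟩
        · simp
      rw [← Finset.card_univ, ← Finset.card_image_of_injective _ hκ, h3,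
        Finset.card_insert_of_notMem (by simp), Finset.card_map]
    have h4 := Finset.card_filter_add_card_filter_not (s := (Finset.univ : Finset X))
      (fun x => ∃ y, κ y = some x)
    rw [Finset.card_univ] at h4
    omega
  · rw [Finset.filter_false_of_mem]
    · simp
    · intro b _ h
      have := h y₀
      rw [h0] at this
      exact hi this.symm

lemma sum_prod_ite_and {A B : Type*} [Fintype A] [Fintype B] {P : A → Prop} {Q : B → Prop}
    {R : A × B → Prop} [DecidablePred P] [DecidablePred Q] [DecidablePred R]
    (hR : ∀ x, R x ↔ P x.1 ∧ Q x.2) (p : A → ℝ) (c : ℝ) :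
    ∑ x, (if R x then p x.1 * c else 0) =
      (∑ a, if P a then p a else 0) * ((Finset.univ.filter Q).card * c) := by
  rw [Fintype.sum_prod_type, Finset.sum_mul]
  refine Finset.sum_congr rfl fun a _ => ?_
  rw [← Finset.sum_boole, Finset.sum_mul, Finset.mul_sum]
  refine Finset.sum_congr rfl fun b _ => ?_
  have := hR (a, b)
  split_ifs <;> simp_all

lemma mul_eq_ite_of_card_mul_pow {t : Prop} [Decidable t] {m N D x y Dx Dy : ℕ} {P : ℝ}
    (hD : D = m + 1) (hDx : Dx = (m + 1) ^ x) (hDy : Dy = (m + 1) ^ y)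
    (h : N * D ^ y = if t then D ^ (x + 1) else 0) :
    P * ((N : ℝ) * (Dx : ℝ)⁻¹) = if t then ((m + 1 : ℕ) : ℝ) * (P * (Dy : ℝ)⁻¹) else 0 := by
  subst hD hDx hDy
  have h' := congrArg (Nat.cast : ℕ → ℝ) h
  have hm : ((m : ℝ) + 1) ≠ 0 := by positivity
  push_cast at h' ⊢
  split_ifs at h' ⊢
  · field_simp
    linear_combination P * h'
  · rw [(mul_eq_zero.1 h').resolve_right (pow_ne_zero _ hm)]
    simp

lemma sum_edgeView_eq {M : Type*} [Fintype M] {m k : ℕ} (pS : (BallIx m k → M) → ℝ)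
    (pE : (EdgeIx m k → M) → ℝ)
    (hp : ∀ i y, ∑ a, (if (fun e => a (edgeToBall i e)) = y then pS a else 0) = pE y)
    (y : (EdgeIx m k → M) × (EdgeIx m k → Fin (m + 1))) :
    ((m + 1 : ℕ) : ℝ) * (pE y.1 * ((Fintype.card (EdgeIx m k → Fin (m + 1)) : ℝ))⁻¹) =
      ∑ i, ∑ a : (BallIx m k → M) × (Fin (m + 1) × Wd m k → Fin (m + 1)),
        if edgeView a i = y then
          pS a.1 * ((Fintype.card (Fin (m + 1) × Wd m k → Fin (m + 1)) : ℝ))⁻¹ else 0 := by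
  have h1 : ∀ i, ∑ a : (BallIx m k → M) × (Fin (m + 1) × Wd m k → Fin (m + 1)),
      (if edgeView a i = y then
        pS a.1 * ((Fintype.card (Fin (m + 1) × Wd m k → Fin (m + 1)) : ℝ))⁻¹ else 0) =
      if y.2 (false, ⟨[], by simp⟩) = i then
        ((m + 1 : ℕ) : ℝ) * (pE y.1 * ((Fintype.card (EdgeIx m k → Fin (m + 1)) : ℝ))⁻¹) else 0 := by
    intro i
    have h2 := card_elim_comp_eq (D := Fin (m + 1)) (edgeToBall i) (edgeToBall_injective i)
      (false, ⟨[], by simp⟩) (edgeToBall_nil (k := k) i) i y.2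
    have h3 : ∀ a : (BallIx m k → M) × (Fin (m + 1) × Wd m k → Fin (m + 1)), edgeView a i = y ↔
        (fun e => a.1 (edgeToBall i e)) = y.1 ∧ ∀ e, (edgeToBall i e).elim i a.2 = y.2 e := by
      intro a
      rw [Prod.ext_iff, ← funext_iff]
      rfl
    rw [sum_prod_ite_and (P := fun a => (fun e => a (edgeToBall i e)) = y.1)
      (Q := fun b => ∀ e, (edgeToBall i e).elim i b = y.2 e) h3, hp]
    refine mul_eq_ite_of_card_mul_pow (D := Fintype.card (Fin (m + 1)))
      (x := Fintype.card (Fin (m + 1) × Wd m k)) (y := Fintype.card (EdgeIx m k))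
      (Fintype.card_fin _) (by rw [Fintype.card_fun, Fintype.card_fin])
      (by rw [Fintype.card_fun, Fintype.card_fin]) ?_
    convert h2
  simp only [h1]
  simp

lemma ent_ball_sub_ent_edge {M : Type*} [Fintype M] {m k : ℕ} (pS : (BallIx m k → M) → ℝ)
    (pE : (EdgeIx m k → M) → ℝ) (hS : ∑ a, pS a = 1) (hE : ∑ a, pE a = 1) :
    ent (fun x : (BallIx m k → M) × (Fin (m + 1) × Wd m k → Fin (m + 1)) =>
        pS x.1 * ((Fintype.card (Fin (m + 1) × Wd m k → Fin (m + 1)) : ℝ))⁻¹) -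
      ((m + 1 : ℕ) : ℝ) / 2 * ent (fun y : (EdgeIx m k → M) × (EdgeIx m k → Fin (m + 1)) =>
        pE y.1 * ((Fintype.card (EdgeIx m k → Fin (m + 1)) : ℝ))⁻¹) =
      ent pS - ((m + 1 : ℕ) : ℝ) / 2 * ent pE := by
  rw [ent_mul_card_inv pS hS, ent_mul_card_inv pE hE]
  simp only [Fintype.card_fun, Fintype.card_prod, Fintype.card_bool, Fintype.card_fin,
    Nat.cast_pow, Real.log_pow]
  push_cast
  ring

/-- The number of numbered regular graphs admitting a coloring whose statistics of local views are
close to a prescribed distribution is at most exponential with rate the annealed entropy. -/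
lemma card_numbered_graphs_le {M : Type*} [Fintype M] {m k : ℕ} (pS : (BallIx m k → M) → ℝ)
    (pE : (EdgeIx m k → M) → ℝ) (hS : ∑ a, pS a = 1) (hE : ∑ a, pE a = 1)
    (hp : ∀ i y, ∑ a, (if (fun e => a (edgeToBall i e)) = y then pS a else 0) = pE y)
    {η : ℝ} (hη : 0 < η) :
    ∃ δ > 0, ∃ A B : ℕ, ∀ n : ℕ,
      ((Finset.univ.filter fun x : regularGraphs (m + 1) n × (Fin n → Equiv.Perm (Fin (m + 1))) =>
        ∃ f : Fin n → M, ∀ a, |emp (localView k (portMatching (portOf x.1 x.2)) f) a -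
          pS a.1 * ((Fintype.card (Fin (m + 1) × Wd m k → Fin (m + 1)) : ℝ))⁻¹| ≤ δ).card : ℝ) ≤
      (matchings (Fin n × Fin (m + 1))).card * ((((n : ℝ) + 1) ^ A *
        (Real.exp 1 * (n * (m + 1 : ℕ) + 1)) ^ B) *
        Real.exp (n * (ent pS - ((m + 1 : ℕ) : ℝ) / 2 * ent pE + η))) := by
  obtain ⟨δ, hδ, h⟩ := card_colored_matchings_le (d := m + 1) (Nat.succ_pos m) edgeView
    edgeRev_involutive
    (fun x : (BallIx m k → M) × (Fin (m + 1) × Wd m k → Fin (m + 1)) =>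
      pS x.1 * ((Fintype.card (Fin (m + 1) × Wd m k → Fin (m + 1)) : ℝ))⁻¹)
    (fun y : (EdgeIx m k → M) × (EdgeIx m k → Fin (m + 1)) =>
      pE y.1 * ((Fintype.card (EdgeIx m k → Fin (m + 1)) : ℝ))⁻¹)
    (fun y => (sum_edgeView_eq pS pE hp y).trans (by congr!)) hη
  refine ⟨δ, hδ, Fintype.card ((BallIx m k → M) × (Fin (m + 1) × Wd m k → Fin (m + 1))),
    Fintype.card ((EdgeIx m k → M) × (EdgeIx m k → Fin (m + 1))), fun n => le_trans ?_ ((h n).trans (le_of_eq ?_))⟩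
  · rw [Nat.cast_le]
    have hM : Nonempty M := by
      by_contra hM
      rw [not_nonempty_iff] at hM
      simp at hS
    choose! F hF using fun (x : regularGraphs (m + 1) n × (Fin n → Equiv.Perm (Fin (m + 1))))
      (hx : ∃ f : Fin n → M, ∀ a, |emp (localView k (portMatching (portOf x.1 x.2)) f) a -
          pS a.1 * ((Fintype.card (Fin (m + 1) × Wd m k → Fin (m + 1)) : ℝ))⁻¹| ≤ δ) => hx
    refine Finset.card_le_card_of_injOn (fun x => (portMatching (portOf x.1 x.2),
      localView k (portMatching (portOf x.1 x.2)) (F x))) ?_ ?_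
    · intro x hx
      have hx' := hF x (Finset.mem_filter.1 hx).2
      rw [Finset.mem_coe]
      exact (@Finset.mem_filter _ _ (_) _ _).2 ⟨@Finset.mem_univ _ (_) _, portMatching_mem_matchings _,
        edgeView_localView_rev (portMatching_portMatching _) _, hx'⟩
    · intro x _ y _ hxy
      exact portMatching_portOf_injective _ _ (congrArg Prod.fst hxy)
  · rw [← ent_ball_sub_ent_edge pS pE hS hE]

/-! ### Concentration under random numberings -/

lemma sum_mul_of_disjoint_dependence {V P : Type*} [Fintype V] [Fintype P] {A : Finset V}
    {f g : (V → P) → ℝ} (hf : ∀ s t, (∀ u ∈ A, s u = t u) → f s = f t)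
    (hg : ∀ s t, (∀ u ∉ A, s u = t u) → g s = g t) :
    (Fintype.card (V → P) : ℝ) * ∑ s, f s * g s = (∑ s, f s) * ∑ s, g s := by
  let φ : (V → P) × (V → P) → (V → P) × (V → P) := fun x =>
    (fun u => if u ∈ A then x.1 u else x.2 u, fun u => if u ∈ A then x.2 u else x.1 u)
  have hφ : Function.Involutive φ := by
    intro x
    refine Prod.ext (funext fun u => ?_) (funext fun u => ?_) <;> by_cases h : u ∈ A <;> simp [φ, h]
  have h1 : (Fintype.card (V → P) : ℝ) * ∑ s, f s * g s =
      ∑ x : (V → P) × (V → P), f x.1 * g x.1 := by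
    rw [Fintype.sum_prod_type]
    simp only [Finset.sum_const, Finset.card_univ, nsmul_eq_mul]
    rw [Finset.mul_sum]
  rw [h1, ← Equiv.sum_comp (hφ.toPerm φ), Finset.sum_mul_sum, Fintype.sum_prod_type]
  refine Finset.sum_congr rfl fun s _ => Finset.sum_congr rfl fun t _ => ?_
  congr 1
  · exact hf _ _ fun u hu => by simp [φ, hu]
  · exact hg _ _ fun u hu => by simp [φ, hu]

lemma sum_sq_sub_mean_le {V P : Type*} [Fintype V] [Fintype P] [Nonempty P] {g : V → (V → P) → ℝ}
    (h0 : ∀ v s, 0 ≤ g v s) (h1 : ∀ v s, g v s ≤ 1) {B : V → Finset V}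
    (hB : ∀ v s t, (∀ u ∈ B v, s u = t u) → g v s = g v t) {D : ℕ}
    (hD : ∀ v, (Finset.univ.filter fun w => ¬ Disjoint (B v) (B w)).card ≤ D) :
    ∑ s, ((∑ v, g v s) - (∑ t, ∑ v, g v t) / Fintype.card (V → P)) ^ 2 ≤
      Fintype.card V * D * Fintype.card (V → P) := by
  set S : ℝ := Nat.cast (Fintype.card (V → P)) with hS
  have hS0 : 0 < S := by
    rw [hS]; exact_mod_cast Fintype.card_pos
  set E : ℝ := ∑ t, ∑ v, g v t with hE
  have e1 : ∑ s, ((∑ v, g v s) - E / S) ^ 2 = (∑ s, (∑ v, g v s) ^ 2) - E ^ 2 / S := by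
    have : ∀ s, ((∑ v, g v s) - E / S) ^ 2 =
        (∑ v, g v s) ^ 2 - (2 * (E / S)) * (∑ v, g v s) + (E / S) ^ 2 := fun s => by ring
    simp only [this]
    rw [Finset.sum_add_distrib, Finset.sum_sub_distrib, ← Finset.mul_sum, ← hE, Finset.sum_const,
      Finset.card_univ, nsmul_eq_mul, ← hS]
    field_simp
    ring
  have e2 : ∑ s, (∑ v, g v s) ^ 2 = ∑ v, ∑ w, ∑ s, g v s * g w s := by
    simp only [sq, Finset.sum_mul_sum]
    rw [Finset.sum_comm]
    exact Finset.sum_congr rfl fun v _ => Finset.sum_comm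
  have e3 : E ^ 2 / S = ∑ v, ∑ w, (∑ s, g v s) * (∑ s, g w s) / S := by
    rw [hE, Finset.sum_comm, sq, Finset.sum_mul_sum, Finset.sum_div]
    simp only [Finset.sum_div]
  rw [e1, e2, e3, ← Finset.sum_sub_distrib]
  simp only [← Finset.sum_sub_distrib]
  have e4 : ∀ v w, (∑ s, g v s * g w s) - (∑ s, g v s) * (∑ s, g w s) / S ≤
      if ¬ Disjoint (B v) (B w) then S else 0 := by
    intro v w
    split_ifs with hd
    · have := sum_mul_of_disjoint_dependence (hB v) (g := g w)
        (fun s t h => hB w s t fun u hu => h u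
          (Finset.disjoint_right.1 hd hu))
      rw [← this, mul_div_cancel_left₀ _ hS0.ne', sub_self]
    · have a1 : ∑ s, g v s * g w s ≤ S := by
        calc _ ≤ ∑ _s : V → P, (1 : ℝ) := Finset.sum_le_sum fun s _ =>
              mul_le_one₀ (h1 v s) (h0 w s) (h1 w s)
          _ = S := by simp [hS]
      have a2 : 0 ≤ (∑ s, g v s) * (∑ s, g w s) / S :=
        div_nonneg (mul_nonneg (Finset.sum_nonneg fun s _ => h0 v s)
          (Finset.sum_nonneg fun s _ => h0 w s)) hS0.le
      linarith
  refine (Finset.sum_le_sum fun v _ => Finset.sum_le_sum fun w _ => e4 v w).trans ?_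
  have e5 : ∀ v, ∑ w, (if ¬ Disjoint (B v) (B w) then S else 0) ≤ D * S := by
    intro v
    rw [← Finset.sum_filter, Finset.sum_const, nsmul_eq_mul]
    exact mul_le_mul_of_nonneg_right (by exact_mod_cast hD v) hS0.le
  refine (Finset.sum_le_sum fun v _ => e5 v).trans (le_of_eq ?_)
  rw [Finset.sum_const, Finset.card_univ, nsmul_eq_mul]
  ring

lemma card_far_from_mean_le {V P : Type*} [Fintype V] [Fintype P] [Nonempty P]
    {g : V → (V → P) → ℝ}
    (h0 : ∀ v s, 0 ≤ g v s) (h1 : ∀ v s, g v s ≤ 1) {B : V → Finset V}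
    (hB : ∀ v s t, (∀ u ∈ B v, s u = t u) → g v s = g v t) {D : ℕ}
    (hD : ∀ v, (Finset.univ.filter fun w => ¬ Disjoint (B v) (B w)).card ≤ D) {δ : ℝ} (hδ : 0 < δ) :
    ((Finset.univ.filter fun s => δ <
      |(∑ v, g v s) - (∑ t, ∑ v, g v t) / Fintype.card (V → P)|).card : ℝ) * δ ^ 2 ≤
      Fintype.card V * D * Fintype.card (V → P) := by
  refine le_trans ?_ (sum_sq_sub_mean_le h0 h1 hB hD)
  rw [← nsmul_eq_mul]
  refine (Finset.card_nsmul_le_sum _ (fun s => ((∑ v, g v s) -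
    (∑ t, ∑ v, g v t) / Fintype.card (V → P)) ^ 2) _ fun s hs => ?_).trans
    (Finset.sum_le_sum_of_subset_of_nonneg (Finset.subset_univ _) fun _ _ _ => sq_nonneg _)
  have := (Finset.mem_filter.1 hs).2
  rw [← sq_abs (_ - _)]
  exact pow_le_pow_left₀ hδ.le this.le 2

/-- The ball of radius `r` around a vertex, as a finite set. -/
def vball {V : Type*} [Fintype V] (G : SimpleGraph V) (r : ℕ) (v : V) : Finset V :=
  Finset.univ.filter fun u => ∃ p : G.Walk v u, p.length ≤ r

lemma mem_vball {V : Type*} [Fintype V] {G : SimpleGraph V} {r : ℕ} {v u : V} :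
    u ∈ vball G r v ↔ ∃ p : G.Walk v u, p.length ≤ r := by simp [vball]

lemma mem_vball_comm {V : Type*} [Fintype V] {G : SimpleGraph V} {r : ℕ} {v u : V} :
    u ∈ vball G r v ↔ v ∈ vball G r u := by
  rw [mem_vball, mem_vball]
  exact ⟨fun ⟨p, hp⟩ => ⟨p.reverse, by simpa using hp⟩, fun ⟨p, hp⟩ => ⟨p.reverse, by simpa using hp⟩⟩

lemma vball_mono {V : Type*} [Fintype V] {G : SimpleGraph V} {r r' : ℕ} (h : r ≤ r') (v : V) :
    vball G r v ⊆ vball G r' v := by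
  intro u hu
  obtain ⟨p, hp⟩ := mem_vball.1 hu
  exact mem_vball.2 ⟨p, hp.trans h⟩

lemma mem_vball_succ {V : Type*} [Fintype V] {G : SimpleGraph V} {r : ℕ} {v u w : V}
    (hu : u ∈ vball G r v) (h : G.Adj u w) : w ∈ vball G (r + 1) v := by
  obtain ⟨p, hp⟩ := mem_vball.1 hu
  exact mem_vball.2 ⟨p.concat h, by simpa using hp⟩

lemma card_vball_le {d n : ℕ} (G : regularGraphs d n) (r : ℕ) (v : Fin n) :
    (vball G.1 r v).card ≤ (d + 1) ^ r := by
  induction r generalizing v with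
  | zero =>
    rw [pow_zero, Finset.card_le_one]
    intro a ha b hb
    obtain ⟨p, hp⟩ := mem_vball.1 ha
    obtain ⟨q, hq⟩ := mem_vball.1 hb
    rw [← SimpleGraph.Walk.eq_of_length_eq_zero (Nat.le_zero.1 hp),
      ← SimpleGraph.Walk.eq_of_length_eq_zero (Nat.le_zero.1 hq)]
  | succ r ih =>
    have h1 : vball G.1 (r + 1) v ⊆ insert v
        ((Finset.univ.image fun i => (stdPort G v i : Fin n)).biUnion fun w => vball G.1 r w) := by
      intro u hu
      obtain ⟨p, hp⟩ := mem_vball.1 hu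
      cases p with
      | nil => exact Finset.mem_insert_self _ _
      | @cons _ w _ h q =>
        refine Finset.mem_insert_of_mem (Finset.mem_biUnion.2 ⟨w, ?_, mem_vball.2 ⟨q, ?_⟩⟩)
        · exact Finset.mem_image.2 ⟨(stdPort G v).symm ⟨w, h⟩, Finset.mem_univ _, by simp⟩
        · simpa using hp
    refine (Finset.card_le_card h1).trans ((Finset.card_insert_le _ _).trans ?_)
    have h2 := Finset.card_biUnion_le_card_mul
      (Finset.univ.image fun i => (stdPort G v i : Fin n)) (fun w => vball G.1 r w) _
      fun w _ => ih w
    have h3 : (Finset.univ.image fun i => (stdPort G v i : Fin n)).card ≤ d :=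
      Finset.card_image_le.trans (by simp)
    have h4 := Nat.mul_le_mul_right ((d + 1) ^ r) h3
    have h5 : 1 ≤ (d + 1) ^ r := Nat.one_le_pow _ _ (Nat.succ_pos d)
    rw [pow_succ]
    nlinarith

lemma card_not_disjoint_vball_le {d n : ℕ} (G : regularGraphs d n) (r : ℕ) (v : Fin n) :
    (Finset.univ.filter fun w => ¬ Disjoint (vball G.1 r v) (vball G.1 r w)).card ≤
      (d + 1) ^ r * (d + 1) ^ r := by
  have h1 : (Finset.univ.filter fun w => ¬ Disjoint (vball G.1 r v) (vball G.1 r w)) ⊆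
      (vball G.1 r v).biUnion fun u => vball G.1 r u := by
    intro w hw
    obtain ⟨u, h2, h3⟩ := Finset.not_disjoint_iff.1 (Finset.mem_filter.1 hw).2
    exact Finset.mem_biUnion.2 ⟨u, h2, mem_vball_comm.1 h3⟩
  exact (Finset.card_le_card h1).trans ((Finset.card_biUnion_le_card_mul _ _ _
    fun u _ => card_vball_le G r u).trans (Nat.mul_le_mul_right _ (card_vball_le G r v)))

lemma portMatching_portOf_congr {d n : ℕ} (G : regularGraphs d n)
    {s t : Fin n → Equiv.Perm (Fin d)} {h : Fin n × Fin d} (h1 : s h.1 = t h.1)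
    (h2 : ∀ w, G.1.Adj h.1 w → s w = t w) :
    portMatching (portOf G s) h = portMatching (portOf G t) h := by
  have e1 : portOf G s h.1 = portOf G t h.1 := by simp only [portOf, h1]
  have hs := congrArg Prod.fst (portMatching_portMatching (portOf G s) h)
  have ht := congrArg Prod.fst (portMatching_portMatching (portOf G t) h)
  have hx : (portMatching (portOf G s) h).1 = (portMatching (portOf G t) h).1 := by
    rw [portMatching_apply_fst, portMatching_apply_fst, e1]
  have e2 : s (portMatching (portOf G t) h).1 = t (portMatching (portOf G t) h).1 :=
    h2 _ ((portOf G t h.1) h.2).2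
  rw [portMatching_apply_fst] at hs ht
  generalize portMatching (portOf G s) h = x at *
  generalize portMatching (portOf G t) h = y at *
  obtain ⟨x1, x2⟩ := x
  obtain ⟨y1, y2⟩ := y
  dsimp only at hx
  subst hx
  have e3 : portOf G s x1 = portOf G t x1 := by
    simp only [portOf]
    rw [e2]
  rw [Prod.mk.injEq]
  refine ⟨rfl, (portOf G t x1).injective (Subtype.ext ?_)⟩
  rw [ht, ← hs, e3]

lemma walk_portOf_congr {m n r : ℕ} (G : regularGraphs (m + 1) n)
    {s t : Fin n → Equiv.Perm (Fin (m + 1))} {v : Fin n}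
    (hst : ∀ u ∈ vball G.1 r v, s u = t u) (i : Fin (m + 1)) (l : List (Fin m))
    (hl : l.length + 1 ≤ r) :
    walk (portMatching (portOf G s)) (portMatching (portOf G s) (v, i)) l =
      walk (portMatching (portOf G t)) (portMatching (portOf G t) (v, i)) l ∧
    (walk (portMatching (portOf G s)) (portMatching (portOf G s) (v, i)) l).1 ∈
      vball G.1 (l.length + 1) v := by
  have key : ∀ j, ∀ h : Fin n × Fin (m + 1), j + 1 ≤ r → h.1 ∈ vball G.1 j v →
      portMatching (portOf G s) h = portMatching (portOf G t) h ∧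
      (portMatching (portOf G s) h).1 ∈ vball G.1 (j + 1) v := by
    intro j h hj hh
    refine ⟨portMatching_portOf_congr G (hst _ (vball_mono (by omega) v hh)) fun w hw =>
      hst _ (vball_mono hj v (mem_vball_succ hh hw)), mem_vball_succ hh ?_⟩
    exact ((portOf G s h.1) h.2).2
  induction l with
  | nil => exact key 0 (v, i) hl (mem_vball.2 ⟨SimpleGraph.Walk.nil, le_rfl⟩)
  | cons a l ih =>
    simp only [List.length_cons] at hl
    obtain ⟨ih1, ih2⟩ := ih (by omega)
    simp only [walk, List.length_cons]
    rw [← ih1]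
    exact key _ _ hl ih2

lemma localView_portOf_congr {M : Type*} {m n k : ℕ} (G : regularGraphs (m + 1) n)
    {s t : Fin n → Equiv.Perm (Fin (m + 1))} {v : Fin n} (f : Fin n → M)
    (hst : ∀ u ∈ vball G.1 (k + 1) v, s u = t u) :
    localView k (portMatching (portOf G s)) f v = localView k (portMatching (portOf G t)) f v := by
  have h : ∀ p : Fin (m + 1) × Wd m k, _ := fun p =>
    (walk_portOf_congr G hst p.1 p.2.1 (by have := p.2.2; omega)).1
  unfold localView
  refine Prod.ext (funext fun x => ?_) (funext fun p => ?_)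
  · rcases x with _ | p
    · rfl
    · simp only [Option.elim, h p]
  · simp only [h p]

/-- The mean over all numberings of the empirical distribution of local views. -/
def meanView {M : Type*} {m n : ℕ} (k : ℕ) (G : regularGraphs (m + 1) n) (f : Fin n → M)
    (c : (BallIx m k → M) × (Fin (m + 1) × Wd m k → Fin (m + 1))) : ℝ :=
  (∑ s : Fin n → Equiv.Perm (Fin (m + 1)), emp (localView k (portMatching (portOf G s)) f) c) /
    Fintype.card (Fin n → Equiv.Perm (Fin (m + 1)))

lemma exists_half_close_to_mean (M : Type*) [Fintype M] (m k : ℕ) {δ : ℝ} (hδ : 0 < δ) :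
    ∃ n₀, ∀ n ≥ n₀, ∀ (G : regularGraphs (m + 1) n) (f : Fin n → M),
      Fintype.card (Fin n → Equiv.Perm (Fin (m + 1))) ≤
      2 * (Finset.univ.filter fun s : Fin n → Equiv.Perm (Fin (m + 1)) =>
        ∀ c, |emp (localView k (portMatching (portOf G s)) f) c - meanView k G f c| ≤ δ).card := by
  set D : ℕ := (m + 1 + 1) ^ (k + 1) * (m + 1 + 1) ^ (k + 1)
  set C := Fintype.card ((BallIx m k → M) × (Fin (m + 1) × Wd m k → Fin (m + 1)))
  obtain ⟨n₀, hn₀⟩ := exists_nat_gt (2 * C * D / δ ^ 2)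
  refine ⟨n₀ + 1, fun n hn G f => ?_⟩
  have hn0 : (0 : ℝ) < n := by
    have : 0 < n := by omega
    exact_mod_cast this
  set S := Fintype.card (Fin n → Equiv.Perm (Fin (m + 1)))
  have h1 : ∀ c, ((Finset.univ.filter fun s : Fin n → Equiv.Perm (Fin (m + 1)) =>
      δ < |emp (localView k (portMatching (portOf G s)) f) c - meanView k G f c|).card : ℝ) *
        (n * δ) ^ 2 ≤ n * D * S := by
    intro c
    have := card_far_from_mean_le (V := Fin n) (P := Equiv.Perm (Fin (m + 1)))
      (g := fun v s => if localView k (portMatching (portOf G s)) f v = c then 1 else 0)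
      (fun v s => by split_ifs <;> simp) (fun v s => by split_ifs <;> simp)
      (B := vball G.1 (k + 1)) (fun v s t hst => by rw [localView_portOf_congr G f hst])
      (D := D) (fun v => by convert card_not_disjoint_vball_le G (k + 1) v) (δ := n * δ)
      (by positivity)
    rw [Fintype.card_fin] at this
    refine le_trans (le_of_eq ?_) (this.trans (le_of_eq ?_))
    swap
    · congr 2
      convert rfl
    congr 3
    ext s
    rw [Finset.mem_filter, Finset.mem_filter]
    simp only [Finset.mem_univ, true_and]
    have e : ∀ s, (∑ v, if localView k (portMatching (portOf G s)) f v = c then (1 : ℝ) else 0) =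
        n * emp (localView k (portMatching (portOf G s)) f) c := by
      intro s
      unfold emp
      rw [Finset.sum_boole, Fintype.card_fin, mul_div_cancel₀ _ hn0.ne']
      congr!
    simp only [e]
    rw [← Finset.mul_sum, mul_div_assoc, ← mul_sub, abs_mul, Nat.abs_cast,
      mul_lt_mul_iff_right₀ hn0]
    unfold meanView
    rw [iff_iff_eq]
    congr! 4
    · congr!
    · congr!
  set good := Finset.univ.filter fun s : Fin n → Equiv.Perm (Fin (m + 1)) =>
        ∀ c, |emp (localView k (portMatching (portOf G s)) f) c - meanView k G f c| ≤ δ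
  have h2 : S ≤ good.card + ∑ c, (Finset.univ.filter fun s : Fin n → Equiv.Perm (Fin (m + 1)) =>
      δ < |emp (localView k (portMatching (portOf G s)) f) c - meanView k G f c|).card := by
    refine le_trans ?_ ((Finset.card_union_le good (Finset.univ.biUnion fun c =>
      Finset.univ.filter fun s : Fin n → Equiv.Perm (Fin (m + 1)) =>
      δ < |emp (localView k (portMatching (portOf G s)) f) c - meanView k G f c|)).trans
      (Nat.add_le_add_left Finset.card_biUnion_le _))
    refine le_of_eq (Finset.card_univ.symm.trans (congrArg _ (Eq.symm ?_)))
    refine Finset.eq_univ_of_forall fun s => ?_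
    by_cases h : s ∈ good
    · exact Finset.mem_union_left _ h
    · rw [Finset.mem_filter] at h
      push Not at h
      obtain ⟨c, hc⟩ := h (Finset.mem_univ _)
      exact Finset.mem_union_right _ (Finset.mem_biUnion.2 ⟨c, Finset.mem_univ _,
        Finset.mem_filter.2 ⟨Finset.mem_univ _, hc⟩⟩)
  have h3 : (∑ c, ((Finset.univ.filter fun s : Fin n → Equiv.Perm (Fin (m + 1)) =>
      δ < |emp (localView k (portMatching (portOf G s)) f) c - meanView k G f c|).card : ℝ)) *
        (n * δ) ^ 2 ≤ C * (n * D * S) := by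
    rw [Finset.sum_mul, ← nsmul_eq_mul C]
    refine (Finset.sum_le_card_nsmul _ _ _ fun c _ => h1 c).trans (le_of_eq ?_)
    rw [Finset.card_univ]
  have h4 : (S : ℝ) ≤ good.card + ∑ c, ((Finset.univ.filter fun s =>
      δ < |emp (localView k (portMatching (portOf G s)) f) c - meanView k G f c|).card : ℝ) := by
    exact_mod_cast h2
  set X := ∑ c, ((Finset.univ.filter fun s : Fin n → Equiv.Perm (Fin (m + 1)) =>
      δ < |emp (localView k (portMatching (portOf G s)) f) c - meanView k G f c|).card : ℝ)
  have h5 : 2 * C * D < n * δ ^ 2 := by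
    rw [div_lt_iff₀ (by positivity)] at hn₀
    refine hn₀.trans_le (mul_le_mul_of_nonneg_right ?_ (by positivity))
    exact_mod_cast (by omega : n₀ ≤ n)
  have h6 : 2 * X ≤ S := by
    by_contra! h6
    have hX : 0 ≤ X := Finset.sum_nonneg fun c _ => Nat.cast_nonneg _
    have h7 : X * (n * δ ^ 2) ≤ C * D * S := by
      refine le_of_mul_le_mul_left ?_ hn0
      calc (n : ℝ) * (X * (n * δ ^ 2)) = X * (n * δ) ^ 2 := by ring
        _ ≤ _ := h3
        _ = _ := by ring
    have hX' : 0 < X := by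
      have : (0 : ℝ) ≤ S := Nat.cast_nonneg _
      linarith
    have h8 : X * (2 * C * D) < X * (n * δ ^ 2) := mul_lt_mul_of_pos_left h5 hX'
    have h9 : (C * D : ℝ) * S ≤ (C * D : ℝ) * (2 * X) :=
      mul_le_mul_of_nonneg_left h6.le (by positivity)
    linarith
  have h7 : (S : ℝ) ≤ 2 * good.card := by linarith
  exact_mod_cast h7

/-! ### Breadth-first search labels -/

lemma eq_of_length_filter_takeWhile_eq {α : Type*} [DecidableEq α] {P : α → Bool} {w w' : α} {L : List α}
    (hw : w ∈ L) (hw' : w' ∈ L) (hP : P w) (hP' : P w')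
    (h : ((L.takeWhile fun x => decide (x ≠ w)).filter P).length =
      ((L.takeWhile fun x => decide (x ≠ w')).filter P).length) : w = w' := by
  induction L with
  | nil => simp at hw
  | cons x L ih =>
    by_cases h1 : x = w
    · subst h1
      by_contra h2
      simp [h2, hP] at h
    · by_cases h2 : x = w'
      · subst h2
        simp [h1, hP'] at h
      · have hw1 : w ∈ L := by simpa [Ne.symm h1] using hw
        have hw2 : w' ∈ L := by simpa [Ne.symm h2] using hw'
        refine ih hw1 hw2 ?_
        simp only [ne_eq, h1, h2, not_false_eq_true, decide_true, List.takeWhile_cons_of_pos,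
          List.filter_cons] at h
        split_ifs at h <;> simpa using h

lemma mem_bfsLayer {n : ℕ} (G : SimpleGraph (Fin n)) (v : Fin n) (σ : Equiv.Perm (Fin n)) (k : ℕ)
    (w : Fin n) : w ∈ bfsLayer G v σ k ↔ G.Reachable v w ∧ G.dist v w = k := by
  cases k with
  | zero =>
    simp only [bfsLayer, List.mem_singleton]
    constructor
    · rintro rfl
      exact ⟨SimpleGraph.Reachable.refl _, SimpleGraph.dist_self⟩
    · rintro ⟨h1, h2⟩
      exact (h1.dist_eq_zero_iff.1 h2).symm
  | succ k => simp [bfsLayer]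

lemma bfsPathAux_length {n : ℕ} {G : SimpleGraph (Fin n)} {v : Fin n} {σ : Equiv.Perm (Fin n)}
    {k : ℕ} {w : Fin n} {l : List ℕ} (h : bfsPathAux G v σ k w = some l) : l.length = k := by
  induction k generalizing w l with
  | zero =>
    simp only [bfsPathAux] at h
    split_ifs at h
    simpa using h.symm
  | succ k ih =>
    simp only [bfsPathAux] at h
    split at h
    · simp at h
    · obtain ⟨l', h1, rfl⟩ := Option.map_eq_some_iff.1 h
      simp [ih h1]

lemma bfsPathAux_succ {n : ℕ} {G : SimpleGraph (Fin n)} {v : Fin n} {σ : Equiv.Perm (Fin n)}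
    {k : ℕ} {w : Fin n} {l : List ℕ} (h : bfsPathAux G v σ (k + 1) w = some l) :
    ∃ p l', (bfsLayer G v σ k).find? (fun u => decide (G.Adj u w)) = some p ∧
      bfsPathAux G v σ k p = some l' ∧
      l = (1 + (((bfsLayer G v σ (k + 1)).takeWhile (fun w' => w' ≠ w)).filter
        (fun w' => (bfsLayer G v σ k).find? (fun u => decide (G.Adj u w')) = some p)).length) ::
          l' := by
  simp only [bfsPathAux] at h
  split at h
  · simp at h
  · next p hp =>
    obtain ⟨l', h1, h2⟩ := Option.map_eq_some_iff.1 h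
    exact ⟨p, l', hp, h1, h2.symm⟩

lemma bfsPathAux_injective {n : ℕ} {G : SimpleGraph (Fin n)} {v : Fin n} {σ : Equiv.Perm (Fin n)}
    {k : ℕ} {w w' : Fin n} {l : List ℕ} (hw : w ∈ bfsLayer G v σ k) (hw' : w' ∈ bfsLayer G v σ k)
    (h : bfsPathAux G v σ k w = some l) (h' : bfsPathAux G v σ k w' = some l) : w = w' := by
  induction k generalizing w w' l with
  | zero =>
    simp only [bfsLayer, List.mem_singleton] at hw hw'
    rw [hw, hw']
  | succ k ih =>
    obtain ⟨p, l₁, hp, h1, h2⟩ := bfsPathAux_succ h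
    obtain ⟨p', l₁', hp', h1', h2'⟩ := bfsPathAux_succ h'
    obtain ⟨hj, hl⟩ := List.cons.inj (h2.symm.trans h2')
    subst hl
    obtain rfl := ih (List.mem_of_find?_eq_some hp) (List.mem_of_find?_eq_some hp') h1 h1'
    exact eq_of_length_filter_takeWhile_eq (P := fun w' => decide
        ((bfsLayer G v σ k).find? (fun u => decide (G.Adj u w')) = some p))
      hw hw' (decide_eq_true hp) (decide_eq_true hp') (Nat.add_left_cancel hj)

lemma bfsPath_eq_some {n : ℕ} {G : SimpleGraph (Fin n)} {v : Fin n} {σ : Equiv.Perm (Fin n)}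
    {w : Fin n} {l : List ℕ} :
    bfsPath G v σ w = some l ↔
      w ∈ bfsLayer G v σ l.length ∧ bfsPathAux G v σ l.length w = some l := by
  rw [mem_bfsLayer]
  unfold bfsPath
  split_ifs with hr
  · constructor
    · intro h
      have := bfsPathAux_length h
      exact ⟨⟨hr, this.symm⟩, by rw [this]; exact h⟩
    · rintro ⟨⟨-, h1⟩, h2⟩
      rw [h1]
      exact h2
  · simp [hr]

lemma bfsPath_injective {n : ℕ} {G : SimpleGraph (Fin n)} {v : Fin n} {σ : Equiv.Perm (Fin n)}
    {w w' : Fin n} {l : List ℕ} (h : bfsPath G v σ w = some l) (h' : bfsPath G v σ w' = some l) :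
    w = w' := by
  rw [bfsPath_eq_some] at h h'
  exact bfsPathAux_injective h.1 h'.1 h.2 h'.2

lemma bfsPath_eq_some_nil {n : ℕ} {G : SimpleGraph (Fin n)} {v : Fin n} {σ : Equiv.Perm (Fin n)}
    {w : Fin n} (h : bfsPath G v σ w = some []) : w = v := by
  simpa [bfsLayer] using (bfsPath_eq_some.1 h).1

lemma bfsPath_eq_some_cons {n : ℕ} {G : SimpleGraph (Fin n)} {v : Fin n} {σ : Equiv.Perm (Fin n)}
    {w : Fin n} {k : ℕ} {l : List ℕ} (h : bfsPath G v σ w = some (k :: l)) :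
    ∃ p, G.Adj p w ∧ bfsPath G v σ p = some l := by
  obtain ⟨-, h2⟩ := bfsPath_eq_some.1 h
  obtain ⟨p, l', hp, h1, h3⟩ := bfsPathAux_succ h2
  obtain ⟨-, rfl⟩ := List.cons.inj h3
  exact ⟨p, by simpa using List.find?_some hp,
    bfsPath_eq_some.2 ⟨List.mem_of_find?_eq_some hp, h1⟩⟩

/-- The breadth-first search label of an address in the ball. -/
def addr {m k : ℕ} (i : BallIx m k) : List ℕ :=
  i.elim [] fun p => p.2.1.map (fun j : Fin m => (j : ℕ) + 1) ++ [(p.1 : ℕ) + 1]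

lemma addr_injective {m k : ℕ} : Function.Injective (addr : BallIx m k → List ℕ) := by
  rintro (_ | ⟨i, l, hl⟩) (_ | ⟨i', l', hl'⟩) h
  · rfl
  · simp [addr] at h
  · simp [addr] at h
  · simp only [addr, Option.elim] at h
    obtain ⟨h1, h2⟩ := List.append_inj' h rfl
    have h3 : l = l' := List.map_injective_iff.2 (fun a b hab => by
      exact Fin.ext (Nat.add_right_cancel hab)) h1
    subst h3
    have h4 : i = i' := Fin.ext (by simpa using h2)
    rw [h4]

/-- The search labels of a ball around `v` carry the colors `a`. -/
def BallColored {M : Type*} {n m k : ℕ} (G : SimpleGraph (Fin n)) (f : Fin n → M) (v : Fin n)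
    (σ : Equiv.Perm (Fin n)) (a : BallIx m k → M) : Prop :=
  ∀ i, (bfsRCG G f v σ).col (addr i) = some (a i)

/-- If all labels of the ball of a regular tree are present then the ball embeds in the graph. -/
lemma BallColored.exists_embedding {M : Type*} {n m k : ℕ} {G : SimpleGraph (Fin n)}
    {f : Fin n → M} {v : Fin n} {σ : Equiv.Perm (Fin n)} {a : BallIx m k → M}
    (h : BallColored G f v σ a) :
    ∃ θ : BallIx m k → Fin n, Function.Injective θ ∧ θ none = v ∧ (∀ i, f (θ i) = a i) ∧
      (∀ i, G.Adj v (θ (some (i, ⟨[], Nat.zero_le k⟩)))) ∧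
      ∀ i j l (hl : (j :: l).length ≤ k),
        G.Adj (θ (some (i, ⟨l, (Nat.le_succ _).trans hl⟩))) (θ (some (i, ⟨j :: l, hl⟩))) := by
  have h1 : ∀ i, ∃ w, bfsPath G v σ w = some (addr i) ∧ f w = a i := by
    intro i
    have := h i
    simp only [bfsRCG] at this
    split_ifs at this with hw
    exact ⟨hw.choose, hw.choose_spec, by simpa using this⟩
  choose θ hθ hf using h1
  have h0 : θ none = v := bfsPath_eq_some_nil (hθ none)
  refine ⟨θ, fun i j hij => addr_injective (Option.some.inj ((hθ i).symm.trans
    ((congrArg _ hij).trans (hθ j)))), h0, hf, fun i => ?_, fun i j l hl => ?_⟩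
  · obtain ⟨p, h1, h2⟩ := bfsPath_eq_some_cons (k := (i : ℕ) + 1) (l := [])
      (hθ (some (i, ⟨[], Nat.zero_le k⟩)))
    rwa [bfsPath_eq_some_nil h2] at h1
  · obtain ⟨p, h1, h2⟩ := bfsPath_eq_some_cons (k := (j : ℕ) + 1)
      (l := addr (some (i, ⟨l, (Nat.le_succ _).trans hl⟩))) (hθ (some (i, ⟨j :: l, hl⟩)))
    rwa [bfsPath_injective h2 (hθ _)] at h1

/-! ### Random rotations of the tree -/

/-- The permutation sending `b` to `0` and acting as `ρ` on the remaining elements. -/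
def permOfSplit {m : ℕ} (b : Fin (m + 1)) (ρ : Equiv.Perm (Fin m)) : Equiv.Perm (Fin (m + 1)) :=
  (finSuccEquiv' b).trans ((Equiv.optionCongr ρ).trans (finSuccEquiv' 0).symm)

lemma permOfSplit_self {m : ℕ} (b : Fin (m + 1)) (ρ : Equiv.Perm (Fin m)) :
    permOfSplit b ρ b = 0 := by simp [permOfSplit]

lemma permOfSplit_succAbove {m : ℕ} (b : Fin (m + 1)) (ρ : Equiv.Perm (Fin m)) (j : Fin m) :
    permOfSplit b ρ (b.succAbove j) = (ρ j).succ := by simp [permOfSplit]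

lemma permOfSplit_bijective (m : ℕ) :
    Function.Bijective fun p : Fin (m + 1) × Equiv.Perm (Fin m) => permOfSplit p.1 p.2 := by
  refine (Fintype.bijective_iff_injective_and_card _).2 ⟨?_, ?_⟩
  · rintro ⟨b, ρ⟩ ⟨b', ρ'⟩ h
    have h : permOfSplit b ρ = permOfSplit b' ρ' := h
    have hb : b = b' := by
      have h1 := permOfSplit_self b' ρ'
      rw [← h, ← permOfSplit_self b ρ] at h1
      exact ((permOfSplit b ρ).injective h1).symm
    subst hb
    congr 1
    ext j : 1
    have h1 := permOfSplit_succAbove b ρ j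
    rw [h, permOfSplit_succAbove] at h1
    exact (Fin.succ_injective _ h1).symm
  · rw [Fintype.card_prod, Fintype.card_fin, Fintype.card_perm, Fintype.card_perm,
      Fintype.card_fin, Fintype.card_fin, Nat.factorial_succ]

/-- The rotation of the branch of the tree hanging from its child with number `i`. -/
def rot {m : ℕ} (κ : Equiv.Perm (Fin (m + 1)))
    (ρ : Fin (m + 1) × List (Fin m) → Equiv.Perm (Fin m)) (i : Fin (m + 1)) :
    List (Fin m) → List (Fin m)
  | [] => []
  | j :: l => ρ (κ i, rot κ ρ i l) j :: rot κ ρ i l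

lemma length_rot {m : ℕ} (κ : Equiv.Perm (Fin (m + 1)))
    (ρ : Fin (m + 1) × List (Fin m) → Equiv.Perm (Fin m)) (i : Fin (m + 1)) (l : List (Fin m)) :
    (rot κ ρ i l).length = l.length := by
  induction l with
  | nil => rfl
  | cons j l ih => simp [rot, ih]

lemma rot_injective {m : ℕ} (κ : Equiv.Perm (Fin (m + 1)))
    (ρ : Fin (m + 1) × List (Fin m) → Equiv.Perm (Fin m)) (i : Fin (m + 1)) :
    Function.Injective (rot κ ρ i) := by
  intro l
  induction l with
  | nil =>
    rintro (_ | ⟨j', l'⟩) h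
    · rfl
    · simp [rot] at h
  | cons j l ih =>
    rintro (_ | ⟨j', l'⟩) h
    · simp [rot] at h
    · simp only [rot, List.cons.injEq] at h
      obtain rfl := ih h.2
      rw [(ρ _).injective h.1]

lemma rot_surjective {m : ℕ} (κ : Equiv.Perm (Fin (m + 1)))
    (ρ : Fin (m + 1) × List (Fin m) → Equiv.Perm (Fin m)) (i : Fin (m + 1)) :
    Function.Surjective (rot κ ρ i) := by
  intro l
  induction l with
  | nil => exact ⟨[], rfl⟩
  | cons j l ih =>
    obtain ⟨l', rfl⟩ := ih
    exact ⟨(ρ (κ i, rot κ ρ i l')).symm j :: l', by simp [rot]⟩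

/-- The rotation of the tree, on the addresses of the vertices other than the root. -/
def rotTree {m : ℕ} (κ : Equiv.Perm (Fin (m + 1)))
    (ρ : Fin (m + 1) × List (Fin m) → Equiv.Perm (Fin m)) :
    Equiv.Perm (Fin (m + 1) × List (Fin m)) :=
  Equiv.ofBijective (fun p => (κ p.1, rot κ ρ p.1 p.2)) (by
    constructor
    · rintro ⟨i, l⟩ ⟨i', l'⟩ h
      obtain ⟨h1, h2⟩ := Prod.mk.inj h
      obtain rfl := κ.injective h1
      exact Prod.ext rfl (rot_injective κ ρ i h2)
    · rintro ⟨i, l⟩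
      obtain ⟨l', hl'⟩ := rot_surjective κ ρ (κ.symm i) l
      exact ⟨(κ.symm i, l'), Prod.ext (by simp) hl'⟩)

/-- The restriction of a rotation to a ball without its center. -/
def rotWord {m k : ℕ} (κ : Equiv.Perm (Fin (m + 1)))
    (ρ : Fin (m + 1) × List (Fin m) → Equiv.Perm (Fin m)) :
    Equiv.Perm (Fin (m + 1) × Wd m k) :=
  Equiv.ofBijective (fun p => (κ p.1, ⟨rot κ ρ p.1 p.2.1, (length_rot _ _ _ _).trans_le p.2.2⟩))
    (Finite.injective_iff_bijective.1 (by
      rintro ⟨i, l, hl⟩ ⟨i', l', hl'⟩ h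
      obtain ⟨h1, h2⟩ := Prod.mk.inj h
      obtain rfl := κ.injective h1
      obtain rfl := rot_injective κ ρ i (Subtype.mk.inj h2)
      rfl))

/-- The restriction of a rotation to a ball. -/
def rotBall {m k : ℕ} (κ : Equiv.Perm (Fin (m + 1)))
    (ρ : Fin (m + 1) × List (Fin m) → Equiv.Perm (Fin m)) : Equiv.Perm (BallIx m k) :=
  Equiv.optionCongr (rotWord κ ρ)

/-- Extension of rotation data from a ball to the whole tree. -/
def extendOne {m k : ℕ} (ρ : Fin (m + 1) × Wd m k → Equiv.Perm (Fin m)) :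
    Fin (m + 1) × List (Fin m) → Equiv.Perm (Fin m) :=
  fun p => if h : p.2.length ≤ k then ρ (p.1, ⟨p.2, h⟩) else 1

lemma portMatching_eq {V : Type*} {d : ℕ} {G : SimpleGraph V} (e : ∀ u, Fin d ≃ G.neighborSet u)
    {u w : V} {i j : Fin d} (hi : (e u i : V) = w) (hj : (e w j : V) = u) :
    portMatching e (u, i) = (w, j) := by
  subst hi
  refine Prod.ext rfl ?_
  change (e (e u i : V)).symm ⟨u, _⟩ = j
  rw [Equiv.symm_apply_eq]
  exact Subtype.ext hj.symm

lemma exists_perm_stdPort {d n : ℕ} (G : regularGraphs d n) {u : Fin n} {c : Fin d → Fin n}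
    (hc : Function.Injective c) (hu : ∀ i, G.1.Adj u (c i)) :
    ∃ τ : Equiv.Perm (Fin d), ∀ i, (stdPort G u (τ i) : Fin n) = c i := by
  refine ⟨Equiv.ofBijective (fun i => (stdPort G u).symm ⟨c i, hu i⟩)
    (Finite.injective_iff_bijective.1 fun i j h => ?_), fun i => by simp⟩
  exact hc (congrArg Subtype.val ((stdPort G u).symm.injective h))

/-- Relative to an embedding `θ` of the ball, the local view of a numbering is obtained from a
rotation of the ball. -/
lemma exists_localView_eq {M : Type*} {m n k : ℕ} (G : regularGraphs (m + 1) n) (f : Fin n → M)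
    {v : Fin n} {θ : BallIx m k → Fin n} (hθ : Function.Injective θ) (h0 : θ none = v)
    (hA : ∀ i, G.1.Adj v (θ (some (i, ⟨[], Nat.zero_le k⟩))))
    (hB : ∀ i j l (hl : (j :: l).length ≤ k),
        G.1.Adj (θ (some (i, ⟨l, (Nat.le_succ _).trans hl⟩))) (θ (some (i, ⟨j :: l, hl⟩)))) :
    ∃ τ : BallIx m k → Equiv.Perm (Fin (m + 1)), ∀ (s : Fin n → Equiv.Perm (Fin (m + 1)))
      (κ : Equiv.Perm (Fin (m + 1))) (β : Fin (m + 1) × Wd m k → Fin (m + 1))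
      (ρ : Fin (m + 1) × Wd m k → Equiv.Perm (Fin m)), s (θ none) = τ none * κ →
      (∀ y, s (θ (some y)) = τ (some y) * permOfSplit (β y) (ρ y)) →
      localView k (portMatching (portOf G s)) f v =
        (fun i => f (θ (rotBall κ (extendOne ρ) i)), fun p => β (rotWord κ (extendOne ρ) p)) := by
  obtain ⟨τ₀, hτ₀⟩ : ∃ τ : Equiv.Perm (Fin (m + 1)), ∀ i,
      (stdPort G v (τ i) : Fin n) = θ (some (i, ⟨[], Nat.zero_le k⟩)) :=
    exists_perm_stdPort G (fun i j h => by simpa using hθ h) hA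
  have h1 : ∀ y : Fin (m + 1) × Wd m k, ∃ τ : Equiv.Perm (Fin (m + 1)),
      (y.2.1 = [] → (stdPort G (θ (some y)) (τ 0) : Fin n) = v) ∧
      (∀ j l (hl : (j :: l).length ≤ k), y.2.1 = j :: l →
        (stdPort G (θ (some y)) (τ 0) : Fin n) =
          θ (some (y.1, ⟨l, (Nat.le_succ _).trans hl⟩))) ∧
      ∀ j (hl : (j :: y.2.1).length ≤ k),
        (stdPort G (θ (some y)) (τ j.succ) : Fin n) = θ (some (y.1, ⟨j :: y.2.1, hl⟩)) := by
    rintro ⟨i, l, hl⟩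
    obtain ⟨q, hq, hq1, hq2⟩ : ∃ q : BallIx m k, G.1.Adj (θ (some (i, ⟨l, hl⟩))) (θ q) ∧
        (l = [] → q = none) ∧ ∀ j l' (hl' : (j :: l').length ≤ k), l = j :: l' →
          q = some (i, ⟨l', (Nat.le_succ _).trans hl'⟩) := by
      rcases l with _ | ⟨j, l⟩
      · exact ⟨none, by rw [h0]; exact (hA i).symm, fun _ => rfl, by simp⟩
      · refine ⟨_, (hB i j l hl).symm, by simp, fun j' l' hl' h => ?_⟩
        obtain ⟨rfl, rfl⟩ := List.cons.inj h
        rfl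
    obtain ⟨τ, hτ0, hτ⟩ : ∃ τ : Equiv.Perm (Fin (m + 1)),
        (stdPort G (θ (some (i, ⟨l, hl⟩))) (τ 0) : Fin n) = θ q ∧ ∀ j (hl' : (j :: l).length ≤ k),
          (stdPort G (θ (some (i, ⟨l, hl⟩))) (τ j.succ) : Fin n) =
            θ (some (i, ⟨j :: l, hl'⟩)) := by
      by_cases hk : l.length + 1 ≤ k
      · obtain ⟨τ, hτ⟩ := exists_perm_stdPort G (u := θ (some (i, ⟨l, hl⟩)))
          (c := Fin.cons (θ q) fun j : Fin m => θ (some (i, ⟨j :: l, hk⟩))) (by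
            rw [Fin.cons_injective_iff]
            constructor
            · rintro ⟨j, hj⟩
              have hj := hθ hj
              rcases l with _ | ⟨j', l⟩
              · rw [hq1 rfl] at hj
                simp at hj
              · rw [hq2 j' l hl rfl] at hj
                have := congrArg (fun p : BallIx m k => p.elim 0 fun p => p.2.1.length) hj
                simp at this
                omega
            · intro j j' h
              simpa using hθ h) (by
            refine Fin.cases ?_ fun j => ?_
            · simpa using hq
            · simpa using hB i j l hk)
        exact ⟨τ, by simpa using hτ 0, fun j _ => by simpa using hτ j.succ⟩
      · refine ⟨Equiv.swap 0 ((stdPort G (θ (some (i, ⟨l, hl⟩)))).symm ⟨θ q, hq⟩), by simp,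
          fun j hl' => absurd hl' hk⟩
    refine ⟨τ, fun h => ?_, fun j l' hl' h => ?_, hτ⟩
    · rw [hτ0, hq1 h, h0]
    · rw [hτ0, hq2 j l' hl' h]
  choose τ h1 h2 h3 using h1
  refine ⟨fun i => i.elim τ₀ τ, fun s κ β ρ hs0 hs => ?_⟩
  have e0 : ∀ i, (portOf G s v i : Fin n) = θ (some (κ i, ⟨[], Nat.zero_le k⟩)) := by
    intro i
    rw [h0] at hs0
    change (stdPort G v (s v i) : Fin n) = _
    rw [hs0]
    exact hτ₀ _
  have e1 : ∀ y i, (portOf G s (θ (some y)) i : Fin n) =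
      stdPort G (θ (some y)) (τ y (permOfSplit (β y) (ρ y) i)) := by
    intro y i
    change (stdPort G (θ (some y)) (s (θ (some y)) i) : Fin n) = _
    rw [hs]
    rfl
  have key : ∀ i l (hl : l.length ≤ k),
      walk (portMatching (portOf G s)) (portMatching (portOf G s) (v, i)) l =
        (θ (some (rotWord κ (extendOne ρ) (i, ⟨l, hl⟩))),
          β (rotWord κ (extendOne ρ) (i, ⟨l, hl⟩))) := by
    intro i l
    induction l with
    | nil =>
      intro hl
      refine portMatching_eq _ (e0 i) ?_
      rw [e1, permOfSplit_self]
      exact h1 _ rfl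
    | cons j l ih =>
      intro hl
      rw [walk, ih ((Nat.le_succ _).trans hl)]
      set y := rotWord κ (extendOne ρ) (i, (⟨l, (Nat.le_succ _).trans hl⟩ : Wd m k)) with hy
      have hlen : (ρ y j :: y.2.1).length ≤ k := by
        have : y.2.1.length = l.length := length_rot _ _ _ _
        simpa [this] using hl
      have hr : rotWord κ (extendOne ρ) (i, (⟨j :: l, hl⟩ : Wd m k)) =
          (y.1, ⟨ρ y j :: y.2.1, hlen⟩) := by
        refine Prod.ext rfl (Subtype.ext ?_)
        change rot κ (extendOne ρ) i (j :: l) = _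
        have : extendOne ρ (κ i, rot κ (extendOne ρ) i l) = ρ y :=
          dif_pos y.2.2
        rw [rot, this]
        rfl
      rw [hr]
      refine portMatching_eq _ ?_ ?_
      · rw [e1, permOfSplit_succAbove]
        exact h3 y _ hlen
      · rw [e1, permOfSplit_self]
        exact h2 (y.1, ⟨ρ y j :: y.2.1, hlen⟩) _ _ hlen rfl
  refine Prod.ext (funext fun i => ?_) (funext fun p => ?_)
  · rcases i with _ | ⟨i, l, hl⟩
    · exact congrArg f h0.symm
    · exact congrArg f (congrArg Prod.fst (key i l hl))
  · exact congrArg Prod.snd (key p.1 p.2.1 p.2.2)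

/-! ### The mean local view -/

lemma card_mul_sum_comp {V I P : Type*} [Group P] [Fintype (V → P)] [Fintype (I → P)]
    {θ : I → V} (hθ : Function.Injective θ) (Φ : (I → P) → ℝ) :
    (Fintype.card (I → P) : ℝ) * ∑ s : V → P, Φ (s ∘ θ) =
      Fintype.card (V → P) * ∑ γ, Φ γ := by
  have h1 : ∀ γ₀ : I → P, ∑ s : V → P, Φ ((s ∘ θ) * γ₀) = ∑ s : V → P, Φ (s ∘ θ) := by
    intro γ₀
    refine Fintype.sum_equiv (Equiv.mulRight (Function.extend θ γ₀ 1)) _ _ fun s => ?_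
    congr 1
    ext i
    simp [hθ.extend_apply]
  have h2 : ∑ γ₀ : I → P, ∑ s : V → P, Φ ((s ∘ θ) * γ₀) =
      Fintype.card (I → P) * ∑ s : V → P, Φ (s ∘ θ) := by
    rw [Finset.sum_congr rfl fun γ₀ _ => h1 γ₀, Finset.sum_const, Finset.card_univ, nsmul_eq_mul]
  have h3 : ∀ s : V → P, ∑ γ₀ : I → P, Φ ((s ∘ θ) * γ₀) = ∑ γ, Φ γ := fun s =>
    Fintype.sum_equiv (Equiv.mulLeft (s ∘ θ)) _ _ fun _ => rfl
  rw [← h2, Finset.sum_comm, Finset.sum_congr rfl fun s _ => h3 s, Finset.sum_const,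
    Finset.card_univ, nsmul_eq_mul]

/-- The data of a rotation of the ball together with a choice of a port at each vertex. -/
abbrev RotData (m k : ℕ) : Type :=
  Equiv.Perm (Fin (m + 1)) × (Fin (m + 1) × Wd m k → Fin (m + 1)) ×
    (Fin (m + 1) × Wd m k → Equiv.Perm (Fin m))

/-- The permutations at the vertices of the ball encoded by rotation data. -/
def RotData.perms {m k : ℕ} (ω : RotData m k) (i : BallIx m k) : Equiv.Perm (Fin (m + 1)) :=
  i.elim ω.1 fun y => permOfSplit (ω.2.1 y) (ω.2.2 y)

lemma RotData.perms_bijective {m k : ℕ} :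
    Function.Bijective (RotData.perms : RotData m k → _) := by
  constructor
  · rintro ⟨κ, β, ρ⟩ ⟨κ', β', ρ'⟩ h
    have h0 : κ = κ' := congrFun h none
    have h1 : ∀ y, (β y, ρ y) = (β' y, ρ' y) := fun y =>
      (permOfSplit_bijective m).1 (congrFun h (some y))
    have h2 : β = β' := funext fun y => (Prod.mk.inj (h1 y)).1
    have h3 : ρ = ρ' := funext fun y => (Prod.mk.inj (h1 y)).2
    rw [h0, h2, h3]
  · intro γ
    choose p hp using fun y => (permOfSplit_bijective m).2 (γ (some y))
    refine ⟨(γ none, fun y => (p y).1, fun y => (p y).2), ?_⟩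
    ext1 i
    rcases i with _ | y
    · rfl
    · exact hp y

/-- The local view obtained from a coloring of the ball and rotation data. -/
def RotData.view {M : Type*} {m k : ℕ} (ω : RotData m k) (a : BallIx m k → M) :
    (BallIx m k → M) × (Fin (m + 1) × Wd m k → Fin (m + 1)) :=
  (fun i => a (rotBall ω.1 (extendOne ω.2.2) i), fun p => ω.2.1 (rotWord ω.1 (extendOne ω.2.2) p))

/-- The probability that random rotation data turn the coloring `a` into the local view `c`. -/
def viewProb {M : Type*} {m k : ℕ} (a : BallIx m k → M)
    (c : (BallIx m k → M) × (Fin (m + 1) × Wd m k → Fin (m + 1))) : ℝ :=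
  (∑ ω : RotData m k, if ω.view a = c then 1 else 0) / Fintype.card (RotData m k)

lemma viewProb_nonneg {M : Type*} {m k : ℕ} (a : BallIx m k → M)
    (c : (BallIx m k → M) × (Fin (m + 1) × Wd m k → Fin (m + 1))) : 0 ≤ viewProb a c :=
  div_nonneg (Finset.sum_nonneg fun ω _ => by split_ifs <;> simp) (Nat.cast_nonneg _)

lemma viewProb_le_one {M : Type*} {m k : ℕ} (a : BallIx m k → M)
    (c : (BallIx m k → M) × (Fin (m + 1) × Wd m k → Fin (m + 1))) : viewProb a c ≤ 1 := by
  refine div_le_one_of_le₀ ?_ (Nat.cast_nonneg _)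
  rw [Finset.sum_boole]
  exact_mod_cast (Finset.card_le_univ _)

lemma BallColored.sum_localView {M : Type*} {m n k : ℕ} {G : regularGraphs (m + 1) n}
    {f : Fin n → M} {v : Fin n} {σ : Equiv.Perm (Fin n)} {a : BallIx m k → M}
    (h : BallColored G.1 f v σ a)
    (c : (BallIx m k → M) × (Fin (m + 1) × Wd m k → Fin (m + 1))) :
    (∑ s : Fin n → Equiv.Perm (Fin (m + 1)),
      if localView k (portMatching (portOf G s)) f v = c then (1 : ℝ) else 0) =
      Fintype.card (Fin n → Equiv.Perm (Fin (m + 1))) * viewProb a c := by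
  obtain ⟨θ, hθ, h0, hf, hA, hB⟩ := h.exists_embedding
  obtain ⟨τ, hτ⟩ := exists_localView_eq G f hθ h0 hA hB
  set E : RotData m k ≃ (BallIx m k → Equiv.Perm (Fin (m + 1))) :=
    Equiv.ofBijective _ RotData.perms_bijective with hE
  set Φ : (BallIx m k → Equiv.Perm (Fin (m + 1))) → ℝ := fun γ =>
    if (E.symm (τ⁻¹ * γ)).view a = c then 1 else 0 with hΦ
  have e1 : ∀ s : Fin n → Equiv.Perm (Fin (m + 1)),
      (if localView k (portMatching (portOf G s)) f v = c then (1 : ℝ) else 0) = Φ (s ∘ θ) := by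
    intro s
    set ω := E.symm (τ⁻¹ * (s ∘ θ)) with hω
    have e2 : s ∘ θ = τ * ω.perms := by
      have : ω.perms = τ⁻¹ * (s ∘ θ) := E.apply_symm_apply _
      rw [this, mul_inv_cancel_left]
    have e3 := hτ s ω.1 ω.2.1 ω.2.2 (congrFun e2 none) (fun y => congrFun e2 (some y))
    simp only [hf] at e3
    rw [hΦ, e3]
    rfl
  have e2 : ∑ γ, Φ γ = ∑ ω : RotData m k, if ω.view a = c then 1 else 0 :=
    Fintype.sum_equiv ((Equiv.mulLeft τ⁻¹).trans E.symm) _ _ fun γ => rfl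
  have e3 := card_mul_sum_comp (P := Equiv.Perm (Fin (m + 1))) hθ Φ
  rw [Finset.sum_congr rfl fun s _ => e1 s, viewProb, ← e2, ← mul_div_assoc, ← e3,
    Fintype.card_congr E, mul_div_cancel_left₀]
  exact_mod_cast Fintype.card_ne_zero

lemma sum_mul_viewProb {M : Type*} [Fintype M] {m k : ℕ} {p : (BallIx m k → M) → ℝ}
    (hp : ∀ κ ρ a, p (fun i => a (rotBall κ ρ i)) = p a)
    (c : (BallIx m k → M) × (Fin (m + 1) × Wd m k → Fin (m + 1))) :
    ∑ a, p a * viewProb a c =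
      p c.1 * (Fintype.card (Fin (m + 1) × Wd m k → Fin (m + 1)) : ℝ)⁻¹ := by
  have e1 : ∀ ω : RotData m k, ∑ a, p a * (if ω.view a = c then (1 : ℝ) else 0) =
      if (fun y => ω.2.1 (rotWord ω.1 (extendOne ω.2.2) y)) = c.2 then p c.1 else 0 := by
    intro ω
    rw [Fintype.sum_eq_single fun i => c.1 ((rotBall ω.1 (extendOne ω.2.2)).symm i)]
    · have : p (fun i => c.1 ((rotBall ω.1 (extendOne ω.2.2)).symm i)) = p c.1 := by
        rw [← hp ω.1 (extendOne ω.2.2)]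
        simp
      rw [this, mul_ite, mul_one, mul_zero]
      refine if_congr ?_ rfl rfl
      rw [RotData.view, Prod.ext_iff]
      simp
    · intro a ha
      rw [if_neg, mul_zero]
      rintro rfl
      exact ha (funext fun i => by simp [RotData.view])
  have e2 : ∀ (κ : Equiv.Perm (Fin (m + 1))) (ρ : Fin (m + 1) × Wd m k → Equiv.Perm (Fin m)),
      ∑ β : Fin (m + 1) × Wd m k → Fin (m + 1),
        (if (fun y => β (rotWord κ (extendOne ρ) y)) = c.2 then p c.1 else 0) = p c.1 := by
    intro κ ρ
    rw [Fintype.sum_eq_single fun y => c.2 ((rotWord κ (extendOne ρ)).symm y)]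
    · simp
    · intro β hβ
      rw [if_neg]
      intro h
      exact hβ (funext fun y => by simp [← h])
  simp only [viewProb, ← mul_div_assoc, Finset.mul_sum]
  rw [← Finset.sum_div, Finset.sum_comm, Finset.sum_congr rfl fun ω _ => e1 ω, Fintype.sum_prod_type]
  simp only [Fintype.sum_prod_type_right, e2]
  rw [Finset.sum_const, Finset.sum_const, Finset.card_univ, Finset.card_univ, smul_smul,
    nsmul_eq_mul, Fintype.card_prod, Fintype.card_prod]
  have h1 : (Fintype.card (Equiv.Perm (Fin (m + 1))) : ℝ) ≠ 0 := by
    exact_mod_cast Fintype.card_ne_zero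
  have h2 : (Fintype.card (Fin (m + 1) × Wd m k → Equiv.Perm (Fin m)) : ℝ) ≠ 0 := by
    exact_mod_cast Fintype.card_ne_zero
  have h3 : (Fintype.card (Fin (m + 1) × Wd m k → Fin (m + 1)) : ℝ) ≠ 0 := by
    exact_mod_cast Fintype.card_ne_zero
  push_cast
  field_simp

/-- The frequency of the coloring `a` of the ball in breadth-first search labels. -/
def bfsFreq {M : Type*} {m n k : ℕ} (G : SimpleGraph (Fin n)) (f : Fin n → M)
    (a : BallIx m k → M) : ℝ :=
  (∑ v, ∑ σ : Equiv.Perm (Fin n), if BallColored G f v σ a then 1 else 0) / (n * n.factorial)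

lemma sum_bfsFreq_mul_viewProb_le {M : Type*} [Fintype M] {m n k : ℕ}
    (G : regularGraphs (m + 1) n) (f : Fin n → M)
    (c : (BallIx m k → M) × (Fin (m + 1) × Wd m k → Fin (m + 1))) :
    ∑ a, bfsFreq G.1 f a * viewProb a c ≤ meanView k G f c := by
  set S : ℝ := ((Fintype.card (Fin n → Equiv.Perm (Fin (m + 1))) : ℕ) : ℝ) with hS
  have hS0 : 0 < S := by
    rw [hS]
    exact_mod_cast Fintype.card_pos
  set X : Fin n → ℝ := fun v => ∑ s : Fin n → Equiv.Perm (Fin (m + 1)),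
      if localView k (portMatching (portOf G s)) f v = c then (1 : ℝ) else 0 with hX
  have e1 : meanView k G f c = (∑ v, X v) / (n * S) := by
    have e0 : ∀ s : Fin n → Equiv.Perm (Fin (m + 1)),
        emp (localView k (portMatching (portOf G s)) f) c =
          (∑ v, if localView k (portMatching (portOf G s)) f v = c then (1 : ℝ) else 0) / n := by
      intro s
      rw [emp, Finset.sum_boole, Fintype.card_fin]
      congr!
    rw [meanView]
    simp only [e0]
    rw [← Finset.sum_div, Finset.sum_comm, div_div]
  have e2 : ∀ v (σ : Equiv.Perm (Fin n)),
      ∑ a : BallIx m k → M, (if BallColored G.1 f v σ a then (1 : ℝ) else 0) * viewProb a c ≤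
        X v / S := by
    intro v σ
    by_cases h : ∃ a : BallIx m k → M, BallColored G.1 f v σ a
    · obtain ⟨a, ha⟩ := h
      rw [Fintype.sum_eq_single a, if_pos ha, one_mul, hX]
      · simp only
        rw [ha.sum_localView c, mul_div_cancel_left₀ _ hS0.ne']
      · intro a' ha'
        rw [if_neg, zero_mul]
        intro h
        exact ha' (funext fun i => Option.some.inj ((h i).symm.trans (ha i)))
    · push Not at h
      simp only [h, if_false, zero_mul, Finset.sum_const_zero]
      exact div_nonneg (Finset.sum_nonneg fun s _ => by split_ifs <;> simp) hS0.le
  have e3 : ∑ a, bfsFreq G.1 f a * viewProb a c = (∑ v, ∑ σ : Equiv.Perm (Fin n),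
      ∑ a : BallIx m k → M, (if BallColored G.1 f v σ a then (1 : ℝ) else 0) * viewProb a c) /
        (n * n.factorial) := by
    simp only [bfsFreq, div_mul_eq_mul_div, ← Finset.sum_div, Finset.sum_mul]
    congr 1
    rw [Finset.sum_comm]
    exact Finset.sum_congr rfl fun v _ => Finset.sum_comm
  rw [e3, e1]
  rcases Nat.eq_zero_or_pos n with rfl | hn
  · simp
  have hn' : (0 : ℝ) < n := by exact_mod_cast hn
  have hn'' : (0 : ℝ) < n.factorial := by exact_mod_cast n.factorial_pos
  calc _ ≤ (∑ v, ∑ _σ : Equiv.Perm (Fin n), X v / S) / (n * n.factorial) :=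
        div_le_div_of_nonneg_right (Finset.sum_le_sum fun v _ => Finset.sum_le_sum fun σ _ => e2 v σ)
          (by positivity)
    _ = _ := by
      simp only [Finset.sum_const, Finset.card_univ, Fintype.card_perm, Fintype.card_fin,
        nsmul_eq_mul, ← Finset.mul_sum, ← Finset.sum_div]
      field_simp

/-! ### The vertices of the regular tree -/

/-- The breadth-first search label of an address in the tree. -/
def treeAddr {m : ℕ} (y : Option (Fin (m + 1) × List (Fin m))) : List ℕ :=
  y.elim [] fun p => p.2.map (fun j : Fin m => (j : ℕ) + 1) ++ [(p.1 : ℕ) + 1]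

lemma treeAddr_injective {m : ℕ} :
    Function.Injective (treeAddr : Option (Fin (m + 1) × List (Fin m)) → List ℕ) := by
  rintro (_ | ⟨i, l⟩) (_ | ⟨i', l'⟩) h
  · rfl
  · simp [treeAddr] at h
  · simp [treeAddr] at h
  · simp only [treeAddr, Option.elim] at h
    obtain ⟨h1, h2⟩ := List.append_inj' h rfl
    have h3 : l = l' := List.map_injective_iff.2 (fun a b hab => by
      exact Fin.ext (Nat.add_right_cancel hab)) h1
    have h4 : i = i' := Fin.ext (by simpa using h2)
    rw [h3, h4]

lemma validTd_treeAddr {m : ℕ} (y : Option (Fin (m + 1) × List (Fin m))) :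
    ValidTd (m + 1) (treeAddr y) := by
  rcases y with _ | ⟨i, l⟩
  · constructor <;> simp [treeAddr]
  · constructor
    · intro a ha
      simp only [treeAddr, Option.elim, List.dropLast_concat, List.mem_map] at ha
      obtain ⟨j, -, rfl⟩ := ha
      omega
    · intro a ha
      simp only [treeAddr, Option.elim, List.getLast?_concat, Option.mem_def,
        Option.some.injEq] at ha
      omega

lemma exists_treeAddr_eq {m : ℕ} {l : List ℕ} (hl : ValidTd (m + 1) l) :
    ∃ y : Option (Fin (m + 1) × List (Fin m)), treeAddr y = l := by
  rcases List.eq_nil_or_concat' l with rfl | ⟨l', a, rfl⟩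
  · exact ⟨none, rfl⟩
  · obtain ⟨h1, h2⟩ := hl
    rw [List.dropLast_concat] at h1
    have ha := h2 a (by simp)
    have hl' : ∃ w : List (Fin m), w.map (fun j : Fin m => (j : ℕ) + 1) = l' := by
      change l' ∈ Set.range (List.map fun j : Fin m => (j : ℕ) + 1)
      rw [Set.range_list_map]
      intro b hb
      have := h1 b hb
      exact ⟨⟨b - 1, by omega⟩, by simp only; omega⟩
    obtain ⟨w, rfl⟩ := hl'
    refine ⟨some (⟨a - 1, by omega⟩, w), ?_⟩
    simp only [treeAddr, Option.elim]
    congr 2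
    omega

/-- The vertex of the tree with a given address. -/
def treeVertex {m : ℕ} : Option (Fin (m + 1) × List (Fin m)) ≃ TdVertex (m + 1) :=
  Equiv.ofBijective (fun y => ⟨treeAddr y, validTd_treeAddr y⟩) (by
    constructor
    · intro y y' h
      exact treeAddr_injective (Subtype.mk.inj h)
    · rintro ⟨l, hl⟩
      obtain ⟨y, rfl⟩ := exists_treeAddr_eq hl
      exact ⟨y, rfl⟩)

/-- The parent of an address. -/
def treeParent {m : ℕ} (y : Option (Fin (m + 1) × List (Fin m))) :
    Option (Fin (m + 1) × List (Fin m)) :=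
  y.elim none fun p => match p.2 with
    | [] => none
    | _ :: l => some (p.1, l)

lemma treeAddr_treeParent {m : ℕ} (y : Option (Fin (m + 1) × List (Fin m))) :
    treeAddr (treeParent y) = (treeAddr y).tail := by
  rcases y with _ | ⟨i, _ | ⟨j, l⟩⟩ <;> simp [treeAddr, treeParent]

lemma treeAddr_eq_cons_iff {m : ℕ} {y y' : Option (Fin (m + 1) × List (Fin m))} :
    (∃ i, treeAddr y' = i :: treeAddr y) ↔ y' ≠ none ∧ treeParent y' = y := by
  rw [← treeAddr_injective.eq_iff (a := treeParent y'), treeAddr_treeParent]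
  have h : y' = none ↔ treeAddr y' = [] := by
    rw [← treeAddr_injective.eq_iff]
    rfl
  rw [ne_eq, h]
  rcases treeAddr y' with _ | ⟨a, l⟩ <;> simp

lemma treeParent_rotTree {m : ℕ} (κ : Equiv.Perm (Fin (m + 1)))
    (ρ : Fin (m + 1) × List (Fin m) → Equiv.Perm (Fin m))
    (y : Option (Fin (m + 1) × List (Fin m))) :
    treeParent (Equiv.optionCongr (rotTree κ ρ) y) =
      Equiv.optionCongr (rotTree κ ρ) (treeParent y) := by
  rcases y with _ | ⟨i, _ | ⟨j, l⟩⟩ <;> rfl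

/-- The automorphism of the regular tree given by rotation data. -/
def treeAut {m : ℕ} (κ : Equiv.Perm (Fin (m + 1)))
    (ρ : Fin (m + 1) × List (Fin m) → Equiv.Perm (Fin m)) :
    TdGraph (m + 1) ≃g TdGraph (m + 1) where
  toEquiv := (treeVertex.symm.trans (Equiv.optionCongr (rotTree κ ρ))).trans treeVertex
  map_rel_iff' := by
    have key : ∀ y y' : Option (Fin (m + 1) × List (Fin m)),
        (TdGraph (m + 1)).Adj (treeVertex y) (treeVertex y') ↔
          (y' ≠ none ∧ treeParent y' = y) ∨ (y ≠ none ∧ treeParent y = y') := by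
      intro y y'
      rw [← treeAddr_eq_cons_iff, ← treeAddr_eq_cons_iff]
      rfl
    intro v w
    obtain ⟨y, rfl⟩ := treeVertex.surjective v
    obtain ⟨y', rfl⟩ := treeVertex.surjective w
    have h0 : ∀ y, Equiv.optionCongr (rotTree κ ρ) y = none ↔ y = none := by
      intro y
      rcases y with _ | y <;> simp
    simp only [Equiv.trans_apply, Equiv.symm_apply_apply]
    rw [key, key, treeParent_rotTree, treeParent_rotTree, ne_eq, ne_eq, h0, h0,
      (Equiv.injective _).eq_iff, (Equiv.injective _).eq_iff]

/-- The vertex of the tree with a given address in the ball around the root. -/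
def ballVertex {m k : ℕ} (i : BallIx m k) : TdVertex (m + 1) :=
  treeVertex (i.map fun p => (p.1, p.2.1))

lemma ballVertex_val {m k : ℕ} (i : BallIx m k) : (ballVertex i).1 = addr i := by
  rcases i with _ | ⟨i, l⟩ <;> rfl

lemma ballVertex_injective {m k : ℕ} : Function.Injective (ballVertex : BallIx m k → _) := by
  intro i j h
  apply addr_injective
  rw [← ballVertex_val, h, ballVertex_val]

lemma treeAut_ballVertex {m k : ℕ} (κ : Equiv.Perm (Fin (m + 1)))
    (ρ : Fin (m + 1) × List (Fin m) → Equiv.Perm (Fin m)) (i : BallIx m k) :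
    treeAut κ ρ (ballVertex i) = ballVertex (rotBall κ ρ i) := by
  change treeVertex (Equiv.optionCongr (rotTree κ ρ) (treeVertex.symm (ballVertex i))) = _
  rw [ballVertex, Equiv.symm_apply_apply]
  rcases i with _ | ⟨i, l⟩ <;> rfl

lemma length_addr_le {m k : ℕ} (i : BallIx m k) : (addr i).length ≤ k + 1 := by
  rcases i with _ | ⟨i, l, hl⟩
  · simp [addr]
  · simpa [addr] using hl

lemma exists_ballVertex_eq {m k : ℕ} {v : TdVertex (m + 1)} (hv : v.1.length ≤ k + 1) :
    ∃ i : BallIx m k, ballVertex i = v := by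
  obtain ⟨y, rfl⟩ := treeVertex.surjective v
  rcases y with _ | ⟨i, l⟩
  · exact ⟨none, rfl⟩
  · have hl : l.length ≤ k := by
      change (treeAddr (some (i, l))).length ≤ k + 1 at hv
      simpa [treeAddr] using hv
    exact ⟨some (i, ⟨l, hl⟩), rfl⟩

/-- The vertices of a ball of the tree. -/
def ballEquiv (m k : ℕ) : BallIx m k ≃ SrSet (m + 1) (k + 1) :=
  Equiv.ofBijective (fun i => ⟨ballVertex i, by
      rw [SrSet, Set.mem_ofPred_eq, ballVertex_val]
      exact length_addr_le i⟩) (by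
    constructor
    · intro i j h
      exact ballVertex_injective (Subtype.mk.inj h)
    · rintro ⟨v, hv⟩
      obtain ⟨i, rfl⟩ := exists_ballVertex_eq hv
      exact ⟨i, rfl⟩)

/-- The vertices of the neighborhood of an edge of the tree. -/
def edgeEquiv (m k : ℕ) : EdgeIx m k ≃ ErSet (m + 1) (k + 1) :=
  Equiv.ofBijective (fun e => ⟨ballVertex (edgeToBall 0 e), by
      rw [ErSet, Set.mem_ofPred_eq, ballVertex_val]
      refine edgeIx_cases (P := fun e => (addr (edgeToBall 0 e)).length + 1 ≤ k + 1 ∨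
        ((addr (edgeToBall 0 e)).getLast? = some 1 ∧
          (addr (edgeToBall 0 e)).length ≤ k + 1)) ?_ ?_ ?_ e
      · intro l
        right
        rw [edgeToBall_true]
        exact ⟨by simp [addr], length_addr_le _⟩
      · left
        rw [edgeToBall_nil]
        simp [addr]
      · intro l j h
        left
        rw [edgeToBall_append]
        simp [addr] at h ⊢
        omega⟩) (by
    constructor
    · intro i j h
      exact edgeToBall_injective 0 (ballVertex_injective (Subtype.mk.inj h))
    · rintro ⟨v, hv⟩
      have hv' : v.1.length ≤ k + 1 := ErSet_subset_SrSet _ _ hv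
      obtain ⟨i, rfl⟩ := exists_ballVertex_eq hv'
      suffices h : ∃ e, edgeToBall 0 e = i by
        obtain ⟨e, rfl⟩ := h
        exact ⟨e, rfl⟩
      rw [ErSet, Set.mem_ofPred_eq, ballVertex_val] at hv
      rcases i with _ | ⟨i, l, hl⟩
      · exact ⟨_, edgeToBall_nil 0⟩
      · rcases Fin.eq_zero_or_eq_succ i with rfl | ⟨j, rfl⟩
        · exact ⟨_, edgeToBall_true 0 _⟩
        · rcases hv with hv | hv
          · refine ⟨(false, ⟨l ++ [j], ?_⟩), ?_⟩
            · simpa [addr] using hv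
            · rw [edgeToBall_append]
              simp
          · simp [addr] at hv)

/-- The rotation of the ball that moves the edge number `0` to the edge number `i`. -/
lemma rotBall_edgeToBall {m k : ℕ} (i : Fin (m + 1)) (e : EdgeIx m k) :
    rotBall (permOfSplit i 1).symm 1 (edgeToBall 0 e) = edgeToBall i e := by
  have h0 : (permOfSplit i 1).symm 0 = i := by
    rw [Equiv.symm_apply_eq, permOfSplit_self]
  have h1 : ∀ j : Fin m, (permOfSplit i 1).symm j.succ = i.succAbove j := by
    intro j
    rw [Equiv.symm_apply_eq, permOfSplit_succAbove]
    rfl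
  have h2 : ∀ (κ : Equiv.Perm (Fin (m + 1))) (j : Fin (m + 1)) (l : List (Fin m)),
      rot κ 1 j l = l := by
    intro κ j l
    induction l with
    | nil => rfl
    | cons a l ih => simp [rot, ih]
  have h3 : ∀ (κ : Equiv.Perm (Fin (m + 1))) (j : Fin (m + 1)) (l : Wd m k),
      rotBall κ 1 (some (j, l)) = some (κ j, l) := by
    intro κ j l
    simp [rotBall, rotWord, h2]
  refine edgeIx_cases (P := fun e =>
    rotBall (permOfSplit i 1).symm 1 (edgeToBall 0 e) = edgeToBall i e) ?_ ?_ ?_ e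
  · intro l
    rw [edgeToBall_true, edgeToBall_true, h3, h0]
  · rw [edgeToBall_nil, edgeToBall_nil]
    rfl
  · intro l j h
    rw [edgeToBall_append, edgeToBall_append, h3, Fin.succAbove_zero, h1]

/-! ### Finite-dimensional marginals of invariant processes -/

lemma shannon_map_equiv {α β : Type*} [MeasurableSpace α] [MeasurableSpace β]
    [MeasurableSingletonClass β] (e : α ≃ β) (he : Measurable e) (ν : Measure α) :
    shannon (ν.map e) = shannon ν := by
  rw [shannon, shannon, ← e.tsum_eq]
  refine tsum_congr fun a => ?_
  rw [Measure.map_apply he (measurableSet_singleton _)]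
  congr 3
  ext b
  simp

lemma shannon_eq_ent {α : Type*} [Fintype α] [MeasurableSpace α] (ν : Measure α) :
    shannon ν = ent fun a => ν.real {a} := by
  rw [shannon, tsum_fintype]
  rfl

lemma sum_ite_measureReal_eq {α β : Type*} [Fintype α] [MeasurableSpace α]
    [MeasurableSingletonClass α] [MeasurableSpace β] [MeasurableSingletonClass β] (ν : Measure α)
    [IsFiniteMeasure ν] (g : α → β) (hg : Measurable g) (y : β) :
    ∑ a, (if g a = y then ν.real {a} else 0) = (ν.map g).real {y} := by
  rw [← Finset.sum_filter, sum_measureReal_singleton, map_measureReal_apply hg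
    (measurableSet_singleton _)]
  congr 1
  ext a
  simp

section Marginals

variable {m k : ℕ} {M : Type}

/-- The law of an invariant process on a ball of the tree. -/
def ballLaw [MeasurableSpace M] (k : ℕ) (μ : Measure (TdVertex (m + 1) → M)) :
    Measure (BallIx m k → M) :=
  μ.map fun x i => x (ballVertex i)

/-- The law of an invariant process on the neighborhood of an edge of the tree. -/
def edgeLaw [MeasurableSpace M] (k : ℕ) (μ : Measure (TdVertex (m + 1) → M)) :
    Measure (EdgeIx m k → M) :=
  μ.map fun x e => x (ballVertex (edgeToBall 0 e))

lemma measurable_comp_right {I J : Type*} [MeasurableSpace M] (g : I → J) :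
    Measurable fun (x : J → M) (i : I) => x (g i) :=
  measurable_pi_lambda _ fun _ => measurable_pi_apply _

instance [MeasurableSpace M] (μ : Measure (TdVertex (m + 1) → M)) [IsProbabilityMeasure μ] :
    IsProbabilityMeasure (ballLaw k μ) :=
  Measure.isProbabilityMeasure_map (measurable_comp_right _).aemeasurable

instance [MeasurableSpace M] (μ : Measure (TdVertex (m + 1) → M)) [IsProbabilityMeasure μ] :
    IsProbabilityMeasure (edgeLaw k μ) :=
  Measure.isProbabilityMeasure_map (measurable_comp_right _).aemeasurable

lemma shannon_restrictTo_SrSet [Fintype M] [MeasurableSpace M] [DiscreteMeasurableSpace M]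
    (μ : Measure (TdVertex (m + 1) → M)) :
    shannon (restrictTo (SrSet (m + 1) (k + 1)) μ) = ent fun a => (ballLaw k μ).real {a} := by
  rw [← shannon_eq_ent, ← shannon_map_equiv ((ballEquiv m k).symm.arrowCongr (Equiv.refl M))
    (measurable_comp_right (ballEquiv m k))]
  exact congrArg shannon (Measure.map_map (measurable_comp_right (ballEquiv m k))
    (measurable_comp_right _))

lemma shannon_restrictTo_ErSet [Fintype M] [MeasurableSpace M] [DiscreteMeasurableSpace M]
    (μ : Measure (TdVertex (m + 1) → M)) :
    shannon (restrictTo (ErSet (m + 1) (k + 1)) μ) = ent fun a => (edgeLaw k μ).real {a} := by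
  rw [← shannon_eq_ent, ← shannon_map_equiv ((edgeEquiv m k).symm.arrowCongr (Equiv.refl M))
    (measurable_comp_right (edgeEquiv m k))]
  exact congrArg shannon (Measure.map_map (measurable_comp_right (edgeEquiv m k))
    (measurable_comp_right _))

lemma map_rotBall_ballLaw [MeasurableSpace M]
    {μ : Measure (TdVertex (m + 1) → M)} (hμ : μ ∈ InvMeas (m + 1) M)
    (κ : Equiv.Perm (Fin (m + 1))) (ρ : Fin (m + 1) × List (Fin m) → Equiv.Perm (Fin m)) :
    (ballLaw k μ).map (fun a i => a (rotBall κ ρ i)) = ballLaw k μ := by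
  conv_rhs => rw [ballLaw, ← hμ.2 (treeAut κ ρ)]
  rw [ballLaw, Measure.map_map (measurable_comp_right _) (measurable_comp_right _),
    Measure.map_map (measurable_comp_right _) (measurable_comp_right _)]
  congr 1
  ext x i
  simp [treeAut_ballVertex]

lemma ballLaw_rotBall [Fintype M] [MeasurableSpace M] [DiscreteMeasurableSpace M]
    {μ : Measure (TdVertex (m + 1) → M)} (hμ : μ ∈ InvMeas (m + 1) M)
    (κ : Equiv.Perm (Fin (m + 1))) (ρ : Fin (m + 1) × List (Fin m) → Equiv.Perm (Fin m))
    (a : BallIx m k → M) :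
    (ballLaw k μ).real {fun i => a (rotBall κ ρ i)} = (ballLaw k μ).real {a} := by
  conv_lhs => rw [← map_rotBall_ballLaw hμ κ ρ]
  rw [map_measureReal_apply (measurable_comp_right _) (measurableSet_singleton _)]
  congr 1
  ext b
  simp only [Set.mem_preimage, Set.mem_singleton_iff]
  constructor
  · intro h
    funext i
    simpa using congrFun h ((rotBall κ ρ).symm i)
  · rintro rfl
    rfl

lemma sum_ballLaw_edgeToBall [Fintype M] [MeasurableSpace M] [DiscreteMeasurableSpace M]
    {μ : Measure (TdVertex (m + 1) → M)} (hμ : μ ∈ InvMeas (m + 1) M) (i : Fin (m + 1))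
    (y : EdgeIx m k → M) :
    ∑ a, (if (fun e => a (edgeToBall i e)) = y then (ballLaw k μ).real {a} else 0) =
      (edgeLaw k μ).real {y} := by
  have := hμ.1
  have h : edgeLaw k μ = (ballLaw k μ).map fun a e => a (edgeToBall i e) := by
    have h1 : (ballLaw k μ).map (fun (a : BallIx m k → M) e => a (edgeToBall 0 e)) =
        edgeLaw k μ := Measure.map_map (measurable_comp_right _) (measurable_comp_right _)
    rw [← h1]
    conv_lhs => rw [← map_rotBall_ballLaw hμ (permOfSplit i 1).symm 1]
    rw [Measure.map_map (measurable_comp_right _) (measurable_comp_right _)]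
    congr 1
    ext a e
    exact congrArg a (rotBall_edgeToBall i e)
  rw [h, ← sum_ite_measureReal_eq (ballLaw k μ) _ (measurable_comp_right (edgeToBall i))]
  congr!

/-! ### Lévy-Prokhorov distance and cylinders -/

lemma col_eq_of_dist_lt {M : Type*} {g g' : RCG M} {r : ℕ} (h : dist g g' < (2 : ℝ)⁻¹ ^ r) {l : List ℕ}
    (hl : l.length ≤ r) : g.col l = g'.col l := by
  have hs : Summable (fun r : ℕ => if resS r g = resS r g' then (0 : ℝ) else (2 : ℝ)⁻¹ ^ r) :=
    Summable.of_nonneg_of_le (fun r => by positivity)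
      (fun r => by split_ifs <;> [positivity; exact le_rfl])
      (summable_geometric_of_lt_one (by norm_num) (by norm_num : (2 : ℝ)⁻¹ < 1))
  have h1 := hs.le_tsum r fun j _ => by positivity
  have h2 : resS r g = resS r g' := by
    by_contra hne
    rw [if_neg hne] at h1
    exact absurd h (not_lt.2 h1)
  have h3 := congrFun (congrArg RCG.col h2) l
  simpa [resS, hl] using h3

lemma dist_le_of_resS_eq {M : Type*} {g g' : RCG M} {R : ℕ} (h : ∀ r ≤ R, resS r g = resS r g') :
    dist g g' ≤ (2 : ℝ)⁻¹ ^ R := by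
  have hg := summable_geometric_of_lt_one (by norm_num) (by norm_num : (2 : ℝ)⁻¹ < 1)
  have h0 : ∀ r : ℕ, (0 : ℝ) ≤ (2 : ℝ)⁻¹ ^ r := fun r => by positivity
  obtain ⟨F, hF⟩ : ∃ F : ℕ → ℝ, F = fun r => if resS r g = resS r g' then 0 else (2 : ℝ)⁻¹ ^ r :=
    ⟨_, rfl⟩
  have hF0 : ∀ r, 0 ≤ F r := fun r => by
    rw [hF]
    dsimp only
    split_ifs <;> [exact le_rfl; exact h0 r]
  have hF1 : ∀ r, F r ≤ (2 : ℝ)⁻¹ ^ r := fun r => by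
    rw [hF]
    dsimp only
    split_ifs <;> [exact h0 r; exact le_rfl]
  have hs : Summable F := Summable.of_nonneg_of_le hF0 hF1 hg
  have hd : dist g g' = ∑' r, F r := by
    rw [hF]
    rfl
  have hR : ∑ r ∈ Finset.range (R + 1), F r = 0 := Finset.sum_eq_zero fun r hr => by
    rw [hF]
    exact if_pos (h r (Nat.lt_succ_iff.1 (Finset.mem_range.1 hr)))
  have h1 : ∀ r, F (r + (R + 1)) ≤ (2 : ℝ)⁻¹ ^ r * (2 : ℝ)⁻¹ ^ (R + 1) := fun r => by
    rw [← pow_add]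
    exact hF1 _
  have h2 : ∑' r, F (r + (R + 1)) ≤ ∑' r : ℕ, (2 : ℝ)⁻¹ ^ r * (2 : ℝ)⁻¹ ^ (R + 1) :=
    Summable.tsum_le_tsum h1 ((summable_nat_add_iff (R + 1)).2 hs) (hg.mul_right _)
  rw [tsum_mul_right, tsum_geometric_of_lt_one (by norm_num) (by norm_num)] at h2
  rw [hd, ← hs.sum_add_tsum_nat_add (R + 1), hR, zero_add]
  refine h2.trans (le_of_eq ?_)
  rw [pow_succ]
  ring

lemma resS_iotaTd_eq {M : Type*} {d R r : ℕ} {x x' : TdVertex d → M}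
    (h : ∀ v : TdVertex d, v.1.length ≤ R → x v = x' v) (hr : r ≤ R) :
    resS r (iotaTd d x) = resS r (iotaTd d x') := by
  refine RCG.ext ?_ ?_
  · ext1 l
    simp only [resS, iotaTd]
    split_ifs with h1 h2
    · exact congrArg some (h ⟨l, h2⟩ (h1.trans hr))
    · rfl
    · rfl
  · rfl

lemma measurable_iotaTd [Fintype M] [MeasurableSpace M] [DiscreteMeasurableSpace M] :
    Measurable (iotaTd (m + 1) : (TdVertex (m + 1) → M) → RCG M) := by
  refine measurable_of_isOpen fun U hU => ?_
  have key : iotaTd (m + 1) ⁻¹' U = ⋃ k : ℕ, (fun x (i : BallIx m k) => x (ballVertex i)) ⁻¹'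
      {y : BallIx m k → M | ∀ x, (fun i => x (ballVertex i)) = y → iotaTd (m + 1) x ∈ U} := by
    ext x
    simp only [Set.mem_preimage, Set.mem_iUnion, Set.mem_ofPred_eq]
    constructor
    · intro hx
      obtain ⟨ε, hε, hU'⟩ := Metric.isOpen_iff.1 hU _ hx
      obtain ⟨k, hk⟩ := exists_pow_lt_of_lt_one hε (by norm_num : (2 : ℝ)⁻¹ < 1)
      refine ⟨k, fun x' hx' => hU' ?_⟩
      refine lt_of_le_of_lt (dist_le_of_resS_eq (R := k + 1) fun r hr => resS_iotaTd_eq (fun v hv => ?_) hr)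
        (lt_of_le_of_lt ?_ hk)
      · obtain ⟨i, rfl⟩ := exists_ballVertex_eq hv
        exact congrFun hx' i
      · exact pow_le_pow_of_le_one (by norm_num) (by norm_num) (Nat.le_succ k)
    · rintro ⟨k, hk⟩
      exact hk x rfl
  rw [key]
  exact MeasurableSet.iUnion fun k => measurable_comp_right _ (Set.toFinite _).measurableSet

/-- The rooted colored graphs whose ball around the root is that of a regular tree with the
coloring `a`. -/
def ballCylinder {M : Type*} (a : BallIx m k → M) : Set (RCG M) :=
  {g | ∀ i, g.col (addr i) = some (a i)}

lemma thickening_ballCylinder {M : Type*} (a : BallIx m k → M) {ε : ℝ} (hε : 0 < ε) (hε' : ε ≤ (2 : ℝ)⁻¹ ^ (k + 1)) :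
    Metric.thickening ε (ballCylinder a) = ballCylinder a := by
  refine Set.Subset.antisymm ?_ (Metric.self_subset_thickening hε _)
  intro g hg i
  obtain ⟨z, hz, hd⟩ := Metric.mem_thickening_iff.1 hg
  rw [col_eq_of_dist_lt (hd.trans_le hε') (length_addr_le i)]
  exact hz i

lemma measurableSet_ballCylinder {M : Type*} (a : BallIx m k → M) : MeasurableSet (ballCylinder a) := by
  rw [← thickening_ballCylinder a (by positivity) le_rfl]
  exact Metric.isOpen_thickening.measurableSet

lemma lawTd_ballCylinder [Fintype M] [MeasurableSpace M] [DiscreteMeasurableSpace M]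
    (μ : Measure (TdVertex (m + 1) → M)) (a : BallIx m k → M) :
    (lawTd (m + 1) μ) (ballCylinder a) = ballLaw k μ {a} := by
  rw [lawTd, Measure.map_apply measurable_iotaTd (measurableSet_ballCylinder a), ballLaw,
    Measure.map_apply (measurable_comp_right _) (measurableSet_singleton _)]
  congr 1
  ext x
  have h : ∀ i : BallIx m k, (iotaTd (m + 1) x).col (addr i) = some (x (ballVertex i)) := by
    intro i
    rw [← ballVertex_val]
    exact dif_pos (ballVertex i).2
  simp only [ballCylinder, Set.mem_preimage, Set.mem_ofPred_eq, h, Option.some.injEq,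
    Set.mem_singleton_iff, funext_iff]

lemma distrG_ballCylinder {M : Type*} {n : ℕ} (G : SimpleGraph (Fin n)) (f : Fin n → M) (a : BallIx m k → M) :
    (distrG G f (ballCylinder a)).toReal = bfsFreq G f a := by
  have h : ∀ v σ, Measure.dirac (bfsRCG G f v σ) (ballCylinder a) =
      ((if BallColored G f v σ a then 1 else 0 : ℕ) : ℝ≥0∞) := by
    intro v σ
    rw [Measure.dirac_apply' _ (measurableSet_ballCylinder a), Set.indicator_apply]
    push_cast
    rfl
  have h2 : ∀ v, distrAt G f v (ballCylinder a) = ((Nat.factorial n : ℝ≥0∞))⁻¹ *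
      ((∑ σ : Equiv.Perm (Fin n), if BallColored G f v σ a then 1 else 0 : ℕ) : ℝ≥0∞) := by
    intro v
    rw [distrAt, Measure.smul_apply, Measure.finsetSum_apply, smul_eq_mul,
      Finset.sum_congr rfl fun σ _ => h v σ]
    push_cast
    rfl
  rw [distrG, Measure.smul_apply, Measure.finsetSum_apply, smul_eq_mul,
    Finset.sum_congr rfl fun v _ => h2 v, ← Finset.mul_sum, ← Nat.cast_sum, ENNReal.toReal_mul,
    ENNReal.toReal_mul, ENNReal.toReal_inv, ENNReal.toReal_inv, ENNReal.toReal_natCast,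
    ENNReal.toReal_natCast, ENNReal.toReal_natCast, bfsFreq, ← mul_assoc, ← mul_inv, div_eq_inv_mul]
  push_cast
  rfl

lemma isFiniteMeasure_distrG {M : Type*} {n : ℕ} (hn : 0 < n) (G : SimpleGraph (Fin n)) (f : Fin n → M) :
    IsFiniteMeasure (distrG G f) := by
  have h1 : ∀ v, IsFiniteMeasure (distrAt G f v) := fun v =>
    Measure.smul_finite _ (ENNReal.inv_ne_top.2 (by exact_mod_cast n.factorial_ne_zero))
  exact Measure.smul_finite _ (ENNReal.inv_ne_top.2 (by exact_mod_cast hn.ne'))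

lemma ballLaw_sub_le_bfsFreq [Fintype M] [MeasurableSpace M] [DiscreteMeasurableSpace M]
    {n : ℕ} (hn : 0 < n) (G : SimpleGraph (Fin n)) (f : Fin n → M)
    (μ : Measure (TdVertex (m + 1) → M)) [IsProbabilityMeasure μ] {ε ε' : ℝ} (hε : 0 ≤ ε) (h : ε < ε')
    (hε' : ε' ≤ (2 : ℝ)⁻¹ ^ (k + 1))
    (hd : levyProkhorovDist (distrG G f) (lawTd (m + 1) μ) ≤ ε) (a : BallIx m k → M) :
    (ballLaw k μ).real {a} - ε' ≤ bfsFreq G f a := by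
  have := isFiniteMeasure_distrG hn G f
  have : IsProbabilityMeasure (lawTd (m + 1) μ) :=
    Measure.isProbabilityMeasure_map measurable_iotaTd.aemeasurable
  have h1 : levyProkhorovEDist (distrG G f) (lawTd (m + 1) μ) < ENNReal.ofReal ε' := by
    rw [← ENNReal.toReal_lt_toReal (levyProkhorovEDist_ne_top _ _) ENNReal.ofReal_ne_top,
      ENNReal.toReal_ofReal (hε.trans h.le)]
    exact lt_of_le_of_lt hd h
  have h2 := right_measure_le_of_levyProkhorovEDist_lt h1 (measurableSet_ballCylinder a)
  rw [ENNReal.toReal_ofReal (hε.trans h.le), thickening_ballCylinder a (hε.trans_lt h) hε',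
    lawTd_ballCylinder] at h2
  have h3 := ENNReal.toReal_mono (by finiteness) h2
  rw [ENNReal.toReal_add (by finiteness) (by finiteness), ENNReal.toReal_ofReal (hε.trans h.le), distrG_ballCylinder] at h3
  rw [Measure.real]
  linarith

end Marginals

/-! ### The annealed entropy of a weakly typical process -/

lemma abs_sub_le_of_sub_le_of_sum_le {C : Type*} [Fintype C] {x y : C → ℝ} {e : ℝ} (he : 0 ≤ e)
    (h : ∀ c, y c - e ≤ x c) (hs : ∑ c, x c ≤ ∑ c, y c) (c : C) :
    |x c - y c| ≤ Fintype.card C * e := by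
  have hc : (1 : ℝ) ≤ Fintype.card C := by
    exact_mod_cast Fintype.card_pos_iff.2 ⟨c⟩
  rw [abs_le]
  constructor
  · nlinarith [h c]
  · have h1 : x c - y c + e ≤ ∑ c, (x c - y c + e) :=
      Finset.single_le_sum (f := fun c => x c - y c + e) (fun c _ => by linarith [h c])
        (Finset.mem_univ c)
    rw [Finset.sum_add_distrib, Finset.sum_sub_distrib, Finset.sum_const, Finset.card_univ,
      nsmul_eq_mul] at h1
    linarith

lemma sum_meanView_le_one {M : Type*} [Fintype M] {m n k : ℕ} (G : regularGraphs (m + 1) n)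
    (f : Fin n → M) : ∑ c, meanView k G f c ≤ 1 := by
  simp only [meanView]
  rw [← Finset.sum_div, Finset.sum_comm]
  refine div_le_one_of_le₀ ((Finset.sum_le_sum fun s _ => sum_emp_le_one _).trans ?_)
    (Nat.cast_nonneg _)
  rw [Finset.sum_const, Finset.card_univ, nsmul_eq_mul, mul_one]

lemma abs_meanView_sub_le {M : Type*} [Fintype M] {m n k : ℕ} {p : (BallIx m k → M) → ℝ}
    (hp1 : ∑ a, p a = 1) (hp : ∀ κ ρ a, p (fun i => a (rotBall κ ρ i)) = p a)
    (G : regularGraphs (m + 1) n) (f : Fin n → M) {ε : ℝ} (hε : 0 ≤ ε)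
    (h : ∀ a, p a - ε ≤ bfsFreq G.1 f a)
    (c : (BallIx m k → M) × (Fin (m + 1) × Wd m k → Fin (m + 1))) :
    |meanView k G f c - p c.1 * (Fintype.card (Fin (m + 1) × Wd m k → Fin (m + 1)) : ℝ)⁻¹| ≤
      Fintype.card ((BallIx m k → M) × (Fin (m + 1) × Wd m k → Fin (m + 1))) *
        (Fintype.card (BallIx m k → M) * ε) := by
  refine (abs_sub_le_of_sub_le_of_sum_le (x := meanView k G f)
    (y := fun c : (BallIx m k → M) × (Fin (m + 1) × Wd m k → Fin (m + 1)) =>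
      p c.1 * (Fintype.card (Fin (m + 1) × Wd m k → Fin (m + 1)) : ℝ)⁻¹)
    (e := Fintype.card (BallIx m k → M) * ε) (by positivity) (fun c => ?_) ?_ c).trans
    (le_of_eq (by congr!))
  · refine le_trans ?_ (sum_bfsFreq_mul_viewProb_le G f c)
    have h1 := Finset.sum_le_sum fun a (_ : a ∈ Finset.univ) =>
      mul_le_mul_of_nonneg_right (h a) (viewProb_nonneg a c)
    refine le_trans ?_ h1
    simp only [sub_mul]
    rw [Finset.sum_sub_distrib, sum_mul_viewProb hp c]
    gcongr
    calc ∑ a, ε * viewProb a c ≤ ∑ a : BallIx m k → M, ε :=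
          Finset.sum_le_sum fun a _ => mul_le_of_le_one_right hε (viewProb_le_one a c)
      _ = _ := by
        rw [Finset.sum_const, Finset.card_univ, nsmul_eq_mul]
  · refine (sum_meanView_le_one G f).trans (le_of_eq ?_)
    rw [Fintype.sum_prod_type]
    simp only [Finset.sum_const, Finset.card_univ, nsmul_eq_mul]
    rw [← Finset.mul_sum, ← Finset.sum_mul, hp1, one_mul, mul_inv_cancel₀]
    exact_mod_cast Fintype.card_ne_zero

lemma card_mul_card_le_of_half {α β : Type*} [Fintype α] [Fintype β] (X : Finset (α × β))
    (A : Finset α)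
    (h : ∀ a ∈ A, Fintype.card β ≤ 2 * (Finset.univ.filter fun b => (a, b) ∈ X).card) :
    A.card * Fintype.card β ≤ 2 * X.card := by
  calc A.card * Fintype.card β = ∑ a ∈ A, Fintype.card β := by simp
    _ ≤ ∑ a ∈ A, 2 * (Finset.univ.filter fun b => (a, b) ∈ X).card := Finset.sum_le_sum h
    _ = 2 * (A.sigma fun a => Finset.univ.filter fun b => (a, b) ∈ X).card := by
      rw [← Finset.mul_sum, Finset.card_sigma]
    _ ≤ 2 * X.card := by
      refine Nat.mul_le_mul_left 2 (Finset.card_le_card_of_injOn (fun x => (x.1, x.2)) ?_ ?_)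
      · rintro ⟨a, b⟩ hx
        simp at hx
        exact hx.2
      · rintro ⟨a, b⟩ - ⟨a', b'⟩ - h
        simp at h
        simp [h]

lemma frequently_lt_of_lt_limsup_real {ι : Type*} {F : Filter ι} {u : ι → ℝ} {b : ℝ} (hb : 0 ≤ b)
    (h : b < F.limsup u) : ∃ᶠ i in F, b < u i := by
  intro hF
  have hF' : b ∈ {a | ∀ᶠ i in F, u i ≤ a} := hF.mono fun i hi => not_lt.1 hi
  rw [Filter.limsup_eq] at h
  by_cases hbd : BddBelow {a | ∀ᶠ i in F, u i ≤ a}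
  · exact absurd (csInf_le hbd hF') (not_le.2 h)
  · rw [Real.sInf_of_not_bddBelow hbd] at h
    linarith

lemma WeaklyTypical.exists_frequently {M : Type*} [MeasurableSpace M] {d : ℕ}
    {μ : Measure (TdVertex d → M)} (h : WeaklyTypical d μ) {ε' : ℝ} (hε' : 0 < ε') :
    ∃ ε, 0 < ε ∧ ε < ε' ∧ ∀ N, ∃ n ≥ N, 1 / 2 < typicalPr d μ ε n := by
  have h1 : ∀ᶠ ε in 𝓝[>] (0 : ℝ), 1 / 2 < (goodFilter d).limsup fun n => typicalPr d μ ε n :=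
    h.eventually (lt_mem_nhds (by norm_num))
  have h2 : ∀ᶠ ε in 𝓝[>] (0 : ℝ), ε ∈ Set.Ioo 0 ε' := Ioo_mem_nhdsGT hε'
  obtain ⟨ε, h3, h4, h5⟩ := (h1.and h2).exists
  refine ⟨ε, h4, h5, fun N => ?_⟩
  have h6 := (frequently_lt_of_lt_limsup_real (by norm_num) h3).filter_mono
    (inf_le_left : goodFilter d ≤ atTop)
  obtain ⟨n, hn, hn'⟩ := (Filter.frequently_atTop.1 h6) N
  exact ⟨n, hn, hn'⟩

lemma ncard_regularGraphs_lt {d n : ℕ} {A : Set (SimpleGraph (Fin n))} (h : 1 / 2 < PrG d n A) :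
    (regularGraphs d n).ncard <
      2 * (Finset.univ.filter fun G : regularGraphs d n => G.1 ∈ A).card := by
  have h1 : (Finset.univ.filter fun G : regularGraphs d n => G.1 ∈ A).card =
      (regularGraphs d n ∩ A).ncard := by
    rw [← Set.ncard_coe_finset, ← Set.ncard_image_of_injective _ Subtype.val_injective]
    congr 1
    ext G
    simp [and_comm]
  rw [h1]
  unfold PrG at h
  have h0 : (0 : ℝ) < (regularGraphs d n).ncard := by
    rcases (Nat.cast_nonneg (α := ℝ) (regularGraphs d n).ncard).eq_or_lt with h2 | h2
    · rw [← h2, div_zero] at h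
      norm_num at h
    · exact h2
  rw [lt_div_iff₀ h0] at h
  have : ((regularGraphs d n).ncard : ℝ) < 2 * (regularGraphs d n ∩ A).ncard := by linarith
  exact_mod_cast this

lemma exists_forall_pow_mul_exp_lt_one (d K A B : ℕ) {η : ℝ} (hη : 0 < η) :
    ∃ N : ℕ, ∀ n ≥ N, 8 * (1 + ((n : ℝ) * d) ^ 2) ^ K * (((n : ℝ) + 1) ^ A *
      (Real.exp 1 * (n * d + 1)) ^ B) * Real.exp (-(n * η)) < 1 := by
  have h1 : Tendsto (fun x : ℝ => x ^ (2 * K + A + B) * Real.exp (-(η * x))) atTop (𝓝 0) := by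
    have := (isLittleO_pow_exp_pos_mul_atTop (2 * K + A + B) hη).tendsto_div_nhds_zero
    refine this.congr fun x => ?_
    rw [Real.exp_neg, div_eq_mul_inv]
  have h2 : Tendsto (fun n : ℕ => (n : ℝ) + 1) atTop atTop :=
    tendsto_atTop_add_const_right _ _ tendsto_natCast_atTop_atTop
  set Q : ℝ := 8 * (((d : ℝ) + 1) ^ 2) ^ K * (Real.exp 1 * (d + 1)) ^ B * Real.exp η with hQ
  have h3 := (h1.comp h2).const_mul Q
  rw [mul_zero] at h3
  obtain ⟨N, hN⟩ := (h3.eventually (gt_mem_nhds (by norm_num : (0 : ℝ) < 1))).exists_forall_of_atTop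
  refine ⟨N, fun n hn => lt_of_le_of_lt ?_ (hN n hn)⟩
  have hn0 : (0 : ℝ) ≤ n := Nat.cast_nonneg n
  have hd0 : (0 : ℝ) ≤ d := Nat.cast_nonneg d
  have e1 : 1 + ((n : ℝ) * d) ^ 2 ≤ (d + 1) ^ 2 * (n + 1) ^ 2 := by
    rw [← mul_pow]
    nlinarith [mul_nonneg hn0 hd0]
  have e2 : Real.exp 1 * ((n : ℝ) * d + 1) ≤ Real.exp 1 * (d + 1) * (n + 1) := by
    rw [mul_assoc]
    gcongr
    nlinarith
  calc _ ≤ 8 * (((d : ℝ) + 1) ^ 2 * (n + 1) ^ 2) ^ K * (((n : ℝ) + 1) ^ A *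
      (Real.exp 1 * (d + 1) * (n + 1)) ^ B) * Real.exp (-(n * η)) := by gcongr
    _ = _ := by
      have e3 : Real.exp (-(n * η)) = Real.exp η * Real.exp (-(η * (n + 1))) := by
        rw [← Real.exp_add]
        congr 1
        ring
      simp only [Function.comp]
      rw [e3, hQ]
      generalize (n : ℝ) + 1 = x
      generalize (d : ℝ) + 1 = y
      ring

lemma one_le_of_count {N g S X Q T : ℕ} {P E : ℝ} (h1 : N < 2 * g) (h2 : g * S ≤ 2 * X) (hS : 0 < S)
    (h3 : Q ≤ 2 * (T * (N * S))) (hP : 0 ≤ P) (hE : 0 ≤ E) (h4 : (X : ℝ) ≤ Q * (P * E)) :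
    1 ≤ 8 * (T : ℝ) * P * E := by
  by_contra! h
  have h5 : N * S < 2 * g * S := Nat.mul_lt_mul_of_pos_right h1 hS
  have h6 : ((N * S : ℕ) : ℝ) < 4 * X := by
    have : N * S < 4 * X := by linarith
    exact_mod_cast this
  have h7 : (Q : ℝ) ≤ 2 * (T * (N * S : ℕ)) := by
    exact_mod_cast h3
  have h8 : (Q : ℝ) * (P * E) ≤ 2 * (T * (N * S : ℕ)) * (P * E) := by gcongr
  have h9 := mul_le_mul_of_nonneg_left h.le (Nat.cast_nonneg (α := ℝ) (N * S))
  linarith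

lemma SigmaR_nonneg_of_weaklyTypical {m k : ℕ} (hm : 1 ≤ m) {M : Type} [Fintype M]
    [MeasurableSpace M] [DiscreteMeasurableSpace M] {μ : Measure (TdVertex (m + 1) → M)}
    (hμ : μ ∈ InvMeas (m + 1) M) (htyp : WeaklyTypical (m + 1) μ) :
    0 ≤ SigmaR (m + 1) (k + 1) μ := by
  by_contra! hneg
  have hprob := hμ.1
  obtain ⟨pS, hpS⟩ : ∃ pS : (BallIx m k → M) → ℝ, pS = fun a => (ballLaw k μ).real {a} := ⟨_, rfl⟩
  obtain ⟨pE, hpE⟩ : ∃ pE : (EdgeIx m k → M) → ℝ, pE = fun a => (edgeLaw k μ).real {a} := ⟨_, rfl⟩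
  have hS1 : ∑ a, pS a = 1 := by
    rw [hpS, sum_measureReal_singleton, Finset.coe_univ]
    exact probReal_univ
  have hE1 : ∑ a, pE a = 1 := by
    rw [hpE, sum_measureReal_singleton, Finset.coe_univ]
    exact probReal_univ
  have hpSE : ∀ i y, ∑ a, (if (fun e => a (edgeToBall i e)) = y then pS a else 0) = pE y := by
    rw [hpS, hpE]
    exact sum_ballLaw_edgeToBall hμ
  have hrot : ∀ κ ρ a, pS (fun i => a (rotBall κ ρ i)) = pS a := by
    rw [hpS]
    exact ballLaw_rotBall hμ
  have hSigma : SigmaR (m + 1) (k + 1) μ = ent pS - ((m + 1 : ℕ) : ℝ) / 2 * ent pE := by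
    rw [SigmaR, shannon_restrictTo_SrSet, shannon_restrictTo_ErSet, hpS, hpE]
  obtain ⟨η, hη⟩ : ∃ η, η = -SigmaR (m + 1) (k + 1) μ / 2 := ⟨_, rfl⟩
  have hη0 : 0 < η := by linarith
  obtain ⟨δ, hδ, A, B, hcount⟩ := card_numbered_graphs_le pS pE hS1 hE1 hpSE hη0
  obtain ⟨n₀, hn₀⟩ := exists_half_close_to_mean M m k (half_pos hδ)
  set C : ℝ := Fintype.card ((BallIx m k → M) × (Fin (m + 1) × Wd m k → Fin (m + 1))) *
    Fintype.card (BallIx m k → M) with hC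
  have hC0 : 0 ≤ C := by positivity
  obtain ⟨ε', hε'⟩ : ∃ ε', ε' = min ((2 : ℝ)⁻¹ ^ (k + 1)) (δ / 2 / (C + 1)) := ⟨_, rfl⟩
  have hε'0 : 0 < ε' := by
    rw [hε']
    exact lt_min (by positivity) (by positivity)
  have hε'1 : ε' ≤ (2 : ℝ)⁻¹ ^ (k + 1) := hε'.trans_le (min_le_left _ _)
  have hε'2 : C * ε' ≤ δ / 2 := by
    have : ε' * (C + 1) ≤ δ / 2 := (le_div_iff₀ (by positivity)).1 (hε'.trans_le (min_le_right _ _))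
    nlinarith
  obtain ⟨ε, hε0, hεε', hfreq⟩ := htyp.exists_frequently hε'0
  obtain ⟨d, hd⟩ : ∃ d, d = m + 1 := ⟨_, rfl⟩
  obtain ⟨K, hK⟩ : ∃ K, K = 2 * (2 * d + 4 * d ^ 2) := ⟨_, rfl⟩
  obtain ⟨N, hN⟩ := exists_forall_pow_mul_exp_lt_one d K A B hη0
  obtain ⟨n, hn, htn⟩ := hfreq (n₀ + N + 4 + (K + 2 * ((2 + 2 * d) * d)) + 1)
  have hnd : n ≤ n * d := Nat.le_mul_of_pos_right n (by omega)
  have hmatch := card_matchings_le_regularGraphs (d := d) (n := n) (by omega) (by omega)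
  rw [← hK, hd] at hmatch
  have hreg := ncard_regularGraphs_lt htn
  set 𝒢 := Finset.univ.filter fun G : regularGraphs (m + 1) n => G.1 ∈
    {G : SimpleGraph (Fin n) | ∃ f : Fin n → M,
      levyProkhorovDist (distrG G f) (lawTd (m + 1) μ) ≤ ε} with h𝒢
  have hreg' : (regularGraphs (m + 1) n).ncard < 2 * 𝒢.card := by convert hreg
  have hhalf := card_mul_card_le_of_half (Finset.univ.filter
    fun x : regularGraphs (m + 1) n × (Fin n → Equiv.Perm (Fin (m + 1))) =>
        ∃ f : Fin n → M, ∀ a, |emp (localView k (portMatching (portOf x.1 x.2)) f) a -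
          pS a.1 * ((Fintype.card (Fin (m + 1) × Wd m k → Fin (m + 1)) : ℝ))⁻¹| ≤ δ) 𝒢 (by
    intro G hG
    rw [h𝒢, Finset.mem_filter] at hG
    obtain ⟨f, hf⟩ := hG.2
    refine (hn₀ n (by omega) G f).trans ?_
    gcongr with s hs
    intro hs'
    rw [Finset.mem_filter]
    refine ⟨Finset.mem_univ _, f, fun c => ?_⟩
    have h1 := abs_meanView_sub_le hS1 hrot G f hε'0.le (fun a => by
      rw [hpS]
      exact ballLaw_sub_le_bfsFreq (by omega) G.1 f μ hε0.le hεε' hε'1 hf a) c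
    rw [← mul_assoc, ← hC] at h1
    have h2 := abs_sub_le (emp (localView k (portMatching (portOf G s)) f) c) (meanView k G f c)
      (pS c.1 * ((Fintype.card (Fin (m + 1) × Wd m k → Fin (m + 1)) : ℝ))⁻¹)
    linarith [hs' c])
  have hcard : Fintype.card (Fin n → Equiv.Perm (Fin (m + 1))) = (m + 1).factorial ^ n := by
    rw [Fintype.card_fun, Fintype.card_perm, Fintype.card_fin, Fintype.card_fin]
  have hc := hcount n
  set X := Finset.univ.filter
    fun x : regularGraphs (m + 1) n × (Fin n → Equiv.Perm (Fin (m + 1))) =>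
        ∃ f : Fin n → M, ∀ a, |emp (localView k (portMatching (portOf x.1 x.2)) f) a -
          pS a.1 * ((Fintype.card (Fin (m + 1) × Wd m k → Fin (m + 1)) : ℝ))⁻¹| ≤ δ
  have hNn := hN n (by omega)
  rw [← hSigma, show SigmaR (m + 1) (k + 1) μ + η = -η by linarith, mul_neg] at hc
  rw [hd] at hNn
  rw [hcard] at hhalf
  have hT : (((1 + (n * (m + 1)) ^ 2) ^ K : ℕ) : ℝ) = (1 + ((n : ℝ) * (m + 1 : ℕ)) ^ 2) ^ K := by
    push_cast
    rfl
  refine absurd hNn (not_lt.2 ?_)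
  rw [← hT]
  exact one_le_of_count hreg' hhalf (pow_pos (Nat.factorial_pos _) n) hmatch (by positivity)
    (Real.exp_pos _).le hc

/-- If `μ ∈ I_d(M)` is weakly typical then `Σ(μ) ≥ 0`. -/
theorem weakly_typical_Sigma_nonneg
    (d : ℕ) (hd : 3 ≤ d) (M : Type) [Fintype M] [MeasurableSpace M]
    [DiscreteMeasurableSpace M]
    (μ : Measure (TdVertex d → M)) (hμ : μ ∈ InvMeas d M)
    (htyp : WeaklyTypical d μ) :
    (0 : EReal) ≤ SigmaInf d μ := by
  obtain ⟨m, rfl⟩ : ∃ m, d = m + 1 := ⟨d - 1, by omega⟩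
  exact le_iInf fun k => by
    exact_mod_cast SigmaR_nonneg_of_weaklyTypical (k := k) (by omega) hμ htyp

end TreeEntropy
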